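/- Consider a linear operator on ℝᵈ of the form Lu = (1/2)aⁱʲ ∂_{ij}u + bⁱ∂_i u + cu, where the matrix a = σσᵀ is bounded on ℝᵈ, has a uniform modulus of continuity on ℝᵈ, and is uniformly elliptic (minimum eigenvalue bounded away from zero on ℝᵈ), and the coefficients b and c are locally bounded and measurable. Then there exists a constant C̃₀ such that every positive strong solution u ∈ W^{2,p}_loc(ℝᵈ), p > d, of Lu = 0 on ℝᵈ satisfies the gradient estimate |∇u(x)|/u(x) ≤ C̃₀ [1 + sup_{y ∈ B₁(x)} (|b(y)| + √|c(y)|)] for all x ∈ ℝᵈ. -/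

import Mathlib

open MeasureTheory Filter Topology Metric Set
open scoped Matrix ENNReal NNReal

noncomputable section

namespace RS

variable {d : ℕ} {K : Type*}

abbrev Vec (d : ℕ) := Fin d → ℝ

/-- Euclidean norm on `Vec d`. -/
def nrm (x : Vec d) : ℝ := Real.sqrt (∑ i, (x i) ^ 2)

/-- Hilbert–Schmidt norm of a matrix. -/
def hsNorm (M : Matrix (Fin d) (Fin d) ℝ) : ℝ := Real.sqrt (∑ i, ∑ j, (M i j) ^ 2)

/-- The gradient, as the vector of partial derivatives. -/
def grad (f : Vec d → ℝ) (x : Vec d) : Vec d := fun i => fderiv ℝ f x (Pi.single i 1)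

/-- The Hessian matrix. -/
def hess (f : Vec d → ℝ) (x : Vec d) : Matrix (Fin d) (Fin d) ℝ := fun i j =>
  fderiv ℝ (fun y => fderiv ℝ f y (Pi.single j 1)) x (Pi.single i 1)

/-- `trProd A H = trace (A ⬝ H)`. -/
def trProd (A H : Matrix (Fin d) (Fin d) ℝ) : ℝ := ∑ i, ∑ j, A i j * H j i

/-- The diffusion matrix `a = σ σᵀ`. -/
def amat (σm : Vec d → Matrix (Fin d) (Fin d) ℝ) (x : Vec d) : Matrix (Fin d) (Fin d) ℝ :=
  σm x * (σm x)ᵀ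

/-- `L_β f = ½ tr(a ∇²f) + ⟨β, ∇f⟩`, the generator with drift `β`. -/
def Lop (σm : Vec d → Matrix (Fin d) (Fin d) ℝ) (β : Vec d → Vec d) (f : Vec d → ℝ)
    (x : Vec d) : ℝ :=
  (1 / 2) * trProd (amat σm x) (hess f x) + (β x) ⬝ᵥ (grad f x)

/-- `L_ξ f = ½ tr(a ∇²f) + ⟨b(·,ξ), ∇f⟩`. -/
def Lxi (σm : Vec d → Matrix (Fin d) (Fin d) ℝ) (b : Vec d → K → Vec d) (ξ : K)
    (f : Vec d → ℝ) (x : Vec d) : ℝ :=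
  (1 / 2) * trProd (amat σm x) (hess f x) + (b x ξ) ⬝ᵥ (grad f x)

/-- The semilinear (maximal) operator `𝒢`. -/
def Gop (σm : Vec d → Matrix (Fin d) (Fin d) ℝ) (b : Vec d → K → Vec d)
    (c : Vec d → K → ℝ) (f : Vec d → ℝ) (x : Vec d) : ℝ :=
  (1 / 2) * trProd (amat σm x) (hess f x) +
    ⨆ ξ : K, ((b x ξ) ⬝ᵥ (grad f x) + c x ξ * f x)

/-- The minimal operator `𝒢̂` (risk-sensitive cost minimization). -/
def Gmin (σm : Vec d → Matrix (Fin d) (Fin d) ℝ) (b : Vec d → K → Vec d)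
    (c : Vec d → K → ℝ) (f : Vec d → ℝ) (x : Vec d) : ℝ :=
  (1 / 2) * trProd (amat σm x) (hess f x) +
    ⨅ ξ : K, ((b x ξ) ⬝ᵥ (grad f x) + c x ξ * f x)

/-- `g` is the weak (distributional) `i`-th partial derivative of `f` on `ℝᵈ`. -/
def IsWeakPartial (f g : Vec d → ℝ) (i : Fin d) : Prop :=
  ∀ φ : Vec d → ℝ, ContDiff ℝ (⊤ : ℕ∞) φ → HasCompactSupport φ →
    ∫ x : Vec d, f x * fderiv ℝ φ x (Pi.single i 1) = -∫ x : Vec d, g x * φ x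

/-- Data witnessing membership in `W^{2,p}_loc(ℝᵈ)` (with continuous representative):
`g` is the weak gradient and `H` the weak Hessian of `φ`, with local `L^p` bounds. -/
def IsW2loc (p : ℝ) (φ : Vec d → ℝ) (g : Vec d → Vec d)
    (H : Vec d → Matrix (Fin d) (Fin d) ℝ) : Prop :=
  Continuous φ ∧
  (∀ i, AEMeasurable (fun x => g x i) (volume : Measure (Vec d))) ∧
  (∀ i j, AEMeasurable (fun x => H x i j) (volume : Measure (Vec d))) ∧
  (∀ i, IsWeakPartial φ (fun x => g x i) i) ∧
  (∀ i j, IsWeakPartial (fun x => g x j) (fun x => H x i j) i) ∧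
  (∀ R : ℝ, ∀ i, IntegrableOn (fun x => |g x i| ^ p) {x : Vec d | nrm x ≤ R} volume) ∧
  (∀ R : ℝ, ∀ i j, IntegrableOn (fun x => |H x i j| ^ p) {x : Vec d | nrm x ≤ R} volume)

/-- The generalized principal eigenvalue `λ*` of the semilinear operator `𝒢` on `ℝᵈ`. -/
def lamStar (σm : Vec d → Matrix (Fin d) (Fin d) ℝ) (b : Vec d → K → Vec d)
    (c : Vec d → K → ℝ) : ℝ :=
  sInf {lam : ℝ | ∃ φ g H, IsW2loc (d : ℝ) φ g H ∧ (∀ x, 0 < φ x) ∧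
    ∀ᵐ x ∂(volume : Measure (Vec d)),
      (1 / 2) * trProd (amat σm x) (H x) +
        (⨆ ξ : K, ((b x ξ) ⬝ᵥ (g x) + c x ξ * φ x)) ≤ lam * φ x}

/-- The generalized principal eigenvalue `λ_v` of `L_v + c_v` on `ℝᵈ`. -/
def lamGenV (σm : Vec d → Matrix (Fin d) (Fin d) ℝ) (bv : Vec d → Vec d)
    (cv : Vec d → ℝ) : ℝ :=
  sInf {lam : ℝ | ∃ φ g H, IsW2loc (d : ℝ) φ g H ∧ (∀ x, 0 < φ x) ∧
    ∀ᵐ x ∂(volume : Measure (Vec d)),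
      (1 / 2) * trProd (amat σm x) (H x) + (bv x) ⬝ᵥ (g x) + cv x * φ x ≤ lam * φ x}

/-- The generalized principal eigenvalue `λ̂*` of the minimal operator `𝒢̂` on `ℝᵈ`. -/
def lamHat (σm : Vec d → Matrix (Fin d) (Fin d) ℝ) (b : Vec d → K → Vec d)
    (c : Vec d → K → ℝ) : ℝ :=
  sInf {lam : ℝ | ∃ φ g H, IsW2loc (d : ℝ) φ g H ∧ (∀ x, 0 < φ x) ∧
    ∀ᵐ x ∂(volume : Measure (Vec d)),
      (1 / 2) * trProd (amat σm x) (H x) +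
        (⨅ ξ : K, ((b x ξ) ⬝ᵥ (g x) + c x ξ * φ x)) ≤ lam * φ x}

/-! ### Partial derivatives of test functions -/

/-- The `i`-th partial derivative. -/
def pd (i : Fin d) (f : Vec d → ℝ) (x : Vec d) : ℝ := fderiv ℝ f x (Pi.single i 1)

/-- The Laplacian. -/
def lap (f : Vec d → ℝ) (x : Vec d) : ℝ := ∑ i, pd i (pd i f) x

/-- The squared Hilbert–Schmidt norm of the Hessian. -/
def hessSq (f : Vec d → ℝ) (x : Vec d) : ℝ := ∑ i, ∑ j, (pd i (pd j f) x) ^ 2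

/-- The closed cube of half-side `r` centred at the origin. -/
def cube (r : ℝ) : Set (Vec d) := closedBall 0 r

/-- Smooth compactly supported functions. -/
structure IsTest (v : Vec d → ℝ) : Prop where
  smooth : ContDiff ℝ (⊤ : ℕ∞) v
  compact : HasCompactSupport v

namespace IsTest

variable {v w : Vec d → ℝ}

theorem continuous (h : IsTest v) : Continuous v := h.smooth.continuous

theorem differentiable (h : IsTest v) : Differentiable ℝ v := h.smooth.differentiable (by simp)

theorem integrable (h : IsTest v) : Integrable v :=
  h.continuous.integrable_of_hasCompactSupport h.compact

theorem pd (h : IsTest v) (i : Fin d) : IsTest (pd i v) where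
  smooth := by
    have := (h.smooth.fderiv_right (m := (⊤ : ℕ∞)) (by simp))
    exact this.clm_apply contDiff_const
  compact := by
    have h1 : HasCompactSupport (fderiv ℝ v) := h.compact.fderiv (𝕜 := ℝ)
    exact h1.comp_left (g := fun L : Vec d →L[ℝ] ℝ => L (Pi.single i 1)) (by simp)

theorem mul_left (h : IsTest v) (hw : ContDiff ℝ (⊤ : ℕ∞) w) : IsTest (fun x => w x * v x) where
  smooth := hw.mul h.smooth
  compact := h.compact.mul_left

theorem mul (hw : IsTest w) (h : IsTest v) : IsTest (fun x => w x * v x) :=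
  h.mul_left hw.smooth

theorem sub (hw : IsTest w) (h : IsTest v) : IsTest (fun x => w x - v x) where
  smooth := hw.smooth.sub h.smooth
  compact := hw.compact.sub h.compact

theorem add (hw : IsTest w) (h : IsTest v) : IsTest (fun x => w x + v x) where
  smooth := hw.smooth.add h.smooth
  compact := hw.compact.add h.compact

theorem lap (h : IsTest v) : IsTest (lap v) where
  smooth := ContDiff.sum fun i _ => ((h.pd i).pd i).smooth
  compact := by
    have : HasCompactSupport (fun x => ∑ i, RS.pd i (RS.pd i v) x) := by
      classical
      have : ∀ s : Finset (Fin d),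
          HasCompactSupport (fun x => ∑ i ∈ s, RS.pd i (RS.pd i v) x) := by
        intro s
        induction s using Finset.induction_on with
        | empty => exact (HasCompactSupport.zero : HasCompactSupport (0 : Vec d → ℝ))
        | insert a s ha ih =>
          simp only [Finset.sum_insert ha]
          exact ((h.pd a).pd a).compact.add ih
      exact this _
    exact this

theorem continuous_hessSq (h : IsTest v) : Continuous (hessSq v) :=
  continuous_finsetSum _ fun i _ => continuous_finsetSum _ fun j _ =>
    (((h.pd j).pd i).continuous).pow 2

end IsTest

theorem fderiv_eq_sum_pd (v : Vec d → ℝ) (x h : Vec d) :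
    fderiv ℝ v x h = ∑ i, h i * pd i v x := by
  conv_lhs => rw [pi_eq_sum_univ' h]
  rw [map_sum]
  refine Finset.sum_congr rfl fun i _ => ?_
  rw [map_smul, smul_eq_mul, pd]

theorem pd_comm {v : Vec d → ℝ} (h : IsTest v) (i j : Fin d) (x : Vec d) :
    pd i (pd j v) x = pd j (pd i v) x := by
  have h1 : Differentiable ℝ (fderiv ℝ v) :=
    (h.smooth.fderiv_right (m := (⊤ : ℕ∞)) (by simp)).differentiable (by simp)
  have h2 : ∀ a b : Fin d, pd a (pd b v) x
      = fderiv ℝ (fderiv ℝ v) x (Pi.single a 1) (Pi.single b 1) := by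
    intro a b
    change fderiv ℝ (fun y => fderiv ℝ v y (Pi.single b 1)) x (Pi.single a 1) = _
    rw [fderiv_clm_apply (h1 x) (differentiableAt_const _)]
    simp
  rw [h2, h2]
  have : IsSymmSndFDerivAt ℝ v x :=
    h.smooth.contDiffAt.isSymmSndFDerivAt (by
      simp only [minSmoothness_of_isRCLikeNormedField]
      exact WithTop.coe_le_coe.2 (le_top : (2 : ℕ∞) ≤ ⊤))
  exact this _ _

theorem pd_add {v w : Vec d → ℝ} (hv : Differentiable ℝ v) (hw : Differentiable ℝ w) (i : Fin d) :
    pd i (fun x => v x + w x) = fun x => pd i v x + pd i w x := by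
  ext x; simp only [pd]; rw [fderiv_fun_add (hv x) (hw x)]; simp

theorem pd_sub {v w : Vec d → ℝ} (hv : Differentiable ℝ v) (hw : Differentiable ℝ w) (i : Fin d) :
    pd i (fun x => v x - w x) = fun x => pd i v x - pd i w x := by
  ext x; simp only [pd]; rw [fderiv_fun_sub (hv x) (hw x)]; simp

theorem pd_mul {v w : Vec d → ℝ} (hv : Differentiable ℝ v) (hw : Differentiable ℝ w) (i : Fin d) :
    pd i (fun x => v x * w x) = fun x => pd i v x * w x + v x * pd i w x := by
  ext x; simp only [pd]; rw [fderiv_fun_mul (hv x) (hw x)]; simp; ring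

theorem pd_const_mul {v : Vec d → ℝ} (hv : Differentiable ℝ v) (c : ℝ) (i : Fin d) :
    pd i (fun x => c * v x) = fun x => c * pd i v x := by
  ext x; simp only [pd]; rw [fderiv_const_mul (hv x)]; simp

theorem hasDerivAt_comp_line {v : Vec d → ℝ} (hv : Differentiable ℝ v) (x z : Vec d) (t : ℝ) :
    HasDerivAt (fun s : ℝ => v (x - s • z)) (-∑ i, z i * pd i v (x - t • z)) t := by
  have h1 : HasDerivAt (fun s : ℝ => x - s • z) (-z) t := by
    simpa using ((hasDerivAt_id t).smul_const z).const_sub x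
  have := (hv (x - t • z)).hasFDerivAt.comp_hasDerivAt t h1
  rw [fderiv_eq_sum_pd] at this
  simpa [Function.comp_def] using this

theorem hasLineDerivAt_comp_dilation {v : Vec d → ℝ} (hv : Differentiable ℝ v) (x z : Vec d)
    (t : ℝ) (i : Fin d) :
    HasLineDerivAt ℝ (fun y => v (x - t • y)) (-t * pd i v (x - t • z)) z (Pi.single i 1) := by
  have h1 : HasFDerivAt (fun y : Vec d => x - t • y) (-(t • ContinuousLinearMap.id ℝ (Vec d))) z :=
    ((hasFDerivAt_id z).const_smul t).const_sub x
  have h2 := ((hv (x - t • z)).hasFDerivAt.comp z h1).hasLineDerivAt (Pi.single i 1)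
  refine h2.congr_deriv ?_ 
  simp [pd]

/-- Integration by parts for test functions. -/
theorem integral_mul_pd {v w : Vec d → ℝ} (hv : IsTest v) (hw : IsTest w) (i : Fin d) :
    ∫ x, v x * pd i w x = -∫ x, pd i v x * w x :=
  integral_mul_fderiv_eq_neg_fderiv_mul_of_integrable ((hv.pd i).mul hw).integrable
    (hv.mul (hw.pd i)).integrable (hv.mul hw).integrable (fun x _ => hv.differentiable x)
    (fun x _ => hw.differentiable x)

theorem integrable_sum_test {ι : Type*} (s : Finset ι) {f : ι → Vec d → ℝ}
    (h : ∀ i ∈ s, IsTest (f i)) : Integrable (fun x => ∑ i ∈ s, f i x) :=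
  integrable_finsetSum _ fun i hi => (h i hi).integrable

/-- The Hessian and the Laplacian of a test function have the same `L²` norm. -/
theorem integral_hessSq_eq {v : Vec d → ℝ} (hv : IsTest v) :
    ∫ x, hessSq v x = ∫ x, (lap v x) ^ 2 := by
  have key : ∀ i j : Fin d, ∫ x, (pd i (pd j v) x) ^ 2
      = ∫ x, pd i (pd i v) x * pd j (pd j v) x := by
    intro i j
    have e1 : ∫ x, pd i (pd j v) x * pd i (pd j v) x
        = -∫ x, pd i (pd i (pd j v)) x * pd j v x :=
      integral_mul_pd ((hv.pd j).pd i) (hv.pd j) i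
    have e2 : ∫ x, pd i (pd i v) x * pd j (pd j v) x
        = -∫ x, pd j (pd i (pd i v)) x * pd j v x :=
      integral_mul_pd ((hv.pd i).pd i) (hv.pd j) j
    have e3 : ∀ x, pd j (pd i (pd i v)) x = pd i (pd i (pd j v)) x := by
      intro x
      rw [pd_comm (hv.pd i) j i x]
      congr 1
      ext y
      exact pd_comm hv j i y
    simp only [sq]
    rw [e1, e2]
    simp only [e3]
  have h2 : ∀ i j : Fin d, IsTest (fun x => (pd i (pd j v) x) ^ 2) := fun i j => by
    simpa only [sq] using ((hv.pd j).pd i).mul ((hv.pd j).pd i)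
  simp only [hessSq, lap]
  rw [integral_finsetSum _ fun i _ => integrable_sum_test _ fun j _ => h2 i j]
  simp only [sq (∑ i, pd i (pd i v) _), Finset.sum_mul_sum]
  rw [integral_finsetSum _ fun i _ => integrable_sum_test _ fun j _ =>
    ((hv.pd i).pd i).mul ((hv.pd j).pd j)]
  refine Finset.sum_congr rfl fun i _ => ?_
  rw [integral_finsetSum _ fun j _ => (h2 i j).integrable,
    integral_finsetSum _ fun j _ => (((hv.pd i).pd i).mul ((hv.pd j).pd j)).integrable]
  exact Finset.sum_congr rfl fun j _ => key i j

/-! ### Radial kernels -/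

/-- The radial kernel `(1 - |z|²)₊ᵏ`. -/
def psi (k : ℕ) (z : Vec d) : ℝ := (max 0 (1 - ∑ i, (z i) ^ 2)) ^ k

theorem psi_nonneg (k : ℕ) (z : Vec d) : 0 ≤ psi k z := pow_nonneg (le_max_left _ _) _

theorem psi_le_one (k : ℕ) (z : Vec d) : psi k z ≤ 1 :=
  pow_le_one₀ (le_max_left _ _) (max_le zero_le_one
    (sub_le_self _ (Finset.sum_nonneg fun _ _ => sq_nonneg _)))

theorem continuous_psi (k : ℕ) : Continuous (psi k : Vec d → ℝ) := by
  unfold psi; fun_prop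

theorem psi_eq_zero {k : ℕ} {z : Vec d} (hz : z ∉ cube 1) : psi (k + 1) z = 0 := by
  have : ∃ i, 1 < |z i| := by
    by_contra! h
    exact hz (by
      rw [cube, mem_closedBall_zero_iff]
      exact (pi_norm_le_iff_of_nonneg zero_le_one).2 h)
  obtain ⟨i, hi⟩ := this
  have h1 : 1 < (z i) ^ 2 := by rw [← sq_abs]; nlinarith
  have h2 : (z i) ^ 2 ≤ ∑ j, (z j) ^ 2 :=
    Finset.single_le_sum (f := fun j => (z j) ^ 2) (fun j _ => sq_nonneg _) (Finset.mem_univ i)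
  rw [psi, max_eq_left (by linarith)]
  simp

theorem hasCompactSupport_psi (k : ℕ) : HasCompactSupport (psi (k + 1) : Vec d → ℝ) :=
  HasCompactSupport.intro (isCompact_closedBall (0 : Vec d) 1) fun _ hz => psi_eq_zero hz

theorem integral_psi_pos (k : ℕ) : 0 < ∫ z : Vec d, psi (k + 1) z := by
  refine Continuous.integral_pos_of_hasCompactSupport_nonneg_nonzero (x := 0) (continuous_psi _)
    (hasCompactSupport_psi _) (psi_nonneg _) ?_
  simp [psi]

theorem hasDerivAt_max_zero_pow (k : ℕ) (s : ℝ) :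
    HasDerivAt (fun s : ℝ => (max 0 s) ^ (k + 2)) ((k + 2) * (max 0 s) ^ (k + 1)) s := by
  rcases lt_trichotomy s 0 with h | h | h
  · have : (fun s : ℝ => (max 0 s) ^ (k + 2)) =ᶠ[𝓝 s] fun _ => 0 := by
      filter_upwards [gt_mem_nhds h] with y hy
      simp [max_eq_left (le_of_lt hy)]
    rw [max_eq_left h.le]
    simpa using (hasDerivAt_const s (0 : ℝ)).congr_of_eventuallyEq this
  · subst h
    simp only [max_self]
    rw [hasDerivAt_iff_isLittleO]
    simp only [max_self, sub_zero, ne_eq, Nat.add_eq_zero_iff, OfNat.ofNat_ne_zero, and_false,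
      not_false_eq_true, zero_pow, one_ne_zero, mul_zero, smul_eq_mul]
    have h1 : (fun x : ℝ => (max 0 x) ^ (k + 2)) =O[𝓝 0] fun x : ℝ => x ^ (k + 2) := by
      refine Asymptotics.IsBigO.of_bound' (Eventually.of_forall fun x => ?_)
      rw [norm_pow, norm_pow]
      refine pow_le_pow_left₀ (norm_nonneg _) ?_ _
      rw [Real.norm_eq_abs, Real.norm_eq_abs, abs_of_nonneg (le_max_left _ _)]
      exact max_le (abs_nonneg _) (le_abs_self _)
    refine h1.trans_isLittleO ?_
    simpa using (Asymptotics.isLittleO_pow_pow (𝕜 := ℝ) (m := 1) (n := k + 2) (by omega))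
  · have : (fun s : ℝ => (max 0 s) ^ (k + 2)) =ᶠ[𝓝 s] fun s => s ^ (k + 2) := by
      filter_upwards [lt_mem_nhds h] with y hy
      simp [max_eq_right (le_of_lt hy)]
    rw [max_eq_right h.le]
    simpa using (hasDerivAt_pow (k + 2) s).congr_of_eventuallyEq this

theorem hasLineDerivAt_psi (k : ℕ) (z : Vec d) (i : Fin d) :
    HasLineDerivAt ℝ (psi (k + 2)) (-(2 * (k + 2)) * (z i * psi (k + 1) z)) z
      (Pi.single i 1) := by
  have h1 : HasDerivAt (fun t : ℝ => 1 - ∑ j, ((z + t • (Pi.single i 1 : Vec d)) j) ^ 2)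
      (-(2 * z i)) 0 := by
    have : ∀ j ∈ Finset.univ, HasDerivAt
        (fun t : ℝ => ((z + t • (Pi.single i 1 : Vec d)) j) ^ 2)
        (2 * z j * (Pi.single i 1 : Vec d) j) 0 := by
      intro j _
      have := (((hasDerivAt_id (0 : ℝ)).mul_const ((Pi.single i 1 : Vec d) j)).const_add
        (z j)).fun_pow 2
      simpa using this
    refine ((HasDerivAt.fun_sum this).const_sub 1).congr_deriv ?_
    simp [Pi.single_apply]
  have h2 := (hasDerivAt_max_zero_pow k (1 - ∑ j, (z j) ^ 2))
  unfold HasLineDerivAt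
  have h3 : HasDerivAt (fun t : ℝ => psi (k + 2) (z + t • (Pi.single i 1 : Vec d))) _ 0 :=
    HasDerivAt.comp (h₂ := fun s : ℝ => (max 0 s) ^ (k + 2)) (0 : ℝ) (by simpa using h2) h1
  refine h3.congr_deriv ?_
  rw [psi]; ring

/-- The average of `v(x - t z)` against the kernel `psi k`. -/
def avg (k : ℕ) (v : Vec d → ℝ) (t : ℝ) (x : Vec d) : ℝ := ∫ z, psi k z * v (x - t • z)

theorem integrable_psi_mul (k : ℕ) {f : Vec d → ℝ} (hf : Continuous f) :
    Integrable (fun z => psi (k + 1) z * f z) :=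
  ((continuous_psi _).mul hf).integrable_of_hasCompactSupport (hasCompactSupport_psi k).mul_right

theorem integral_coord_mul_psi (k : ℕ) {v : Vec d → ℝ} (hv : IsTest v) (t : ℝ) (x : Vec d)
    (i : Fin d) :
    t * avg (k + 2) (pd i v) t x
      = -(2 * (k + 2)) * ∫ z, psi (k + 1) z * (z i * v (x - t • z)) := by
  have hline : ∀ u : Vec d → ℝ, Continuous u → Continuous fun z : Vec d => u (x - t • z) :=
    fun u hu => hu.comp (by fun_prop)
  have h := integral_bilinear_hasLineDerivAt_right_eq_neg_left_of_integrable
    (μ := (volume : Measure (Vec d))) (B := ContinuousLinearMap.mul ℝ ℝ)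
    (f := psi (k + 2)) (f' := fun z : Vec d => -(2 * (k + 2)) * (z i * psi (k + 1) z))
    (g := fun z => v (x - t • z)) (g' := fun z => -t * pd i v (x - t • z))
    (v := Pi.single i 1) ?_ ?_ ?_ (fun z _ => hasLineDerivAt_psi k z i)
    (fun z _ => hasLineDerivAt_comp_dilation hv.differentiable x z t i)
  · simp only [ContinuousLinearMap.mul_apply'] at h
    rw [avg, ← integral_const_mul, ← integral_const_mul]
    rw [← neg_inj, ← integral_neg]
    convert h using 1
    · congr 1; ext z; ring
    · congr 2; ext z; ring
  · simp only [ContinuousLinearMap.mul_apply']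
    refine (integrable_psi_mul k (f := fun z => -(2 * (k + 2)) * (z i * v (x - t • z)))
      ?_).congr (ae_of_all _ fun z => by ring)
    exact continuous_const.mul ((continuous_apply i).mul (hline v hv.continuous))
  · simp only [ContinuousLinearMap.mul_apply']
    exact integrable_psi_mul (k + 1) (continuous_const.mul (hline _ (hv.pd i).continuous))
  · simp only [ContinuousLinearMap.mul_apply']
    exact integrable_psi_mul (k + 1) (hline _ hv.continuous)

theorem avg_sum (k : ℕ) {ι : Type*} (s : Finset ι) {f : ι → Vec d → ℝ}
    (h : ∀ i, Continuous (f i)) (t : ℝ) (x : Vec d) :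
    avg (k + 1) (fun y => ∑ i ∈ s, f i y) t x = ∑ i ∈ s, avg (k + 1) (f i) t x := by
  simp only [avg, Finset.mul_sum]
  exact integral_finsetSum _ fun i _ => integrable_psi_mul k
    (f := fun z : Vec d => f i (x - t • z)) ((h i).comp (by fun_prop : Continuous fun z : Vec d => x - t • z))

theorem norm_fderiv_bound {v : Vec d → ℝ} (hv : IsTest v) :
    ∃ C, ∀ i x, |pd i v x| ≤ C := by
  have : ∀ i, ∃ C, ∀ x, ‖pd i v x‖ ≤ C := fun i =>
    (hv.pd i).compact.exists_bound_of_continuous (hv.pd i).continuous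
  choose C hC using this
  refine ⟨∑ i, |C i|, fun i x => (hC i x).trans ((le_abs_self _).trans ?_)⟩
  exact Finset.single_le_sum (f := fun i => |C i|) (fun j _ => abs_nonneg _) (Finset.mem_univ i)

theorem hasDerivAt_avg_aux (k : ℕ) {v : Vec d → ℝ} (hv : IsTest v) (t : ℝ) (x : Vec d) :
    HasDerivAt (fun t => avg (k + 1) v t x)
      (∫ z, psi (k + 1) z * (-∑ i, z i * pd i v (x - t • z))) t := by
  obtain ⟨C, hC⟩ := norm_fderiv_bound hv
  refine (hasDerivAt_integral_of_dominated_loc_of_deriv_le (s := univ)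
    (F := fun (t : ℝ) (z : Vec d) => psi (k + 1) z * v (x - t • z))
    (F' := fun (t : ℝ) (z : Vec d) => psi (k + 1) z * (-∑ i, z i * pd i v (x - t • z)))
    (bound := fun z => psi (k + 1) z * (∑ i : Fin d, |z i| * C)) univ_mem
    (Eventually.of_forall fun s => ?_) ?_ ?_ (ae_of_all _ fun z s _ => ?_) ?_
    (ae_of_all _ fun z s _ => ?_)).2
  · exact (integrable_psi_mul k (hv.continuous.comp (by fun_prop))).aestronglyMeasurable
  · exact integrable_psi_mul k (hv.continuous.comp (by fun_prop))
  · refine (integrable_psi_mul k ?_).aestronglyMeasurable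
    have : ∀ i, Continuous fun z : Vec d => pd i v (x - t • z) :=
      fun i => (hv.pd i).continuous.comp (by fun_prop)
    fun_prop
  · rw [norm_mul, Real.norm_eq_abs, abs_of_nonneg (psi_nonneg _ _), norm_neg]
    refine mul_le_mul_of_nonneg_left ((norm_sum_le _ _).trans ?_) (psi_nonneg _ _)
    refine Finset.sum_le_sum fun i _ => ?_
    rw [norm_mul]
    exact mul_le_mul_of_nonneg_left (hC _ _) (norm_nonneg _)
  · exact integrable_psi_mul k (by fun_prop)
  · exact (hasDerivAt_comp_line hv.differentiable x z s).const_mul _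

theorem integral_psi_mul_neg_sum (k : ℕ) {u : Fin d → Vec d → ℝ} (hu : ∀ i, Continuous (u i))
    (t : ℝ) (x : Vec d) :
    ∫ z, psi (k + 1) z * (-∑ i, z i * u i (x - t • z))
      = -∑ i, ∫ z, psi (k + 1) z * (z i * u i (x - t • z)) := by
  simp only [mul_neg, Finset.mul_sum]
  rw [integral_neg, integral_finsetSum]
  intro i _
  have : Continuous fun z : Vec d => u i (x - t • z) := (hu i).comp (by fun_prop)
  exact integrable_psi_mul k (by fun_prop)

/-- The scale derivative of the average is an average of the Laplacian. -/
theorem hasDerivAt_avg (k : ℕ) {v : Vec d → ℝ} (hv : IsTest v) (t : ℝ) (x : Vec d) :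
    HasDerivAt (fun t => avg (k + 1) v t x)
      ((2 * (k + 2 : ℝ))⁻¹ * (t * avg (k + 2) (lap v) t x)) t := by
  refine (hasDerivAt_avg_aux k hv t x).congr_deriv ?_
  rw [integral_psi_mul_neg_sum k fun i => (hv.pd i).continuous]
  change _ = (2 * (k + 2 : ℝ))⁻¹ * (t * avg (k + 2) (fun y => ∑ i, pd i (pd i v) y) t x)
  rw [avg_sum (k + 1) _ fun i => ((hv.pd i).pd i).continuous, Finset.mul_sum, Finset.mul_sum,
    ← Finset.sum_neg_distrib]
  refine Finset.sum_congr rfl fun i _ => ?_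
  rw [integral_coord_mul_psi k (hv.pd i)]
  have : (2 * (k + 2 : ℝ)) ≠ 0 := by positivity
  field_simp

theorem lap_pd {v : Vec d → ℝ} (hv : IsTest v) (j : Fin d) : lap (pd j v) = pd j (lap v) := by
  have h1 : ∀ i, pd i (pd i (pd j v)) = pd j (pd i (pd i v)) := by
    intro i
    have : pd i (pd j v) = pd j (pd i v) := funext fun y => pd_comm hv i j y
    rw [this]
    exact funext fun y => pd_comm (hv.pd i) i j y
  ext x
  simp only [lap, h1]
  have : pd j (fun y => ∑ i, pd i (pd i v) y) x = ∑ i, pd j (pd i (pd i v)) x := by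
    conv_lhs => rw [pd]
    rw [fderiv_fun_sum fun i _ => ((hv.pd i).pd i).differentiable x]
    simp [pd]
  exact this.symm

theorem hasDerivAt_avg_pd (k : ℕ) {v : Vec d → ℝ} (hv : IsTest v) (j : Fin d) (t : ℝ)
    (x : Vec d) :
    HasDerivAt (fun t => avg (k + 1) (pd j v) t x)
      (-∫ z, psi (k + 1) z * (z j * lap v (x - t • z))) t := by
  refine (hasDerivAt_avg k (hv.pd j) t x).congr_deriv ?_
  rw [lap_pd hv, integral_coord_mul_psi k hv.lap]
  have : (2 * (k + 2 : ℝ)) ≠ 0 := by positivity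
  field_simp

/-! ### `L²` bounds for averages -/

theorem sq_integral_le {α : Type*} [MeasurableSpace α] {μ : Measure α} [IsFiniteMeasure μ]
    {f : α → ℝ} (hf : Integrable f μ) (hf2 : Integrable (fun x => f x ^ 2) μ) :
    (∫ x, f x ∂μ) ^ 2 ≤ μ.real univ * ∫ x, f x ^ 2 ∂μ := by
  set V := μ.real univ
  set I := ∫ x, f x ∂μ
  set J := ∫ x, f x ^ 2 ∂μ
  have hV : 0 ≤ V := measureReal_nonneg
  have h0 : 0 ≤ ∫ x, (V * f x - I) ^ 2 ∂μ := integral_nonneg fun x => sq_nonneg _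
  have h1 : ∫ x, (V * f x - I) ^ 2 ∂μ = V ^ 2 * J - 2 * V * I * I + V * I ^ 2 := by
    have : ∀ x, (V * f x - I) ^ 2 = V ^ 2 * f x ^ 2 - 2 * V * I * f x + I ^ 2 := fun x => by ring
    simp only [this]
    have h2 : Integrable (fun x => V ^ 2 * f x ^ 2 - 2 * V * I * f x) μ :=
      (hf2.const_mul _).sub (hf.const_mul _)
    rw [integral_add h2 (integrable_const _), integral_sub (hf2.const_mul _) (hf.const_mul _),
      integral_const_mul, integral_const_mul, integral_const, smul_eq_mul]
  rcases hV.eq_or_lt with hV0 | hVpos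
  · have : μ = 0 := by
      have h := (measureReal_eq_zero_iff (μ := μ) (s := univ)).1 hV0.symm
      exact Measure.measure_univ_eq_zero.1 h
    simp [I, J, this]
  · rw [h1] at h0
    have : 0 ≤ V * (V * J - I ^ 2) := by nlinarith
    have := nonneg_of_mul_nonneg_right this hVpos
    linarith

theorem isCompact_cube (r : ℝ) : IsCompact (cube r : Set (Vec d)) := isCompact_closedBall _ _

theorem measurableSet_cube (r : ℝ) : MeasurableSet (cube r : Set (Vec d)) :=
  measurableSet_closedBall

theorem mem_cube {r : ℝ} {x : Vec d} : x ∈ cube r ↔ ‖x‖ ≤ r := mem_closedBall_zero_iff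

theorem cube_mono {r s : ℝ} (h : r ≤ s) : (cube r : Set (Vec d)) ⊆ cube s := closedBall_subset_closedBall h

instance (r : ℝ) : IsFiniteMeasure ((volume : Measure (Vec d)).restrict (cube r)) :=
  ⟨by simpa using (isCompact_cube r).measure_lt_top⟩

theorem integrableOn_cube {f : Vec d → ℝ} (hf : Continuous f) (r : ℝ) : IntegrableOn f (cube r) :=
  hf.continuousOn.integrableOn_compact (isCompact_cube r)

theorem volume_cube {r : ℝ} (hr : 0 ≤ r) :
    (volume : Measure (Vec d)).real (cube r) = (2 * r) ^ d := by
  rw [Measure.real, cube, Real.volume_pi_closedBall _ hr]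
  simp [ENNReal.toReal_ofReal, hr]

theorem setIntegral_cube_mono {f : Vec d → ℝ} (hf : Continuous f) (h0 : ∀ x, 0 ≤ f x) {r s : ℝ}
    (h : r ≤ s) : ∫ x in cube r, f x ≤ ∫ x in cube s, f x :=
  setIntegral_mono_set (integrableOn_cube hf s) (ae_of_all _ h0)
    (cube_mono h).eventuallyLE

theorem setIntegral_swap {X Y : Type*} [TopologicalSpace X] [MeasurableSpace X] [BorelSpace X]
    [SecondCountableTopology X] [T2Space X] [TopologicalSpace Y] [MeasurableSpace Y] [BorelSpace Y]
    [SecondCountableTopology Y] [T2Space Y] (μ : Measure X) (ν : Measure Y) [SigmaFinite μ]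
    [SigmaFinite ν] [IsFiniteMeasureOnCompacts μ] [IsFiniteMeasureOnCompacts ν]
    {s : Set X} {t : Set Y} (hs : IsCompact s) (ht : IsCompact t)
    {F : X → Y → ℝ} (hF : Continuous (Function.uncurry F)) :
    ∫ x in s, ∫ y in t, F x y ∂ν ∂μ = ∫ y in t, ∫ x in s, F x y ∂μ ∂ν := by
  refine integral_integral_swap ?_
  rw [Measure.prod_restrict]
  exact hF.continuousOn.integrableOn_compact (hs.prod ht)

theorem integral_cube_translate_le {f : Vec d → ℝ} (hf : Continuous f) (r : ℝ) {h : Vec d}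
    (hh : ‖h‖ ≤ 1) : ∫ x in cube r, f (x - h) ^ 2 ≤ ∫ x in cube (r + 1), f x ^ 2 := by
  have e : ∫ x in cube r, f (x - h) ^ 2
      = ∫ x in (fun x => x + h) ⁻¹' (cube r), f x ^ 2 := by
    have := (measurePreserving_add_right (volume : Measure (Vec d)) h).setIntegral_preimage_emb
      (measurableEmbedding_addRight h) (fun x => f (x - h) ^ 2) (cube r)
    simp only [add_sub_cancel_right] at this
    exact this.symm
  rw [e]
  refine setIntegral_mono_set (integrableOn_cube (hf.pow 2) _) (ae_of_all _ fun x => sq_nonneg _)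
    (LE.le.eventuallyLE fun x hx => ?_)
  have hx' : ‖x + h‖ ≤ r := mem_cube.1 hx
  rw [mem_cube]
  calc ‖x‖ = ‖(x + h) - h‖ := by rw [add_sub_cancel_right]
    _ ≤ ‖x + h‖ + ‖h‖ := norm_sub_le _ _
    _ ≤ r + 1 := add_le_add hx' hh

/-- The local `L²` mass of `f` seen from `x` at scale `t`. -/
def mass (f : Vec d → ℝ) (t : ℝ) (x : Vec d) : ℝ := ∫ z in cube 1, f (x - t • z) ^ 2

theorem mass_nonneg (f : Vec d → ℝ) (t : ℝ) (x : Vec d) : 0 ≤ mass f t x :=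
  integral_nonneg fun _ => sq_nonneg _

theorem continuous_mass {f : Vec d → ℝ} (hf : Continuous f) :
    Continuous fun p : ℝ × Vec d => mass f p.1 p.2 := by
  unfold mass
  have : Continuous (Function.uncurry fun (p : ℝ × Vec d) (z : Vec d) =>
      f (p.2 - p.1 • z) ^ 2) := by
    have : Continuous fun q : (ℝ × Vec d) × Vec d => q.1.2 - q.1.1 • q.2 := by fun_prop
    exact (hf.comp this).pow 2
  exact continuous_parametric_integral_of_continuous this (isCompact_cube 1)

theorem integral_mass_le {f : Vec d → ℝ} (hf : Continuous f) (r : ℝ) {t : ℝ} (ht : t ∈ Icc 0 1) :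
    ∫ x in cube r, mass f t x ≤ 2 ^ d * ∫ x in cube (r + 1), f x ^ 2 := by
  unfold mass
  rw [setIntegral_swap volume volume (isCompact_cube r) (isCompact_cube 1)]
  · have h1 : ∀ z ∈ (cube 1 : Set (Vec d)), ‖∫ x in cube r, f (x - t • z) ^ 2‖
        ≤ ∫ x in cube (r + 1), f x ^ 2 := by
      intro z hz
      rw [Real.norm_of_nonneg (integral_nonneg fun _ => sq_nonneg _)]
      refine integral_cube_translate_le hf r ?_
      rw [norm_smul, Real.norm_of_nonneg ht.1]
      exact mul_le_one₀ ht.2 (norm_nonneg _) (mem_cube.1 hz)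
    have h2 := norm_setIntegral_le_of_norm_le_const (μ := volume)
      (isCompact_cube 1).measure_lt_top h1
    rw [volume_cube zero_le_one, mul_one, mul_comm] at h2
    exact (Real.le_norm_self _).trans h2
  · have : Continuous fun q : Vec d × Vec d => q.1 - t • q.2 := by fun_prop
    exact (hf.comp this).pow 2

theorem integral_mass_le' {f : Vec d → ℝ} (hf : Continuous f) (r : ℝ) :
    ∫ x in cube r, ∫ t in Icc (0 : ℝ) 1, mass f t x ≤ 2 ^ d * ∫ x in cube (r + 1), f x ^ 2 := by
  rw [setIntegral_swap volume volume (isCompact_cube r) isCompact_Icc]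
  · have h1 : ∀ t ∈ Icc (0 : ℝ) 1, ‖∫ x in cube r, mass f t x‖
        ≤ 2 ^ d * ∫ x in cube (r + 1), f x ^ 2 := by
      intro t ht
      rw [Real.norm_of_nonneg (integral_nonneg fun _ => mass_nonneg _ _ _)]
      exact integral_mass_le hf r ht
    have h2 := norm_setIntegral_le_of_norm_le_const (μ := volume)
      (isCompact_Icc (a := (0 : ℝ)) (b := 1)).measure_lt_top h1
    simp only [Real.volume_real_Icc, sub_zero, zero_le_one, sup_of_le_left, mul_one] at h2
    exact (Real.le_norm_self _).trans h2
  · exact (continuous_mass hf).comp continuous_swap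

theorem sq_integral_psi_le (k : ℕ) {g : Vec d → ℝ} (hg : Continuous g) :
    (∫ z, psi (k + 1) z * g z) ^ 2 ≤ 2 ^ d * ∫ z in cube 1, g z ^ 2 := by
  have e : ∫ z, psi (k + 1) z * g z = ∫ z in cube 1, psi (k + 1) z * g z := by
    refine (setIntegral_eq_integral_of_forall_compl_eq_zero fun z hz => ?_).symm
    rw [psi_eq_zero hz, zero_mul]
  have hc : Continuous fun z => psi (k + 1) z * g z := (continuous_psi _).mul hg
  rw [e]
  refine (sq_integral_le (integrableOn_cube hc 1) (integrableOn_cube (hc.pow 2) 1)).trans ?_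
  rw [measureReal_restrict_apply_univ, volume_cube zero_le_one, mul_one]
  refine mul_le_mul_of_nonneg_left ?_ (by positivity)
  refine integral_mono (integrableOn_cube (hc.pow 2) 1) (integrableOn_cube (hg.pow 2) 1)
    fun z => ?_
  simp only [mul_pow]
  exact mul_le_of_le_one_left (sq_nonneg _) (pow_le_one₀ (psi_nonneg _ _) (psi_le_one _ _))

theorem sq_avg_le (k : ℕ) {v : Vec d → ℝ} (hv : Continuous v) (t : ℝ) (x : Vec d) :
    (avg (k + 1) v t x) ^ 2 ≤ 2 ^ d * mass v t x :=
  sq_integral_psi_le k (hv.comp (by fun_prop : Continuous fun z : Vec d => x - t • z))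

theorem sq_integral_coord_psi_le (k : ℕ) {v : Vec d → ℝ} (hv : Continuous v) (t : ℝ) (x : Vec d)
    (j : Fin d) : (∫ z, psi (k + 1) z * (z j * v (x - t • z))) ^ 2 ≤ 2 ^ d * mass v t x := by
  have hc : Continuous fun z : Vec d => v (x - t • z) := hv.comp (by fun_prop)
  have hc' : Continuous fun z : Vec d => z j * v (x - t • z) := (continuous_apply j).mul hc
  refine (sq_integral_psi_le k hc').trans (mul_le_mul_of_nonneg_left ?_ (by positivity))
  refine setIntegral_mono_on (integrableOn_cube (hc'.pow 2) 1) (integrableOn_cube (hc.pow 2) 1)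
    (measurableSet_cube 1) fun z hz => ?_
  rw [mul_pow]
  refine mul_le_of_le_one_left (sq_nonneg _) ?_
  rw [sq_le_one_iff_abs_le_one]
  exact (norm_le_pi_norm z j).trans (mem_cube.1 hz)

theorem avg_zero (k : ℕ) (v : Vec d → ℝ) (x : Vec d) : avg k v 0 x = (∫ z : Vec d, psi k z) * v x := by
  simp [avg, integral_mul_const]

/-- The difference of an average at scale one and the function itself, squared, is bounded by the
scale derivative. -/
theorem sq_avg_sub_le (k : ℕ) {v f : Vec d → ℝ} (hv : IsTest v) (hf : Continuous f) (x : Vec d)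
    (h : ∀ t ∈ Icc (0 : ℝ) 1, ((2 * (k + 2 : ℝ))⁻¹ * (t * avg (k + 2) (lap v) t x)) ^ 2
      ≤ 2 ^ d * mass f t x) :
    (avg (k + 1) v 1 x - (∫ z : Vec d, psi (k + 1) z) * v x) ^ 2
      ≤ 2 ^ d * ∫ t in Icc (0 : ℝ) 1, mass f t x := by
  set q' : ℝ → ℝ := fun t => (2 * (k + 2 : ℝ))⁻¹ * (t * avg (k + 2) (lap v) t x)
  have hcont : Continuous fun t => avg (k + 2) (lap v) t x :=
    continuous_iff_continuousAt.2 fun t => (hasDerivAt_avg (k + 1) hv.lap t x).continuousAt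
  have hq' : Continuous q' := by fun_prop
  have h1 : ∫ t in (0 : ℝ)..1, q' t = avg (k + 1) v 1 x - avg (k + 1) v 0 x :=
    intervalIntegral.integral_eq_sub_of_hasDerivAt (fun t _ => hasDerivAt_avg k hv t x)
      (hq'.intervalIntegrable _ _)
  rw [← avg_zero, ← h1, intervalIntegral.integral_of_le zero_le_one, ← integral_Icc_eq_integral_Ioc]
  have hi : ∀ {g : ℝ → ℝ}, Continuous g → IntegrableOn g (Icc 0 1) := fun hg =>
    hg.continuousOn.integrableOn_compact isCompact_Icc
  refine (sq_integral_le (hi hq') (hi (hq'.pow 2))).trans ?_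
  have hm : Continuous fun t => mass f t x := (continuous_mass hf).comp
    (by fun_prop : Continuous fun t : ℝ => (t, x))
  rw [measureReal_restrict_apply_univ, Real.volume_real_Icc, sub_zero, max_eq_left zero_le_one,
    one_mul, ← integral_const_mul]
  exact setIntegral_mono_on (hi (hq'.pow 2)) (hi (hm.const_mul _)) measurableSet_Icc h

/-! ### Local energy estimates -/

theorem support_pd_subset (i : Fin d) (v : Vec d → ℝ) : Function.support (pd i v) ⊆ tsupport v := by
  intro x hx
  refine support_fderiv_subset ℝ fun h => hx ?_
  simp [pd, h]

theorem tsupport_pd_subset (i : Fin d) (v : Vec d → ℝ) : tsupport (pd i v) ⊆ tsupport v :=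
  closure_minimal (support_pd_subset i v) (isClosed_tsupport v)

theorem lap_eq_zero {v : Vec d → ℝ} {x : Vec d} (hx : x ∉ tsupport v) : lap v x = 0 :=
  Finset.sum_eq_zero fun i _ => image_eq_zero_of_notMem_tsupport fun h =>
    hx (tsupport_pd_subset i v (tsupport_pd_subset i _ h))

theorem exists_cutoff {r : ℝ} (hr : 0 < r) : ∃ χ : Vec d → ℝ, IsTest χ ∧ (∀ x, 0 ≤ χ x) ∧
    (∀ x, χ x ≤ 1) ∧ (∀ x ∈ (cube r : Set (Vec d)), χ x = 1) ∧ tsupport χ ⊆ cube (2 * r) := by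
  let χ : ContDiffBump (0 : Vec d) := ⟨r, 2 * r, hr, by linarith⟩
  exact ⟨χ, ⟨χ.contDiff, χ.hasCompactSupport⟩, fun x => χ.nonneg, fun x => χ.le_one,
    fun x hx => χ.one_of_mem_closedBall hx, χ.tsupport_eq.subset⟩

/-- Sum of the squares of a function and of its first derivatives. -/
def jetSq (v : Vec d → ℝ) (x : Vec d) : ℝ := v x ^ 2 + ∑ i, pd i v x ^ 2

theorem IsTest.continuous_jetSq {v : Vec d → ℝ} (h : IsTest v) : Continuous (jetSq v) :=
  (h.continuous.pow 2).add (continuous_finsetSum _ fun i _ => (h.pd i).continuous.pow 2)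

theorem pd_pd_mul {χ v : Vec d → ℝ} (hχ : IsTest χ) (hv : IsTest v) (i j : Fin d) (x : Vec d) :
    pd i (pd j fun y => χ y * v y) x = χ x * pd i (pd j v) x +
      (pd i (pd j χ) x * v x + pd j χ x * pd i v x + pd i χ x * pd j v x) := by
  rw [pd_mul hχ.differentiable hv.differentiable,
    pd_add ((hχ.pd j).mul hv).differentiable (hχ.mul (hv.pd j)).differentiable,
    pd_mul (hχ.pd j).differentiable hv.differentiable,
    pd_mul hχ.differentiable (hv.pd j).differentiable]
  ring

theorem exists_commutator_bound {χ : Vec d → ℝ} (hχ : IsTest χ) : ∃ M, 0 ≤ M ∧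
    ∀ (v : Vec d → ℝ) (i j : Fin d) (x : Vec d),
      (pd i (pd j χ) x * v x + pd j χ x * pd i v x + pd i χ x * pd j v x) ^ 2 ≤ M * jetSq v x := by
  obtain ⟨M₁, h₁⟩ := norm_fderiv_bound hχ
  have : ∀ j, ∃ C, ∀ i x, |pd i (pd j χ) x| ≤ C := fun j => norm_fderiv_bound (hχ.pd j)
  choose M₂ h₂ using this
  refine ⟨3 * (∑ j, M₂ j ^ 2 + 2 * M₁ ^ 2), by positivity, fun v i j x => ?_⟩
  have a1 : (pd i (pd j χ) x) ^ 2 ≤ ∑ j, M₂ j ^ 2 :=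
    (sq_le_sq' (neg_le_of_abs_le (h₂ j i x)) (le_of_abs_le (h₂ j i x))).trans
      (Finset.single_le_sum (f := fun j => M₂ j ^ 2) (fun _ _ => sq_nonneg _) (Finset.mem_univ j))
  have a2 : ∀ i, (pd i χ x) ^ 2 ≤ M₁ ^ 2 := fun i =>
    sq_le_sq' (neg_le_of_abs_le (h₁ i x)) (le_of_abs_le (h₁ i x))
  have b0 : 0 ≤ ∑ i, pd i v x ^ 2 := Finset.sum_nonneg fun _ _ => sq_nonneg _
  have b1 : v x ^ 2 ≤ jetSq v x := by unfold jetSq; linarith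
  have b2 : ∀ i, pd i v x ^ 2 ≤ jetSq v x := fun i => by
    have := Finset.single_le_sum (f := fun j => pd j v x ^ 2) (fun _ _ => sq_nonneg _)
      (Finset.mem_univ i)
    unfold jetSq
    nlinarith [sq_nonneg (v x)]
  have J0 : 0 ≤ jetSq v x := (sq_nonneg _).trans b1
  have c0 : ∀ {p q P : ℝ}, p ^ 2 ≤ P → q ^ 2 ≤ jetSq v x → (p * q) ^ 2 ≤ P * jetSq v x := by
    intro p q P hp hq
    rw [mul_pow]
    exact mul_le_mul hp hq (sq_nonneg _) ((sq_nonneg p).trans hp)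
  have c1 := c0 a1 b1
  have c2 := c0 (a2 j) (b2 i)
  have c3 := c0 (a2 i) (b2 j)
  have : ∀ a b c : ℝ, (a + b + c) ^ 2 ≤ 3 * (a ^ 2 + b ^ 2 + c ^ 2) := fun a b c => by
    nlinarith [sq_nonneg (a - b), sq_nonneg (a - c), sq_nonneg (b - c)]
  refine (this _ _ _).trans ?_
  nlinarith

theorem add_sq_le_two (a b : ℝ) : (a + b) ^ 2 ≤ 2 * a ^ 2 + 2 * b ^ 2 := by
  nlinarith [sq_nonneg (a - b)]

theorem sub_sq_le_two (a b : ℝ) : (a - b) ^ 2 ≤ 2 * a ^ 2 + 2 * b ^ 2 := by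
  nlinarith [sq_nonneg (a + b)]

theorem sq_le_two (a b : ℝ) : a ^ 2 ≤ 2 * (a + b) ^ 2 + 2 * b ^ 2 := by
  nlinarith [sq_nonneg (a + 2 * b)]

/-- Localised `L²` bound of the Hessian by the Laplacian and lower order terms. -/
theorem exists_energy_bound {χ : Vec d → ℝ} (hχ : IsTest χ) {r : ℝ}
    (hs : tsupport χ ⊆ cube r) : ∃ C, 0 ≤ C ∧ ∀ v : Vec d → ℝ, IsTest v →
      ∫ x in cube r, χ x ^ 2 * hessSq v x
        ≤ 4 * (∫ x in cube r, χ x ^ 2 * lap v x ^ 2) + C * ∫ x in cube r, jetSq v x := by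
  obtain ⟨M, hM0, hM⟩ := exists_commutator_bound hχ
  refine ⟨6 * (d * (d * M)), by positivity, fun v hv => ?_⟩
  set w : Vec d → ℝ := fun x => χ x * v x
  have hw : IsTest w := hχ.mul hv
  have p1 : ∀ x, χ x ^ 2 * hessSq v x ≤ 2 * hessSq w x + 2 * (d * (d * M)) * jetSq v x := by
    intro x
    have : ∀ i j, χ x ^ 2 * pd i (pd j v) x ^ 2 ≤ 2 * pd i (pd j w) x ^ 2 + 2 * (M * jetSq v x) := by
      intro i j
      rw [← mul_pow]
      refine (sq_le_two _ _).trans (add_le_add (le_of_eq ?_)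
        (mul_le_mul_of_nonneg_left (hM v i j x) zero_le_two))
      rw [pd_pd_mul hχ hv]
    unfold hessSq
    rw [Finset.mul_sum]
    calc ∑ i, χ x ^ 2 * ∑ j, pd i (pd j v) x ^ 2
        ≤ ∑ i, ∑ j, (2 * pd i (pd j w) x ^ 2 + 2 * (M * jetSq v x)) := by
          refine Finset.sum_le_sum fun i _ => ?_
          rw [Finset.mul_sum]
          exact Finset.sum_le_sum fun j _ => this i j
      _ = _ := by
          simp only [Finset.sum_add_distrib, ← Finset.mul_sum]
          simp
          ring
  have p2 : ∀ x, lap w x ^ 2 ≤ 2 * (χ x ^ 2 * lap v x ^ 2) + 2 * (d * (d * M)) * jetSq v x := by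
    intro x
    have e : lap w x = χ x * lap v x + ∑ i,
        (pd i (pd i χ) x * v x + pd i χ x * pd i v x + pd i χ x * pd i v x) := by
      simp only [lap, w, pd_pd_mul hχ hv, Finset.sum_add_distrib, Finset.mul_sum]
    rw [e, ← mul_pow]
    refine (add_sq_le_two _ _).trans (add_le_add le_rfl ?_)
    have := sq_sum_le_card_mul_sum_sq (s := (Finset.univ : Finset (Fin d))) (f := fun i =>
      (pd i (pd i χ) x * v x + pd i χ x * pd i v x + pd i χ x * pd i v x))
    have h2 : ∑ i : Fin d, (pd i (pd i χ) x * v x + pd i χ x * pd i v x + pd i χ x * pd i v x) ^ 2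
        ≤ ∑ i : Fin d, M * jetSq v x := Finset.sum_le_sum fun i _ => hM v i i x
    simp only [Finset.card_univ, Fintype.card_fin, Finset.sum_const, nsmul_eq_mul] at this h2
    have h3 := mul_le_mul_of_nonneg_left h2 (Nat.cast_nonneg (α := ℝ) d)
    nlinarith
  have iJ := integrableOn_cube hv.continuous_jetSq r
  have iH := integrableOn_cube hw.continuous_hessSq r
  have cL : Continuous fun x => χ x ^ 2 * lap v x ^ 2 :=
    (hχ.continuous.pow 2).mul (hv.lap.continuous.pow 2)
  have cH : Continuous fun x => χ x ^ 2 * hessSq v x :=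
    (hχ.continuous.pow 2).mul hv.continuous_hessSq
  have q1 : ∫ x in cube r, χ x ^ 2 * hessSq v x
      ≤ 2 * (∫ x in cube r, hessSq w x) + 2 * (d * (d * M)) * ∫ x in cube r, jetSq v x := by
    rw [← integral_const_mul, ← integral_const_mul,
      ← integral_add (iH.const_mul _) (iJ.const_mul _)]
    exact integral_mono (integrableOn_cube cH r) ((iH.const_mul _).add (iJ.const_mul _)) p1
  have q2 : ∫ x in cube r, lap w x ^ 2 ≤ 2 * (∫ x in cube r, χ x ^ 2 * lap v x ^ 2)
      + 2 * (d * (d * M)) * ∫ x in cube r, jetSq v x := by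
    have i1 := integrableOn_cube cL r
    rw [← integral_const_mul, ← integral_const_mul,
      ← integral_add (i1.const_mul _) (iJ.const_mul _)]
    exact integral_mono (integrableOn_cube (hw.lap.continuous.pow 2) r)
      ((i1.const_mul _).add (iJ.const_mul _)) p2
  have q3 : ∫ x in cube r, hessSq w x ≤ ∫ x in cube r, lap w x ^ 2 := by
    have h0 : ∀ x, 0 ≤ hessSq w x := fun x =>
      Finset.sum_nonneg fun _ _ => Finset.sum_nonneg fun _ _ => sq_nonneg _
    have hi : Integrable (hessSq w) := integrable_finsetSum _ fun i _ => integrable_sum_test _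
      fun j _ => by simpa only [sq] using ((hw.pd j).pd i).mul ((hw.pd j).pd i)
    refine (setIntegral_le_integral hi (ae_of_all _ h0)).trans ?_
    rw [integral_hessSq_eq hw]
    refine le_of_eq (setIntegral_eq_integral_of_forall_compl_eq_zero fun x hx => ?_).symm
    rw [lap_eq_zero fun h => hx (hs (tsupport_mul_subset_left h))]
    simp
  nlinarith

theorem avg_one_eq_convolution (v : Vec d → ℝ) :
    avg 1 v 1 = convolution (psi 1) v (ContinuousLinearMap.mul ℝ ℝ) volume := by
  ext x
  simp [avg, convolution]

theorem IsTest.avg_one {v : Vec d → ℝ} (hv : IsTest v) : IsTest (avg 1 v 1) := by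
  rw [avg_one_eq_convolution]
  exact ⟨hv.compact.contDiff_convolution_right _ (continuous_psi 1).locallyIntegrable hv.smooth,
    (hasCompactSupport_psi 0).convolution _ hv.compact⟩

theorem pd_avg_one {v : Vec d → ℝ} (hv : IsTest v) (i : Fin d) :
    pd i (avg 1 v 1) = avg 1 (pd i v) 1 := by
  have h1 : ContDiff ℝ 1 v := hv.smooth.of_le (by exact_mod_cast le_top)
  ext x
  rw [pd, avg_one_eq_convolution, (hv.compact.hasFDerivAt_convolution_right
    (ContinuousLinearMap.mul ℝ ℝ) (continuous_psi 1).locallyIntegrable h1 x).fderiv,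
    convolution_precompR_apply _ (continuous_psi 1).locallyIntegrable (hv.compact.fderiv (𝕜 := ℝ))
      (h1.continuous_fderiv one_ne_zero)]
  simp [avg, convolution, pd]

theorem lap_avg_one {v : Vec d → ℝ} (hv : IsTest v) : lap (avg 1 v 1) = avg 1 (lap v) 1 := by
  ext x
  have := avg_sum 0 Finset.univ (fun i => ((hv.pd i).pd i).continuous) 1 x
  simp only [zero_add] at this
  simp only [lap, pd_avg_one hv, pd_avg_one (hv.pd _)]
  rw [← this]
  rfl

theorem setIntegral_cube_neg (f : Vec d → ℝ) (r : ℝ) :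
    ∫ x in cube r, f (-x) = ∫ x in cube r, f x := by
  have := (Measure.measurePreserving_neg (volume : Measure (Vec d))).setIntegral_preimage_emb
    (MeasurableEquiv.neg _).measurableEmbedding f (cube r)
  have e : Neg.neg ⁻¹' (cube r : Set (Vec d)) = cube r := by
    ext x; simp [mem_cube]
  rwa [e] at this

theorem mass_one_le {f : Vec d → ℝ} (hf : Continuous f) {x : Vec d} (hx : x ∈ (cube 1 : Set (Vec d))) :
    mass f 1 x ≤ ∫ y in cube 3, f y ^ 2 := by
  have h1 := integral_cube_translate_le (f := fun y => f (-y)) (hf.comp continuous_neg) 1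
    (mem_cube.1 hx)
  have h2 := setIntegral_cube_neg (fun y => f y ^ 2) (1 + 1)
  rw [h2] at h1
  simp only [neg_sub] at h1
  have h3 := setIntegral_cube_mono (hf.pow 2) (fun x => sq_nonneg (f x))
    (show (1 + 1 : ℝ) ≤ 3 by norm_num)
  unfold mass
  simp only [one_smul]
  exact h1.trans h3

theorem hessSq_nonneg (v : Vec d → ℝ) (x : Vec d) : 0 ≤ hessSq v x :=
  Finset.sum_nonneg fun _ _ => Finset.sum_nonneg fun _ _ => sq_nonneg _

theorem setIntegral_hessSq {v : Vec d → ℝ} (hv : IsTest v) (r : ℝ) :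
    ∫ x in cube r, hessSq v x = ∑ i, ∑ j, ∫ x in cube r, pd i (pd j v) x ^ 2 := by
  have h : ∀ i j, IntegrableOn (fun x => pd i (pd j v) x ^ 2) (cube r) := fun i j =>
    integrableOn_cube (((hv.pd j).pd i).continuous.pow 2) r
  unfold hessSq
  rw [integral_finsetSum _ fun i _ => integrable_finsetSum _ fun j _ => h i j]
  exact Finset.sum_congr rfl fun i _ => integral_finsetSum _ fun j _ => h i j

theorem hessSq_avg_le {v : Vec d → ℝ} (hv : IsTest v) {x : Vec d}
    (hx : x ∈ (cube 1 : Set (Vec d))) :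
    hessSq (avg 1 v 1) x ≤ 2 ^ d * ∫ y in cube 3, hessSq v y := by
  rw [setIntegral_hessSq hv, Finset.mul_sum]
  unfold hessSq
  refine Finset.sum_le_sum fun i _ => ?_
  rw [Finset.mul_sum]
  refine Finset.sum_le_sum fun j _ => ?_
  rw [pd_avg_one hv, pd_avg_one (hv.pd j)]
  have hc := ((hv.pd j).pd i).continuous
  exact (sq_avg_le 0 hc 1 x).trans (mul_le_mul_of_nonneg_left (mass_one_le hc hx) (by positivity))

theorem integral_sq_avg_sub_le {v f : Vec d → ℝ} (hv : IsTest v) (hf : Continuous f)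
    (h : ∀ x, ∀ t ∈ Icc (0 : ℝ) 1, ((2 * ((0 : ℕ) + 2 : ℝ))⁻¹ * (t * avg (0 + 2) (lap v) t x)) ^ 2
      ≤ 2 ^ d * mass f t x) :
    ∫ x in cube 2, (avg 1 v 1 x - (∫ z : Vec d, psi 1 z) * v x) ^ 2
      ≤ 2 ^ d * (2 ^ d * ∫ x in cube 3, f x ^ 2) := by
  have h1 := integral_mass_le' hf 2
  rw [show (2 : ℝ) + 1 = 3 by norm_num] at h1
  refine le_trans ?_ (mul_le_mul_of_nonneg_left h1 (by positivity))
  rw [← integral_const_mul]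
  have hm : Continuous fun x => ∫ t in Icc (0 : ℝ) 1, mass f t x := by
    have : Continuous (Function.uncurry fun (x : Vec d) (t : ℝ) => mass f t x) :=
      (continuous_mass hf).comp continuous_swap
    exact continuous_parametric_integral_of_continuous this isCompact_Icc
  refine integral_mono (integrableOn_cube ?_ 2) (integrableOn_cube (hm.const_mul _) 2) fun x => ?_
  · exact (hv.avg_one.continuous.sub (hv.continuous.const_mul _)).pow 2
  · exact sq_avg_sub_le 0 hv hf x (h x)

/-- Decay of the Hessian at the unit scale. -/
theorem exists_hessian_decay_unit : ∃ C : ℝ, 0 ≤ C ∧ ∀ τ : ℝ, 0 < τ → τ ≤ 1 →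
    ∀ v : Vec d → ℝ, IsTest v → ∫ x in cube τ, hessSq v x
      ≤ C * τ ^ d * (∫ x in cube 3, hessSq v x) + C * ∫ x in cube 3, lap v x ^ 2 := by
  obtain ⟨χ, hχ, hχ0, hχ1, hχe, hχs⟩ := exists_cutoff (d := d) one_pos
  rw [mul_one] at hχs
  obtain ⟨M, hM0, hM⟩ := exists_energy_bound hχ hχs
  set I := ∫ z : Vec d, psi 1 z with hI
  have hIpos : 0 < I := integral_psi_pos 0
  set D : ℝ := 2 ^ d * 2 ^ d with hD
  have hD0 : 0 < D := by positivity
  set C₁ : ℝ := 4 * (2 * D + 2 * I ^ 2) + M * (D + d * D) with hC1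
  have hC10 : 0 ≤ C₁ := by positivity
  refine ⟨(I ^ 2)⁻¹ * (2 * D + 2 * C₁), by positivity, fun τ hτ0 hτ1 v hv => ?_⟩
  set h : ℝ := ∫ x in cube 3, hessSq v x
  set ℓ : ℝ := ∫ x in cube 3, lap v x ^ 2
  have hh0 : 0 ≤ h := integral_nonneg fun x => hessSq_nonneg v x
  have hℓ0 : 0 ≤ ℓ := integral_nonneg fun x => sq_nonneg _
  have hcl : IsTest fun x => I * v x := hv.mul_left contDiff_const
  set w : Vec d → ℝ := fun x => avg 1 v 1 x - I * v x
  have hw : IsTest w := hv.avg_one.sub hcl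
  have pw : ∀ i, pd i w = fun x => avg 1 (pd i v) 1 x - I * pd i v x := by
    intro i
    rw [pd_sub hv.avg_one.differentiable hcl.differentiable, pd_avg_one hv,
      pd_const_mul hv.differentiable]
  have ppw : ∀ i j, pd i (pd j w) = fun x => avg 1 (pd i (pd j v)) 1 x - I * pd i (pd j v) x := by
    intro i j
    have hcl' : IsTest fun x => I * pd j v x := (hv.pd j).mul_left contDiff_const
    rw [pw, pd_sub (hv.pd j).avg_one.differentiable hcl'.differentiable, pd_avg_one (hv.pd j),
      pd_const_mul (hv.pd j).differentiable]
  have lw : ∀ x, lap w x = avg 1 (lap v) 1 x - I * lap v x := by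
    intro x
    rw [← lap_avg_one hv]
    simp only [lap, ppw, pd_avg_one hv, pd_avg_one (hv.pd _), Finset.sum_sub_distrib,
      Finset.mul_sum]
  have bw : ∫ x in cube 2, w x ^ 2 ≤ D * ℓ := by
    rw [hD, mul_assoc]
    refine integral_sq_avg_sub_le hv hv.lap.continuous fun x t ht => ?_
    refine le_trans ?_ (sq_avg_le 1 hv.lap.continuous t x)
    rw [mul_pow, mul_pow]
    have : t ^ 2 ≤ 1 := pow_le_one₀ ht.1 ht.2
    have h3 := sq_nonneg (avg (0 + 2) (lap v) t x)
    norm_num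
    nlinarith
  have bpw : ∀ i, ∫ x in cube 2, pd i w x ^ 2 ≤ D * ℓ := by
    intro i
    rw [hD, mul_assoc, pw]
    refine integral_sq_avg_sub_le (hv.pd i) hv.lap.continuous fun x t ht => ?_
    have := (hasDerivAt_avg 0 (hv.pd i) t x).unique (hasDerivAt_avg_pd 0 hv i t x)
    rw [this, neg_sq]
    exact sq_integral_coord_psi_le 0 hv.lap.continuous t x i
  have bj : ∫ x in cube 2, jetSq w x ≤ (D + d * D) * ℓ := by
    unfold jetSq
    have i1 : IntegrableOn (fun x => w x ^ 2) (cube 2) := integrableOn_cube (hw.continuous.pow 2) 2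
    have i2 : ∀ i, IntegrableOn (fun x => pd i w x ^ 2) (cube 2) := fun i =>
      integrableOn_cube ((hw.pd i).continuous.pow 2) 2
    rw [integral_add i1 (integrable_finsetSum _ fun i _ => i2 i),
      integral_finsetSum _ fun i _ => i2 i]
    have := Finset.sum_le_sum fun i (_ : i ∈ Finset.univ) => bpw i
    simp only [Finset.sum_const, Finset.card_univ, Fintype.card_fin, nsmul_eq_mul] at this
    nlinarith
  have bl : ∫ x in cube 2, lap w x ^ 2 ≤ (2 * D + 2 * I ^ 2) * ℓ := by
    have hm : Continuous (mass (lap v) 1) :=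
      (continuous_mass hv.lap.continuous).comp (by fun_prop : Continuous fun x : Vec d => ((1 : ℝ), x))
    have hL : Continuous fun x => lap v x ^ 2 := hv.lap.continuous.pow 2
    have hm' : Continuous fun x => 2 * (2 ^ d * mass (lap v) 1 x) := (hm.const_mul _).const_mul _
    have hL' : Continuous fun x => 2 * I ^ 2 * lap v x ^ 2 := hL.const_mul _
    have h1 : ∫ x in cube 2, lap w x ^ 2
        ≤ ∫ x in cube 2, (2 * (2 ^ d * mass (lap v) 1 x) + 2 * I ^ 2 * lap v x ^ 2) := by
      refine integral_mono (integrableOn_cube (hw.lap.continuous.pow 2) 2)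
        (integrableOn_cube (hm'.add hL') 2) fun x => ?_
      have := sub_sq_le_two (avg 1 (lap v) 1 x) (I * lap v x)
      have h2 := sq_avg_le 0 hv.lap.continuous 1 x
      simp only [zero_add] at h2
      simp only [lw]
      nlinarith
    rw [integral_add (integrableOn_cube hm' 2) (integrableOn_cube hL' 2),
      integral_const_mul, integral_const_mul, integral_const_mul] at h1
    have h2 := integral_mass_le hv.lap.continuous 2 (t := 1) (by simp)
    rw [show (2 : ℝ) + 1 = 3 by norm_num] at h2
    have h3 := setIntegral_cube_mono hL (fun x => sq_nonneg (lap v x)) (show (2 : ℝ) ≤ 3 by norm_num)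
    have h4 := mul_le_mul_of_nonneg_left h2 (show (0 : ℝ) ≤ 2 ^ d by positivity)
    have h5 := mul_le_mul_of_nonneg_left h3 (show (0 : ℝ) ≤ 2 * I ^ 2 by positivity)
    have e : (2 * D + 2 * I ^ 2) * ℓ = 2 * (2 ^ d * (2 ^ d * ℓ)) + 2 * I ^ 2 * ℓ := by
      rw [hD]; ring
    rw [e]
    linarith
  have bH : ∫ x in cube τ, hessSq w x ≤ C₁ * ℓ := by
    have cH : Continuous fun x => χ x ^ 2 * hessSq w x :=
      (hχ.continuous.pow 2).mul hw.continuous_hessSq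
    have h1 : ∫ x in cube 1, hessSq w x = ∫ x in cube 1, χ x ^ 2 * hessSq w x :=
      setIntegral_congr_fun (measurableSet_cube 1) fun x hx => by simp [hχe x hx]
    have h2 := setIntegral_cube_mono cH (fun x => mul_nonneg (sq_nonneg _) (hessSq_nonneg w x))
      (show (1 : ℝ) ≤ 2 by norm_num)
    have h3 := setIntegral_cube_mono hw.continuous_hessSq (hessSq_nonneg w) hτ1
    have h4 : ∫ x in cube 2, χ x ^ 2 * lap w x ^ 2 ≤ ∫ x in cube 2, lap w x ^ 2 := by
      have cl : Continuous fun x => lap w x ^ 2 := hw.lap.continuous.pow 2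
      refine integral_mono (integrableOn_cube ((hχ.continuous.pow 2).mul cl) 2)
        (integrableOn_cube cl 2) fun x => ?_
      exact mul_le_of_le_one_left (sq_nonneg _) (pow_le_one₀ (hχ0 x) (hχ1 x))
    have h5 := hM w hw
    have h6 := mul_le_mul_of_nonneg_left bj hM0
    rw [hC1]
    nlinarith
  have bA : ∫ x in cube τ, hessSq (avg 1 v 1) x ≤ D * τ ^ d * h := by
    have h1 : ∀ x ∈ (cube τ : Set (Vec d)), ‖hessSq (avg 1 v 1) x‖ ≤ 2 ^ d * h := by
      intro x hx
      rw [Real.norm_of_nonneg (hessSq_nonneg _ _)]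
      exact hessSq_avg_le hv (cube_mono hτ1 hx)
    have h2 := norm_setIntegral_le_of_norm_le_const (μ := volume)
      (isCompact_cube τ).measure_lt_top h1
    rw [volume_cube hτ0.le, mul_pow] at h2
    refine (Real.le_norm_self _).trans (h2.trans (le_of_eq ?_))
    rw [hD]; ring
  have pt : ∀ x, I ^ 2 * hessSq v x ≤ 2 * hessSq (avg 1 v 1) x + 2 * hessSq w x := by
    intro x
    unfold hessSq
    simp only [Finset.mul_sum, ← Finset.sum_add_distrib]
    refine Finset.sum_le_sum fun i _ => Finset.sum_le_sum fun j _ => ?_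
    have := sub_sq_le_two (avg 1 (pd i (pd j v)) 1 x) (avg 1 (pd i (pd j v)) 1 x - I * pd i (pd j v) x)
    rw [pd_avg_one hv, pd_avg_one (hv.pd j), ppw, ← mul_pow]
    simpa using this
  have i1 := integrableOn_cube hv.avg_one.continuous_hessSq τ
  have i2 := integrableOn_cube hw.continuous_hessSq τ
  have main : I ^ 2 * ∫ x in cube τ, hessSq v x ≤ 2 * (D * τ ^ d * h) + 2 * (C₁ * ℓ) := by
    have h1 : I ^ 2 * ∫ x in cube τ, hessSq v x
        ≤ 2 * (∫ x in cube τ, hessSq (avg 1 v 1) x) + 2 * ∫ x in cube τ, hessSq w x := by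
      rw [← integral_const_mul, ← integral_const_mul, ← integral_const_mul,
        ← integral_add (i1.const_mul _) (i2.const_mul _)]
      exact integral_mono ((integrableOn_cube hv.continuous_hessSq τ).const_mul _)
        ((i1.const_mul _).add (i2.const_mul _)) pt
    linarith
  have hI2 : 0 < I ^ 2 := by positivity
  refine ((le_inv_mul_iff₀ hI2).2 main).trans (sub_nonneg.1 ?_)
  have e : (I ^ 2)⁻¹ * (2 * D + 2 * C₁) * τ ^ d * h + (I ^ 2)⁻¹ * (2 * D + 2 * C₁) * ℓ
      - (I ^ 2)⁻¹ * (2 * (D * τ ^ d * h) + 2 * (C₁ * ℓ))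
      = (I ^ 2)⁻¹ * (2 * C₁ * τ ^ d * h + 2 * D * ℓ) := by ring
  rw [e]
  positivity

/-! ### Affine changes of variables -/

theorem pd_comp_affine {v : Vec d → ℝ} (hv : Differentiable ℝ v) (L : Vec d ≃L[ℝ] Vec d) (x₁ : Vec d)
    (i : Fin d) : pd i (fun y => v (x₁ + L y))
      = fun y => ∑ k, L (Pi.single i 1) k * pd k v (x₁ + L y) := by
  funext y
  have h1 : HasFDerivAt (fun y => x₁ + L y) (L : Vec d →L[ℝ] Vec d) y := L.hasFDerivAt.const_add x₁
  have h2 := (hv (x₁ + L y)).hasFDerivAt.comp y h1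
  rw [← fderiv_eq_sum_pd]
  unfold pd
  rw [show (fun y => v (x₁ + L y)) = v ∘ fun y => x₁ + L y from rfl, h2.fderiv]
  rfl

theorem IsTest.comp_affine {v : Vec d → ℝ} (hv : IsTest v) (L : Vec d ≃L[ℝ] Vec d) (x₁ : Vec d) :
    IsTest fun y => v (x₁ + L y) where
  smooth := hv.smooth.comp (contDiff_const.add L.contDiff)
  compact := hv.compact.comp_homeomorph (L.toHomeomorph.trans (Homeomorph.addLeft x₁))

theorem pd_sum {ι : Type*} (s : Finset ι) {f : ι → Vec d → ℝ} (hf : ∀ k, Differentiable ℝ (f k))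
    (i : Fin d) (x : Vec d) : pd i (fun y => ∑ k ∈ s, f k y) x = ∑ k ∈ s, pd i (f k) x := by
  unfold pd
  rw [fderiv_fun_sum fun k _ => hf k x]
  simp

theorem pd_pd_comp_affine {v : Vec d → ℝ} (hv : IsTest v) (L : Vec d ≃L[ℝ] Vec d) (x₁ : Vec d)
    (i j : Fin d) (y : Vec d) : pd i (pd j fun y => v (x₁ + L y)) y
      = ∑ k, ∑ l, L (Pi.single i 1) l * L (Pi.single j 1) k * pd l (pd k v) (x₁ + L y) := by
  rw [pd_comp_affine hv.differentiable,
    pd_sum _ fun k => (((hv.pd k).comp_affine L x₁).mul_left contDiff_const).differentiable]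
  refine Finset.sum_congr rfl fun k _ => ?_
  rw [pd_const_mul ((hv.pd k).comp_affine L x₁).differentiable,
    pd_comp_affine (hv.pd k).differentiable]
  beta_reduce
  rw [Finset.mul_sum]
  exact Finset.sum_congr rfl fun l _ => by ring

/-- Multiplication by a nonzero real as a continuous linear equivalence. -/
def dil {r : ℝ} (hr : r ≠ 0) : Vec d ≃L[ℝ] Vec d :=
  (LinearEquiv.smulOfNeZero ℝ (Vec d) r hr).toContinuousLinearEquiv

theorem pd_pd_comp_smul {v : Vec d → ℝ} (hv : IsTest v) {r : ℝ} (hr : r ≠ 0) (i j : Fin d)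
    (y : Vec d) : pd i (pd j fun y => v (r • y)) y = r ^ 2 * pd i (pd j v) (r • y) := by
  have h := pd_pd_comp_affine hv (dil hr) 0 i j y
  have e : ∀ z : Vec d, (dil hr) z = r • z := fun z => rfl
  simp only [e, zero_add] at h
  rw [h]
  simp [Pi.single_apply, pow_two]

theorem IsTest.comp_smul {v : Vec d → ℝ} (hv : IsTest v) {r : ℝ} (hr : r ≠ 0) :
    IsTest fun y => v (r • y) := by
  have h := hv.comp_affine (dil hr) 0
  simp only [zero_add] at h
  exact h

theorem setIntegral_cube_comp_smul (f : Vec d → ℝ) {r : ℝ} (hr : 0 < r) {t : ℝ} (ht : 0 ≤ t) :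
    ∫ y in cube t, f (r • y) = (r ^ d)⁻¹ * ∫ x in cube (t * r), f x := by
  have h := Measure.setIntegral_comp_smul_of_pos volume f (cube t) hr
  rw [h, Module.finrank_fintype_fun_eq_card, Fintype.card_fin, smul_eq_mul]
  unfold cube
  rw [_root_.smul_closedBall _ _ ht, smul_zero, Real.norm_of_nonneg hr.le, mul_comm r]

/-- Decay of the Hessian at an arbitrary scale. -/
theorem exists_hessian_decay : ∃ C : ℝ, 0 ≤ C ∧ ∀ τ : ℝ, 0 < τ → τ ≤ 1 → ∀ r : ℝ, 0 < r →
    ∀ v : Vec d → ℝ, IsTest v → ∫ x in cube (τ * r), hessSq v x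
      ≤ C * τ ^ d * (∫ x in cube (3 * r), hessSq v x) + C * ∫ x in cube (3 * r), lap v x ^ 2 := by
  obtain ⟨C, hC0, hC⟩ := exists_hessian_decay_unit (d := d)
  refine ⟨C, hC0, fun τ hτ0 hτ1 r hr v hv => ?_⟩
  have h := hC τ hτ0 hτ1 _ (hv.comp_smul hr.ne')
  have e1 : ∀ x, hessSq (fun y => v (r • y)) x = r ^ 4 * hessSq v (r • x) := by
    intro x
    simp only [hessSq, pd_pd_comp_smul hv hr.ne', mul_pow, Finset.mul_sum]
    exact Finset.sum_congr rfl fun i _ => Finset.sum_congr rfl fun j _ => by ring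
  have e2 : ∀ x, lap (fun y => v (r • y)) x ^ 2 = r ^ 4 * lap v (r • x) ^ 2 := by
    intro x
    simp only [lap, pd_pd_comp_smul hv hr.ne', ← Finset.mul_sum, mul_pow]
    ring
  simp only [e1, e2, integral_const_mul] at h
  rw [setIntegral_cube_comp_smul _ hr hτ0.le, setIntegral_cube_comp_smul _ hr (by norm_num),
    setIntegral_cube_comp_smul (fun x => lap v x ^ 2) hr (by norm_num)] at h
  have hp : 0 < r ^ 4 * (r ^ d)⁻¹ := by positivity
  refine le_of_mul_le_mul_left ?_ hp
  linarith

/-! ### Smallness of the gradient at almost harmonic points -/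

/-- The amount by which `v` fails to satisfy `(Δv)² ≤ ε (|D²v|² + 1)`. -/
def excess (ε : ℝ) (v : Vec d → ℝ) (x : Vec d) : ℝ := max 0 (lap v x ^ 2 - ε * (hessSq v x + 1))

theorem excess_nonneg (ε : ℝ) (v : Vec d → ℝ) (x : Vec d) : 0 ≤ excess ε v x := le_max_left _ _

theorem sq_lap_le_excess (ε : ℝ) (v : Vec d → ℝ) (x : Vec d) :
    lap v x ^ 2 ≤ ε * hessSq v x + ε + excess ε v x := by
  have := le_max_right 0 (lap v x ^ 2 - ε * (hessSq v x + 1))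
  unfold excess
  linarith

theorem IsTest.continuous_sq_lap {v : Vec d → ℝ} (hv : IsTest v) :
    Continuous fun x => RS.lap v x ^ 2 := hv.lap.continuous.pow 2

theorem IsTest.continuous_excess {v : Vec d → ℝ} (hv : IsTest v) (ε : ℝ) :
    Continuous (excess ε v) :=
  continuous_const.max
    (hv.continuous_sq_lap.sub (continuous_const.mul (hv.continuous_hessSq.add continuous_const)))

theorem setIntegral_cube_const (c : ℝ) {r : ℝ} (hr : 0 ≤ r) :
    ∫ _ in (cube r : Set (Vec d)), c = (2 * r) ^ d * c := by
  rw [setIntegral_const, volume_cube hr, smul_eq_mul]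

/-- A Caccioppoli inequality. -/
theorem exists_caccioppoli {S : ℝ} (hS : 0 < S) (Q : ℝ) : ∃ E : ℝ, 0 ≤ E ∧ ∀ ε : ℝ, 0 ≤ ε →
    ε ≤ 1 / 8 → ∀ v : Vec d → ℝ, IsTest v →
    (∀ x ∈ (cube (2 * S) : Set (Vec d)), |v x| ≤ Q ∧ ∀ i, |pd i v x| ≤ Q) →
    ∫ x in cube (2 * S), excess ε v x ≤ 1 → ∫ x in cube S, hessSq v x ≤ E := by
  obtain ⟨χ, hχ, hχ0, hχ1, hχe, hχs⟩ := exists_cutoff (d := d) hS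
  obtain ⟨M, hM0, hM⟩ := exists_energy_bound hχ hχs
  set V : ℝ := (2 * (2 * S)) ^ d with hV
  have hV0 : 0 ≤ V := by positivity
  refine ⟨2 * (4 * (V + 1) + M * (V * (Q ^ 2 + d * Q ^ 2))), by positivity,
    fun ε hε0 hε v hv hvQ hx => ?_⟩
  have cH : Continuous fun x => χ x ^ 2 * hessSq v x :=
    (hχ.continuous.pow 2).mul hv.continuous_hessSq
  have cL : Continuous fun x => χ x ^ 2 * lap v x ^ 2 :=
    (hχ.continuous.pow 2).mul hv.continuous_sq_lap
  have h0 : ∫ x in cube S, hessSq v x = ∫ x in cube S, χ x ^ 2 * hessSq v x :=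
    setIntegral_congr_fun (measurableSet_cube S) fun x hx => by simp [hχe x hx]
  have h1 := setIntegral_cube_mono cH (fun x => mul_nonneg (sq_nonneg _) (hessSq_nonneg v x))
    (show S ≤ 2 * S by linarith)
  have h2 : ∫ x in cube (2 * S), χ x ^ 2 * lap v x ^ 2
      ≤ ε * (∫ x in cube (2 * S), χ x ^ 2 * hessSq v x) + V * ε
        + ∫ x in cube (2 * S), excess ε v x := by
    have c1 : Continuous fun x => ε * (χ x ^ 2 * hessSq v x) := cH.const_mul _
    have c2 : Continuous fun _ : Vec d => ε := continuous_const
    have c3 : Continuous fun x => ε * (χ x ^ 2 * hessSq v x) + ε := c1.add c2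
    rw [hV, ← setIntegral_cube_const ε (by positivity), ← integral_const_mul,
      ← integral_add (integrableOn_cube c1 _) (integrableOn_cube c2 _),
      ← integral_add (integrableOn_cube c3 _) (integrableOn_cube (hv.continuous_excess ε) _)]
    refine integral_mono (integrableOn_cube cL _)
      (integrableOn_cube (c3.add (hv.continuous_excess ε)) _) fun x => ?_
    have a := sq_lap_le_excess ε v x
    have b : χ x ^ 2 ≤ 1 := pow_le_one₀ (hχ0 x) (hχ1 x)
    have e := excess_nonneg ε v x
    have c := sq_nonneg (χ x)
    calc χ x ^ 2 * lap v x ^ 2 ≤ χ x ^ 2 * (ε * hessSq v x + ε + excess ε v x) :=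
          mul_le_mul_of_nonneg_left a c
      _ ≤ ε * (χ x ^ 2 * hessSq v x) + ε + excess ε v x := by nlinarith
  have h3 : ∫ x in cube (2 * S), jetSq v x ≤ V * (Q ^ 2 + d * Q ^ 2) := by
    rw [hV, ← setIntegral_cube_const _ (by positivity)]
    refine setIntegral_mono_on (integrableOn_cube hv.continuous_jetSq _)
      (integrableOn_cube continuous_const _) (measurableSet_cube _) fun x hx => ?_
    obtain ⟨a, b⟩ := hvQ x hx
    have sq : ∀ {y : ℝ}, |y| ≤ Q → y ^ 2 ≤ Q ^ 2 := fun h =>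
      sq_le_sq' (neg_le_of_abs_le h) (le_of_abs_le h)
    have := Finset.sum_le_sum fun i (_ : i ∈ Finset.univ) => sq (b i)
    simp only [Finset.sum_const, Finset.card_univ, Fintype.card_fin, nsmul_eq_mul] at this
    unfold jetSq
    linarith [sq a]
  have h4 := hM v hv
  have h5 := mul_le_mul_of_nonneg_left h3 hM0
  have h6 : 0 ≤ ∫ x in cube (2 * S), χ x ^ 2 * hessSq v x :=
    integral_nonneg fun x => mul_nonneg (sq_nonneg _) (hessSq_nonneg v x)
  nlinarith

theorem morrey_iteration (n : ℕ) {C A : ℝ} (hC : 0 ≤ C) (hA : 0 ≤ A) : ∃ ε₁ > 0,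
    ∀ S > 0, ∀ E ≥ 0, ∃ N, 0 ≤ N ∧ ∀ η, 0 < η → ∀ e : ℝ → ℝ,
    (∀ t, 0 ≤ e t) → (∀ t ≤ S, e t ≤ E) →
    (∀ τ, 0 < τ → τ ≤ 1 → ∀ t ∈ Icc η S,
      e (τ * (t / 3)) ≤ C * τ ^ n * e t + C * (ε₁ * (e t + A * t ^ n))) →
    ∀ t ∈ Icc η S, e t * t ≤ N * t ^ n := by
  obtain ⟨σ, hσ0, hσ3, hσC⟩ : ∃ σ : ℝ, 0 < σ ∧ σ ≤ 1 / 3 ∧ σ * (C * 3 ^ n) ≤ 1 / 4 := by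
    refine ⟨min (1 / 3) (1 / (4 * (C * 3 ^ n + 1))), by positivity, min_le_left _ _, ?_⟩
    have hp : 0 ≤ C * 3 ^ n := by positivity
    refine (mul_le_mul_of_nonneg_right (min_le_right _ _) hp).trans ?_
    rw [div_mul_eq_mul_div, div_le_div_iff₀ (by positivity) (by norm_num)]
    linarith
  set ε₁ := σ ^ n / (4 * (C + 1)) with hε₁
  have hCε : C * ε₁ ≤ σ ^ n / 4 := by
    rw [hε₁, ← mul_div_assoc, div_le_div_iff₀ (by positivity) (by norm_num)]
    have : 0 < σ ^ n := by positivity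
    nlinarith
  refine ⟨ε₁, by positivity, fun S hS E hE => ?_⟩
  set N := A * S + E * S / (σ * S) ^ n with hN
  have hN0 : 0 ≤ N := by positivity
  refine ⟨N, hN0, fun η hη e he0 heE hdec => ?_⟩
  have base : ∀ t ∈ Icc η S, σ * S ≤ t → e t * t ≤ N * t ^ n := by
    intro t ht hσt
    have ht0 := hη.trans_le ht.1
    have h1 : e t * t ≤ E * S := mul_le_mul (heE t ht.2) ht.2 ht0.le hE
    have h2 : E * S / (σ * S) ^ n * (σ * S) ^ n = E * S := by field_simp
    have h3 : (σ * S) ^ n ≤ t ^ n := pow_le_pow_left₀ (by positivity) hσt n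
    have h4 : E * S / (σ * S) ^ n * (σ * S) ^ n ≤ E * S / (σ * S) ^ n * t ^ n :=
      mul_le_mul_of_nonneg_left h3 (by positivity)
    have h5 : 0 ≤ A * S * t ^ n := by positivity
    rw [hN]
    nlinarith
  have step : ∀ k : ℕ, ∀ t ∈ Icc η S, σ ^ k * S ≤ t → e t * t ≤ N * t ^ n := by
    intro k
    induction k with
    | zero =>
      intro t ht h
      refine base t ht (le_trans ?_ h)
      nlinarith
    | succ k ih =>
      intro t ht h
      rcases le_total (σ * S) t with h' | h'
      · exact base t ht h'
      have ht0 := hη.trans_le ht.1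
      set t' := t / σ with ht'
      have e1 : t = σ * t' := by rw [ht']; field_simp
      have ht'0 : 0 < t' := by positivity
      have m1 : t' ≤ S := by rw [ht', div_le_iff₀ hσ0]; linarith
      have m2 : η ≤ t' := by
        refine ht.1.trans ?_
        rw [e1]; nlinarith
      have m3 : σ ^ k * S ≤ t' := by
        rw [ht', le_div_iff₀ hσ0]
        rw [pow_succ] at h
        linarith
      have hI := ih t' ⟨m2, m1⟩ m3
      have hD := hdec (3 * σ) (by positivity) (by linarith) t' ⟨m2, m1⟩
      rw [show 3 * σ * (t' / 3) = t by rw [e1]; ring, mul_pow] at hD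
      have q0 : 0 ≤ t' ^ n := by positivity
      have p0 : 0 ≤ σ ^ n := by positivity
      have e0 := he0 t'
      have NA : A * S ≤ N := by rw [hN]; exact le_add_of_nonneg_right (by positivity)
      have a1 : σ * (C * 3 ^ n) * (σ ^ n * (e t' * t')) ≤ 1 / 4 * (σ ^ n * (N * t' ^ n)) :=
        mul_le_mul hσC (mul_le_mul_of_nonneg_left hI p0) (by positivity) (by norm_num)
      have a2 : σ * (C * ε₁) * (e t' * t') ≤ σ ^ n / 4 * (N * t' ^ n) := by
        refine mul_le_mul ?_ hI (by positivity) (by positivity)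
        nlinarith [show 0 ≤ C * ε₁ by positivity]
      have a3 : σ * (C * ε₁) * (A * t' * t' ^ n) ≤ σ ^ n / 4 * (N * t' ^ n) := by
        refine mul_le_mul ?_ (mul_le_mul_of_nonneg_right ?_ q0) (by positivity) (by positivity)
        · nlinarith [show 0 ≤ C * ε₁ by positivity]
        · exact (mul_le_mul_of_nonneg_left m1 hA).trans NA
      have b := mul_le_mul_of_nonneg_right hD ht0.le
      have g : N * t ^ n = N * (σ ^ n * t' ^ n) := by rw [e1, mul_pow]
      rw [g]
      refine b.trans ?_
      have g2 : (C * (3 ^ n * σ ^ n) * e t' + C * (ε₁ * (e t' + A * t' ^ n))) * t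
          = σ * (C * 3 ^ n) * (σ ^ n * (e t' * t')) + σ * (C * ε₁) * (e t' * t')
            + σ * (C * ε₁) * (A * t' * t' ^ n) := by rw [e1]; ring
      rw [g2]
      nlinarith [mul_nonneg p0 (mul_nonneg hN0 q0)]
  intro t ht
  have ht0 := hη.trans_le ht.1
  obtain ⟨k, hk⟩ := exists_pow_lt_of_lt_one (show 0 < t / S by positivity) (show σ < 1 by linarith)
  exact step k t ht ((lt_div_iff₀ hS).1 hk).le

theorem mass_zero_eq {f : Vec d → ℝ} {t : ℝ} (ht : 0 < t) :
    mass f t 0 = (t ^ d)⁻¹ * ∫ x in cube t, f x ^ 2 := by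
  have h := setIntegral_cube_comp_smul (fun x => f (-x) ^ 2) ht zero_le_one
  rw [one_mul, setIntegral_cube_neg fun x => f x ^ 2] at h
  simpa [mass] using h

/-- A Morrey type bound for the Laplacian of almost harmonic functions. -/
theorem exists_morrey_bound {S : ℝ} (hS : 0 < S) (Q : ℝ) : ∃ B ≥ 0, ∃ ε₀ > 0, ∀ ε : ℝ, 0 ≤ ε →
    ε ≤ ε₀ → ∀ η : ℝ, 0 < η → η ≤ 1 → ∀ v : Vec d → ℝ, IsTest v →
    (∀ x ∈ (cube (2 * S) : Set (Vec d)), |v x| ≤ Q ∧ ∀ i, |pd i v x| ≤ Q) →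
    ∫ x in cube (2 * S), excess ε v x ≤ ε * η ^ d →
    ∀ t ∈ Icc η S, t * mass (lap v) t 0 ≤ B * ε := by
  obtain ⟨E, hE0, hE⟩ := exists_caccioppoli (d := d) hS Q
  obtain ⟨C, hC0, hC⟩ := exists_hessian_decay (d := d)
  set A : ℝ := 2 ^ d + 1
  have hA : 0 ≤ A := by positivity
  obtain ⟨ε₁, hε₁, hmor⟩ := morrey_iteration d hC0 hA
  obtain ⟨N, hN0, hN⟩ := hmor S hS E hE0
  refine ⟨N + A * S, by positivity, min ε₁ (1 / 8), by positivity,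
    fun ε hε0 hε η hη0 hη1 v hv hvQ hx t ht => ?_⟩
  set e : ℝ → ℝ := fun t => ∫ x in cube t, hessSq v x
  have he0 : ∀ t, 0 ≤ e t := fun t => integral_nonneg fun x => hessSq_nonneg v x
  have hlap : ∀ t ∈ Icc η S, ∫ x in cube t, lap v x ^ 2 ≤ ε * (e t + A * t ^ d) := by
    intro t ht
    have ht0 := hη0.trans_le ht.1
    have c1 : Continuous fun x => ε * hessSq v x := hv.continuous_hessSq.const_mul _
    have c2 : Continuous fun _ : Vec d => ε := continuous_const
    have c3 : Continuous fun x => ε * hessSq v x + ε := c1.add c2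
    have h1 : ∫ x in cube t, lap v x ^ 2
        ≤ ∫ x in cube t, (ε * hessSq v x + ε + excess ε v x) :=
      integral_mono (integrableOn_cube hv.continuous_sq_lap _)
        (integrableOn_cube (c3.add (hv.continuous_excess ε)) _) (sq_lap_le_excess ε v)
    rw [integral_add (integrableOn_cube c3 _) (integrableOn_cube (hv.continuous_excess ε) _),
      integral_add (integrableOn_cube c1 _) (integrableOn_cube c2 _), integral_const_mul,
      setIntegral_cube_const ε ht0.le, mul_pow] at h1
    have h2 := setIntegral_cube_mono (hv.continuous_excess ε) (excess_nonneg ε v)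
      (show t ≤ 2 * S by linarith [ht.2])
    have h3 : ε * η ^ d ≤ ε * t ^ d :=
      mul_le_mul_of_nonneg_left (pow_le_pow_left₀ hη0.le ht.1 d) hε0
    have : ε * (e t + A * t ^ d) = ε * e t + 2 ^ d * t ^ d * ε + ε * t ^ d := by ring
    rw [this]
    linarith
  have hx1 : ∫ x in cube (2 * S), excess ε v x ≤ 1 := by
    refine hx.trans ?_
    have h1 : η ^ d ≤ 1 := pow_le_one₀ hη0.le hη1
    have h2 : ε ≤ 1 / 8 := hε.trans (min_le_right _ _)
    nlinarith [show 0 ≤ η ^ d by positivity]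
  have heS := hE ε hε0 (hε.trans (min_le_right _ _)) v hv hvQ hx1
  have key := hN η hη0 e he0
    (fun t ht => (setIntegral_cube_mono hv.continuous_hessSq (hessSq_nonneg v) ht).trans heS)
    (fun τ hτ0 hτ1 t ht => by
      have ht0 := hη0.trans_le ht.1
      have h := hC τ hτ0 hτ1 (t / 3) (by positivity) v hv
      rw [mul_div_cancel₀ t (by norm_num : (3 : ℝ) ≠ 0)] at h
      refine h.trans (add_le_add_right (mul_le_mul_of_nonneg_left ((hlap t ht).trans ?_) hC0) _)
      exact mul_le_mul_of_nonneg_right (hε.trans (min_le_left _ _))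
        (add_nonneg (he0 t) (by positivity))) t ht
  have ht0 := hη0.trans_le ht.1
  rw [mass_zero_eq ht0]
  have h1 := mul_le_mul_of_nonneg_left (hlap t ht) ht0.le
  have h2 : t * (ε * (e t + A * t ^ d)) ≤ (N + A * S) * ε * t ^ d := by
    have a : ε * (e t * t) ≤ ε * (N * t ^ d) := mul_le_mul_of_nonneg_left key hε0
    have b : ε * A * t ^ d * t ≤ ε * A * t ^ d * S := mul_le_mul_of_nonneg_left ht.2 (by positivity)
    linarith
  calc t * ((t ^ d)⁻¹ * ∫ x in cube t, lap v x ^ 2)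
      = (t ^ d)⁻¹ * (t * ∫ x in cube t, lap v x ^ 2) := by ring
    _ ≤ (t ^ d)⁻¹ * ((N + A * S) * ε * t ^ d) :=
        mul_le_mul_of_nonneg_left (h1.trans h2) (by positivity)
    _ = (N + A * S) * ε := by field_simp

theorem abs_sub_le_of_sq_deriv_le {F F' : ℝ → ℝ} {a b c : ℝ} (ha : 0 < a) (hab : a ≤ b)
    (hF : ∀ t ∈ Icc a b, HasDerivAt F (F' t) t) (hc : ∀ t ∈ Icc a b, t * F' t ^ 2 ≤ c) :
    |F b - F a| ≤ 2 * √(c * b) := by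
  have hmem : ∀ s ∈ Icc (√a) (√b), s ^ 2 ∈ Icc a b ∧ 0 < s := by
    intro s hs
    have h0 : 0 < s := (Real.sqrt_pos.2 ha).trans_le hs.1
    exact ⟨⟨(Real.sqrt_le_left h0.le).1 hs.1, (Real.le_sqrt' h0).1 hs.2⟩, h0⟩
  have hG : ∀ s ∈ Icc (√a) (√b), HasDerivWithinAt (fun s => F (s ^ 2)) (F' (s ^ 2) * (2 * s))
      (Icc (√a) (√b)) s := by
    intro s hs
    have h1 : HasDerivAt (fun s : ℝ => s ^ 2) (2 * s) s := by simpa using hasDerivAt_pow 2 s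
    exact (HasDerivAt.comp (h := fun s : ℝ => s ^ 2) s (hF _ (hmem s hs).1) h1).hasDerivWithinAt
  have hc0 : 0 ≤ c := (mul_nonneg ha.le (sq_nonneg _)).trans (hc a ⟨le_rfl, hab⟩)
  have hb : ∀ s ∈ Ico (√a) (√b), ‖F' (s ^ 2) * (2 * s)‖ ≤ 2 * √c := by
    intro s hs
    have h := hc _ (hmem s (Ico_subset_Icc_self hs)).1
    rw [Real.norm_eq_abs]
    refine abs_le_of_sq_le_sq ?_ (by positivity)
    rw [mul_pow, mul_pow, mul_pow, Real.sq_sqrt hc0]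
    nlinarith
  have h := norm_image_sub_le_of_norm_deriv_le_segment' hG hb (√b) ⟨Real.sqrt_le_sqrt hab, le_rfl⟩
  rw [Real.sq_sqrt ha.le, Real.sq_sqrt (ha.le.trans hab), Real.norm_eq_abs] at h
  refine h.trans ?_
  rw [Real.sqrt_mul hc0]
  have := Real.sqrt_nonneg a
  nlinarith [Real.sqrt_nonneg c]

theorem avg_const_sub (k : ℕ) {f : Vec d → ℝ} (hf : Continuous f) (η c : ℝ) :
    ∫ z, psi (k + 1) z * (f (0 - η • z) - c)
      = avg (k + 1) f η 0 - c * ∫ z : Vec d, psi (k + 1) z := by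
  have h1 : Continuous fun z : Vec d => f (0 - η • z) := hf.comp (by fun_prop)
  have := integral_sub (integrable_psi_mul k h1) ((integrable_psi_mul k
    (continuous_const : Continuous fun _ : Vec d => c)))
  rw [integral_mul_const, mul_comm _ c] at this
  rw [avg, ← this]
  exact integral_congr_ae (Eventually.of_forall fun z => mul_sub _ _ _)

theorem psi_mul_le (k : ℕ) {η : ℝ} (hη : 0 ≤ η) {f : Vec d → ℝ} {c : ℝ}
    (h : ∀ x ∈ (cube η : Set (Vec d)), f x ≤ c) (z : Vec d) :
    psi (k + 1) z * f (0 - η • z) ≤ psi (k + 1) z * c := by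
  by_cases hz : z ∈ (cube 1 : Set (Vec d))
  · refine mul_le_mul_of_nonneg_left (h _ ?_) (psi_nonneg _ _)
    rw [mem_cube] at hz ⊢
    rw [zero_sub, norm_neg, norm_smul, Real.norm_of_nonneg hη]
    exact mul_le_of_le_one_right hη hz
  · simp [psi_eq_zero hz]

theorem avg_le (k : ℕ) {f : Vec d → ℝ} (hf : Continuous f) {η : ℝ} (hη : 0 ≤ η) {c : ℝ}
    (h : ∀ x ∈ (cube η : Set (Vec d)), f x ≤ c) :
    avg (k + 1) f η 0 ≤ c * ∫ z : Vec d, psi (k + 1) z := by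
  rw [mul_comm, ← integral_mul_const]
  exact integral_mono (integrable_psi_mul k
    (hf.comp (by fun_prop : Continuous fun z : Vec d => 0 - η • z)))
    (integrable_psi_mul k (continuous_const : Continuous fun _ : Vec d => c)) (psi_mul_le k hη h)

theorem abs_avg_sub_le (k : ℕ) {f : Vec d → ℝ} (hf : Continuous f) {η : ℝ} (hη : 0 ≤ η) {ℓ κ : ℝ}
    (h : ∀ x ∈ (cube η : Set (Vec d)), |f x - ℓ| ≤ κ) :
    |avg (k + 1) f η 0 - ℓ * ∫ z : Vec d, psi (k + 1) z| ≤ κ * ∫ z : Vec d, psi (k + 1) z := by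
  have h1 := avg_le (f := fun x => f x - ℓ) (c := κ) k (hf.sub continuous_const) hη
    fun x hx => le_of_abs_le (h x hx)
  have h2 := avg_le (f := fun x => ℓ - f x) (c := κ) k (continuous_const.sub hf) hη
    fun x hx => by linarith [neg_le_of_abs_le (h x hx)]
  have e1 := avg_const_sub k hf η ℓ
  have e2 : avg (k + 1) (fun x => ℓ - f x) η 0 = - avg (k + 1) (fun x => f x - ℓ) η 0 := by
    rw [avg, avg, ← integral_neg]
    exact integral_congr_ae (Eventually.of_forall fun z => by ring)
  rw [e2] at h2
  unfold avg at h1 h2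
  rw [e1] at h1 h2
  exact abs_le.2 ⟨by linarith, h1⟩

theorem abs_avg_pd_le {v : Vec d → ℝ} (hv : IsTest v) {S : ℝ} (hS : 0 < S)
    (h0 : ∀ x ∈ (cube S : Set (Vec d)), 0 ≤ v x) (j : Fin d) :
    |avg 2 (pd j v) S 0| ≤ 4 / S * avg 1 v S 0 := by
  have h := integral_coord_mul_psi 0 hv S 0 j
  have hc : Continuous fun z : Vec d => v (0 - S • z) := hv.continuous.comp (by fun_prop)
  have h1 : |∫ z, psi 1 z * (z j * v (0 - S • z))| ≤ avg 1 v S 0 := by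
    refine (Real.norm_eq_abs _ ▸ norm_integral_le_of_norm_le (integrable_psi_mul 0 hc)
      (Eventually.of_forall fun z => ?_))
    by_cases hz : z ∈ (cube 1 : Set (Vec d))
    · have hz' := mem_cube.1 hz
      have hv0 : 0 ≤ v (0 - S • z) := by
        refine h0 _ ?_
        rw [mem_cube, zero_sub, norm_neg, norm_smul, Real.norm_of_nonneg hS.le]
        exact mul_le_of_le_one_right hS.le hz'
      rw [norm_mul, Real.norm_of_nonneg (psi_nonneg _ _), norm_mul, Real.norm_of_nonneg hv0]
      exact mul_le_mul_of_nonneg_left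
        (mul_le_of_le_one_left hv0 ((norm_le_pi_norm z j).trans hz')) (psi_nonneg _ _)
    · have := psi_eq_zero (k := 0) hz
      simp [zero_add] at this
      simp [this]
  have h2 : S * |avg 2 (pd j v) S 0| = 4 * |∫ z, psi 1 z * (z j * v (0 - S • z))| := by
    norm_num at h
    rw [← abs_of_pos hS, ← abs_mul, abs_of_pos hS]
    simp only [zero_sub] at h ⊢
    rw [h, abs_neg, abs_mul]
    norm_num
  rw [div_mul_eq_mul_div, le_div_iff₀ hS]
  linarith

/-- Quantitative Liouville property: a nonnegative function, normalized at the origin and almost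
harmonic on a large cube, has a small gradient at the origin. -/
theorem exists_gradient_smallness {κ : ℝ} (hκ : 0 < κ) : ∃ S : ℝ, 1 ≤ S ∧ ∀ Q : ℝ, ∃ ε > 0,
    ∀ η : ℝ, 0 < η → η ≤ 1 → ∀ v : Vec d → ℝ, IsTest v →
    (∀ x ∈ (cube (2 * S) : Set (Vec d)), 0 ≤ v x ∧ v x ≤ Q ∧ ∀ i, |pd i v x| ≤ Q) →
    (∀ x ∈ (cube η : Set (Vec d)), v x ≤ 2) →
    ∫ x in cube (2 * S), excess ε v x ≤ ε * η ^ d →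
    ∀ (j : Fin d) (ℓ : ℝ), (∀ x ∈ (cube η : Set (Vec d)), |pd j v x - ℓ| ≤ κ) → |ℓ| ≤ 2 * κ := by
  set I₁ := ∫ z : Vec d, psi 1 z
  set I₂ := ∫ z : Vec d, psi 2 z
  have hI1 : 0 < I₁ := integral_psi_pos 0
  have hI2 : 0 < I₂ := integral_psi_pos 1
  set S : ℝ := max 1 (16 * I₁ / (κ * I₂))
  have hS1 : 1 ≤ S := le_max_left _ _
  have hS0 : 0 < S := by linarith
  have hSI : 8 * I₁ / S ≤ κ * I₂ / 2 := by
    have : 16 * I₁ / (κ * I₂) ≤ S := le_max_right _ _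
    rw [div_le_iff₀ (by positivity)] at this
    rw [div_le_div_iff₀ hS0 (by norm_num)]
    linarith
  refine ⟨S, hS1, fun Q => ?_⟩
  obtain ⟨B, hB, ε₀, hε₀, hM⟩ := exists_morrey_bound (d := d) hS0 Q
  obtain ⟨ε, hε, hεε, hsmall⟩ : ∃ ε > 0, ε ≤ ε₀ ∧
      4 / S * (2 * √(2 ^ d * (S ^ 2 * (B * ε)) * S)) + 2 * √(2 ^ d * (B * ε) * S)
        ≤ κ * I₂ / 2 := by
    have hc : Continuous fun ε : ℝ =>
      4 / S * (2 * √(2 ^ d * (S ^ 2 * (B * ε)) * S)) + 2 * √(2 ^ d * (B * ε) * S) := by fun_prop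
    have h := hc.tendsto 0
    simp only [mul_zero, zero_mul, Real.sqrt_zero, add_zero] at h
    have h' := (h.mono_left nhdsWithin_le_nhds).eventually_le_const (u := κ * I₂ / 2)
      (by positivity) (l := 𝓝[>] (0 : ℝ))
    have h'' : ∀ᶠ ε in 𝓝[>] (0 : ℝ), ε ∈ Ioc 0 ε₀ := Ioc_mem_nhdsGT hε₀
    obtain ⟨ε, h1, h2⟩ := (h'.and h'').exists
    exact ⟨ε, h2.1, h2.2, h1⟩
  refine ⟨ε, hε, fun η hη0 hη1 v hv hvQ hv2 hx j ℓ hℓ => ?_⟩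
  have hηS : η ≤ S := hη1.trans hS1
  have hmass := hM ε hε.le hεε η hη0 hη1 v hv
    (fun x hx => ⟨abs_le.2 ⟨by linarith [hvQ x hx], (hvQ x hx).2.1⟩, (hvQ x hx).2.2⟩) hx
  have d1 : |avg 1 v S 0 - avg 1 v η 0| ≤ 2 * √(2 ^ d * (S ^ 2 * (B * ε)) * S) := by
    refine abs_sub_le_of_sq_deriv_le hη0 hηS (fun t _ => hasDerivAt_avg 0 hv t 0) fun t ht => ?_
    have ht0 := hη0.trans_le ht.1
    have h1 := sq_avg_le 1 hv.lap.continuous t 0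
    have h2 := hmass t ht
    have h3 : t ^ 2 ≤ S ^ 2 := pow_le_pow_left₀ ht0.le ht.2 2
    have h4 := mul_le_mul_of_nonneg_left h1 (show 0 ≤ t ^ 2 * t by positivity)
    have h5 := mul_le_mul h3 h2 (mul_nonneg ht0.le (mass_nonneg _ _ _)) (sq_nonneg S)
    have h6 := mul_le_mul_of_nonneg_left h5 (show (0 : ℝ) ≤ 2 ^ d by positivity)
    have h7 : 0 ≤ t ^ 2 * t * avg (0 + 2) (lap v) t 0 ^ 2 := by positivity
    norm_num at h1 h4 h7 ⊢
    rw [mul_pow, mul_pow]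
    nlinarith
  have d2 : |avg 2 (pd j v) S 0 - avg 2 (pd j v) η 0| ≤ 2 * √(2 ^ d * (B * ε) * S) := by
    refine abs_sub_le_of_sq_deriv_le hη0 hηS (fun t _ => hasDerivAt_avg_pd 1 hv j t 0) fun t ht => ?_
    have ht0 := hη0.trans_le ht.1
    have h1 := sq_integral_coord_psi_le 1 hv.lap.continuous t 0 j
    have h2 := mul_le_mul_of_nonneg_left (hmass t ht) (show (0 : ℝ) ≤ 2 ^ d by positivity)
    have h3 := mul_le_mul_of_nonneg_left h1 ht0.le
    rw [neg_sq]
    linarith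
  have d3 := abs_avg_pd_le hv hS0 (fun x hx => (hvQ x (cube_mono (by linarith) hx)).1) j
  have d4 := avg_le 0 hv.continuous hη0.le hv2
  have d5 := abs_avg_sub_le 1 (hv.pd j).continuous hη0.le hℓ
  norm_num at d4 d5
  have d6 : 4 / S * avg 1 v S 0 ≤ 8 * I₁ / S + 4 / S * (2 * √(2 ^ d * (S ^ 2 * (B * ε)) * S)) := by
    have h1 : avg 1 v S 0 ≤ 2 * I₁ + 2 * √(2 ^ d * (S ^ 2 * (B * ε)) * S) := by
      linarith [le_of_abs_le d1]
    refine (mul_le_mul_of_nonneg_left h1 (by positivity)).trans (le_of_eq ?_)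
    ring
  have d7 : |ℓ * I₂| ≤ |avg 2 (pd j v) η 0 - ℓ * I₂| + |avg 2 (pd j v) S 0 - avg 2 (pd j v) η 0|
      + |avg 2 (pd j v) S 0| := by
    rw [abs_le]
    constructor <;> cases abs_cases (avg 2 (pd j v) η 0 - ℓ * I₂) <;>
      cases abs_cases (avg 2 (pd j v) S 0 - avg 2 (pd j v) η 0) <;>
      cases abs_cases (avg 2 (pd j v) S 0) <;> linarith
  rw [abs_mul, abs_of_pos hI2] at d7
  refine le_of_mul_le_mul_right ?_ hI2
  linarith

/-! ### Mollification -/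

/-- The convolution of two real functions. -/
def conv (w k : Vec d → ℝ) (x : Vec d) : ℝ := ∫ t, w t * k (x - t)

theorem conv_eq_convolution (w k : Vec d → ℝ) :
    conv w k = convolution w k (ContinuousLinearMap.mul ℝ ℝ) volume := by
  ext x
  simp [conv, convolution]

theorem conv_eq_convolution_smul (w k : Vec d → ℝ) :
    conv w k = convolution w k (ContinuousLinearMap.lsmul ℝ ℝ) volume := by
  ext x
  simp [conv, convolution]

theorem conv_comm (w k : Vec d → ℝ) : conv w k = conv k w := by
  ext x
  unfold conv
  rw [← integral_sub_left_eq_self _ volume x]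
  exact integral_congr_ae (Eventually.of_forall fun t => by simp [mul_comm])

theorem pd_conv {w k : Vec d → ℝ} (hw : LocallyIntegrable w) (hk : ContDiff ℝ 1 k)
    (hc : HasCompactSupport k) (i : Fin d) : pd i (conv w k) = conv w (pd i k) := by
  ext x
  rw [pd, conv_eq_convolution, (hc.hasFDerivAt_convolution_right
    (ContinuousLinearMap.mul ℝ ℝ) hw hk x).fderiv,
    convolution_precompR_apply _ hw (hc.fderiv (𝕜 := ℝ)) (hk.continuous_fderiv one_ne_zero)]
  simp [conv, convolution, pd]

/-- Smooth probability densities supported in the ball of radius `r`. -/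
structure IsMollifier (r : ℝ) (w : Vec d → ℝ) : Prop where
  test : IsTest w
  nonneg : ∀ x, 0 ≤ w x
  integral_eq : ∫ x, w x = 1
  support : Function.support w ⊆ ball 0 r

theorem exists_isMollifier {r : ℝ} (hr : 0 < r) : ∃ w : Vec d → ℝ, IsMollifier r w := by
  let φ : ContDiffBump (0 : Vec d) := ⟨r / 2, r, half_pos hr, half_lt_self hr⟩
  exact ⟨φ.normed volume, ⟨φ.contDiff_normed, φ.hasCompactSupport_normed⟩, φ.nonneg_normed,
    φ.integral_normed, φ.support_normed_eq.subset⟩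

namespace IsMollifier

variable {r : ℝ} {w k : Vec d → ℝ}

theorem integrable_mul (hw : IsMollifier r w) (hk : LocallyIntegrable k) (x : Vec d) :
    Integrable fun t => w t * k (x - t) :=
  hw.test.compact.convolutionExists_left (ContinuousLinearMap.mul ℝ ℝ) hw.test.continuous hk x

theorem continuous_conv (hw : IsMollifier r w) (hk : LocallyIntegrable k) :
    Continuous (conv w k) := by
  rw [conv_eq_convolution]
  exact hw.test.compact.continuous_convolution_left _ hw.test.continuous hk

theorem isTest_conv (hw : IsMollifier r w) (hk : LocallyIntegrable k) (hc : HasCompactSupport k) :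
    IsTest (conv w k) := by
  rw [conv_eq_convolution]
  exact ⟨hw.test.compact.contDiff_convolution_left _ hw.test.smooth hk,
    hw.test.compact.convolution _ hc⟩

theorem abs_conv_sub_le (hw : IsMollifier r w) (hk : Continuous k) {x : Vec d} {δ : ℝ} (hδ : 0 ≤ δ)
    (h : ∀ y, ‖y - x‖ < r → |k y - k x| ≤ δ) : |conv w k x - k x| ≤ δ := by
  rw [conv_eq_convolution_smul, ← Real.dist_eq]
  exact dist_convolution_le hδ hw.support hw.nonneg hw.integral_eq hk.aestronglyMeasurable
    fun y hy => h y (by rwa [← dist_eq_norm])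

theorem sq_conv_le (hw : IsMollifier r w) (hk : MemLp k 2) (x : Vec d) :
    conv w k x ^ 2 ≤ conv w (fun y => k y ^ 2) x := by
  have h1 := hw.integrable_mul (hk.locallyIntegrable (by norm_num)) x
  have h2 := hw.integrable_mul hk.integrable_sq.locallyIntegrable x
  have h3 := hw.test.integrable
  set m := conv w k x
  have h : 0 ≤ ∫ t, (w t * k (x - t) ^ 2 - 2 * m * (w t * k (x - t)) + m ^ 2 * w t) :=
    integral_nonneg fun t => by
      have := mul_nonneg (hw.nonneg t) (sq_nonneg (k (x - t) - m))
      simp only [Pi.zero_apply]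
      linarith
  have h12 : Integrable fun t => w t * k (x - t) ^ 2 - 2 * m * (w t * k (x - t)) :=
    h2.sub (h1.const_mul _)
  rw [integral_add h12 (h3.const_mul _), integral_sub h2 (h1.const_mul _),
    integral_const_mul, integral_const_mul, hw.integral_eq] at h
  change 0 ≤ conv w (fun y => k y ^ 2) x - 2 * m * m + m ^ 2 * 1 at h
  linarith

theorem setIntegral_sq_conv_le (hw : IsMollifier r w) (hk : MemLp k 2) (R : ℝ) :
    ∫ x in cube R, conv w k x ^ 2 ≤ ∫ x, k x ^ 2 := by
  have hi : Integrable (conv w fun y => k y ^ 2) := by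
    rw [conv_eq_convolution]
    exact hw.test.integrable.integrable_convolution _ hk.integrable_sq
  have e : ∫ x, conv w (fun y => k y ^ 2) x = ∫ x, k x ^ 2 := by
    rw [conv_eq_convolution, integral_convolution _ hw.test.integrable hk.integrable_sq,
      hw.integral_eq]
    simp
  have hc : Continuous (conv w k) := hw.continuous_conv (hk.locallyIntegrable (by norm_num))
  rw [← e]
  refine (setIntegral_mono (integrableOn_cube (hc.pow 2) R) hi.integrableOn
    (hw.sq_conv_le hk)).trans (setIntegral_le_integral hi (Eventually.of_forall fun x => ?_))
  exact integral_nonneg fun t => mul_nonneg (hw.nonneg t) (sq_nonneg _)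

theorem conv_sub (hw : IsMollifier r w) {k₁ k₂ : Vec d → ℝ} (h₁ : LocallyIntegrable k₁)
    (h₂ : LocallyIntegrable k₂) (x : Vec d) :
    conv w (fun y => k₁ y - k₂ y) x = conv w k₁ x - conv w k₂ x := by
  unfold conv
  rw [← integral_sub (hw.integrable_mul h₁ x) (hw.integrable_mul h₂ x)]
  exact integral_congr_ae (Eventually.of_forall fun t => mul_sub _ _ _)

end IsMollifier

theorem exists_radius {k : Vec d → ℝ} (hk : Continuous k) (hc : HasCompactSupport k) {δ : ℝ}
    (hδ : 0 < δ) : ∃ r₀ > 0, ∀ r ≤ r₀, ∀ w, IsMollifier r w → ∀ x, |conv w k x - k x| ≤ δ := by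
  obtain ⟨r₀, hr₀, h⟩ := Metric.uniformContinuous_iff.1 (hc.uniformContinuous_of_continuous hk) δ hδ
  refine ⟨r₀, hr₀, fun r hr w hw x => hw.abs_conv_sub_le hk hδ.le fun y hy => ?_⟩
  have := h (a := y) (b := x) (by rw [dist_eq_norm]; linarith)
  rw [Real.dist_eq] at this
  exact this.le

theorem exists_radius_sq {k : Vec d → ℝ} (hk : MemLp k 2) {R : ℝ} (hR : 0 ≤ R) {δ : ℝ} (hδ : 0 < δ) :
    ∃ r₀ > 0, ∀ r ≤ r₀, ∀ w, IsMollifier r w → ∫ x in cube R, (conv w k x - k x) ^ 2 ≤ δ := by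
  obtain ⟨g, hgc, hg, hgcont, hg2⟩ := MemLp.exists_hasCompactSupport_integral_rpow_sub_le
    (p := 2) (by norm_num) (by simpa using hk) (show 0 < δ / 9 by positivity)
  simp only [ENNReal.ofReal_ofNat] at hg2
  have hg' : ∫ x, (k x - g x) ^ 2 ≤ δ / 9 := by
    refine le_trans (le_of_eq ?_) hg
    exact integral_congr_ae (Eventually.of_forall fun x => by simp)
  set V : ℝ := (2 * R) ^ d with hV
  have hV0 : 0 ≤ V := by positivity
  set s : ℝ := min 1 (δ / (9 * (V + 1)))
  have hs0 : 0 < s := by positivity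
  obtain ⟨r₀, hr₀, hr⟩ := exists_radius hgcont hgc hs0
  refine ⟨r₀, hr₀, fun r hrr w hw => ?_⟩
  have hkg : MemLp (fun x => k x - g x) 2 := hk.sub hg2
  have l1 := hk.locallyIntegrable (by norm_num)
  have l2 := hg2.locallyIntegrable (by norm_num)
  have l3 := hkg.locallyIntegrable (by norm_num)
  have i1 : IntegrableOn (fun x => conv w (fun y => k y - g y) x ^ 2) (cube R) :=
    integrableOn_cube ((hw.continuous_conv l3).pow 2) R
  have i2 : IntegrableOn (fun x => (k x - g x) ^ 2) (cube R) := hkg.integrable_sq.integrableOn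
  have i3 : IntegrableOn (fun _ : Vec d => s ^ 2) (cube R) := integrableOn_cube continuous_const R
  have b1 := hw.setIntegral_sq_conv_le hkg R
  have b2 : ∫ x in cube R, (k x - g x) ^ 2 ≤ ∫ x, (k x - g x) ^ 2 :=
    setIntegral_le_integral hkg.integrable_sq (Eventually.of_forall fun x => sq_nonneg _)
  have b3 : V * s ^ 2 ≤ δ / 9 := by
    have h1 : s ^ 2 ≤ δ / (9 * (V + 1)) := by
      have : s ^ 2 ≤ s := by nlinarith [min_le_left 1 (δ / (9 * (V + 1)))]
      exact this.trans (min_le_right _ _)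
    refine (mul_le_mul_of_nonneg_left h1 hV0).trans ?_
    rw [← mul_div_assoc, div_le_div_iff₀ (by positivity) (by norm_num)]
    nlinarith
  have i12 : IntegrableOn
      (fun x => 3 * conv w (fun y => k y - g y) x ^ 2 + 3 * (k x - g x) ^ 2) (cube R) :=
    (i1.const_mul 3).add (i2.const_mul 3)
  have hm : ∫ x in cube R, (conv w k x - k x) ^ 2
      ≤ ∫ x in cube R, (3 * conv w (fun y => k y - g y) x ^ 2 + 3 * (k x - g x) ^ 2
        + 3 * s ^ 2) := by
    refine integral_mono_of_nonneg (Eventually.of_forall fun x => sq_nonneg _)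
      (i12.add (i3.const_mul 3))
      (Eventually.of_forall fun x => ?_)
    have h1 := hr r hrr w hw x
    have h2 : (conv w g x - g x) ^ 2 ≤ s ^ 2 :=
      sq_le_sq' (neg_le_of_abs_le h1) (le_of_abs_le h1)
    have h3 := hw.conv_sub l1 l2 x
    have h4 : conv w k x - k x = conv w (fun y => k y - g y) x - (k x - g x)
      + (conv w g x - g x) := by rw [h3]; ring
    simp only [h4]
    set a := conv w (fun y => k y - g y) x
    set b := k x - g x
    set c := conv w g x - g x
    nlinarith [sq_nonneg (a + b), sq_nonneg (a - c), sq_nonneg (b + c)]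
  rw [integral_add i12 (i3.const_mul 3),
    integral_add (i1.const_mul 3) (i2.const_mul 3), integral_const_mul, integral_const_mul,
    integral_const_mul, setIntegral_cube_const _ hR] at hm
  linarith

/-! ### Approximation by test functions -/

/-- `H` is the distributional Hessian of `u`. -/
def IsWeakHess (u : Vec d → ℝ) (H : Vec d → Matrix (Fin d) (Fin d) ℝ) : Prop :=
  ∀ i j φ, IsTest φ → ∫ x, u x * pd i (pd j φ) x = ∫ x, H x i j * φ x

theorem isWeakHess_of_isWeakPartial {u : Vec d → ℝ} {g : Vec d → Vec d}
    {H : Vec d → Matrix (Fin d) (Fin d) ℝ} (h₁ : ∀ i, IsWeakPartial u (fun x => g x i) i)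
    (h₂ : ∀ i j, IsWeakPartial (fun x => g x j) (fun x => H x i j) i) : IsWeakHess u H := by
  intro i j φ hφ
  have e1 := h₁ j (pd i φ) (hφ.pd i).smooth (hφ.pd i).compact
  have e2 := h₂ i j φ hφ.smooth hφ.compact
  simp only [pd_comm hφ i j]
  change ∫ x, u x * pd j (pd i φ) x = _ at e1
  rw [e1, neg_eq_iff_eq_neg]
  exact e2

namespace IsMollifier

variable {r : ℝ} {w : Vec d → ℝ}

theorem norm_le_of_mem_tsupport (hw : IsMollifier r w) {x : Vec d} (hx : x ∈ tsupport w) :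
    ‖x‖ ≤ r := by
  have : tsupport w ⊆ closedBall 0 r :=
    closure_minimal (hw.support.trans ball_subset_closedBall) isClosed_closedBall
  simpa using this hx

theorem pd_pd_conv (hw : IsMollifier r w) {u f : Vec d → ℝ}
    {H G : Vec d → Matrix (Fin d) (Fin d) ℝ} (hH : IsWeakHess u H) (hf : LocallyIntegrable f)
    (x : Vec d) (hfu : ∀ y, ‖y - x‖ ≤ r → f y = u y) (i j : Fin d)
    (hHG : ∀ y, ‖y - x‖ ≤ r → G y i j = H y i j) :
    pd i (pd j (conv w f)) x = conv w (fun y => G y i j) x := by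
  have hΦ : IsTest fun t => w (x + dil (neg_ne_zero.2 one_ne_zero) t) := hw.test.comp_affine _ x
  have hd : ∀ t : Vec d, x + dil (d := d) (neg_ne_zero.2 (one_ne_zero (α := ℝ))) t = x - t := by
    intro t
    change x + (-1 : ℝ) • t = _
    rw [neg_one_smul, sub_eq_add_neg]
  have e1 : ∀ t, pd i (pd j fun t => w (x + dil (neg_ne_zero.2 one_ne_zero) t)) t
      = pd i (pd j w) (x - t) := by
    intro t
    rw [pd_pd_comp_affine hw.test, hd]
    have e : ∀ z : Vec d, dil (d := d) (neg_ne_zero.2 (one_ne_zero (α := ℝ))) z = -z := fun z => by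
      change (-1 : ℝ) • z = _
      rw [neg_one_smul]
    simp [e, Pi.single_apply]
  have h := hH i j _ hΦ
  simp_rw [e1] at h
  simp only [hd] at h
  rw [conv_comm w f, pd_conv hf (hw.test.smooth.of_le (by simp)) hw.test.compact,
    pd_conv hf ((hw.test.pd j).smooth.of_le (by simp)) (hw.test.pd j).compact, conv_comm w]
  have near : ∀ t, x - t ∈ tsupport w → ‖t - x‖ ≤ r := fun t ht => by
    rw [norm_sub_rev]
    exact hw.norm_le_of_mem_tsupport ht
  calc conv f (pd i (pd j w)) x = ∫ t, u t * pd i (pd j w) (x - t) := by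
        refine integral_congr_ae (Eventually.of_forall fun t => ?_)
        by_cases ht : pd i (pd j w) (x - t) = 0
        · simp [ht]
        · beta_reduce
          rw [hfu t (near t (tsupport_pd_subset j w (support_pd_subset i _ ht)))]
    _ = ∫ t, H t i j * w (x - t) := h
    _ = conv (fun y => G y i j) w x := by
        refine integral_congr_ae (Eventually.of_forall fun t => ?_)
        by_cases ht : w (x - t) = 0
        · simp [ht]
        · simp only [hHG t (near t (subset_tsupport w ht))]

end IsMollifier

/-- A `C¹` function whose weak Hessian is locally square integrable is approximated by test
functions, in `C¹` and with the Hessian in `L²`, on every cube. -/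
theorem exists_isTest_approx {u : Vec d → ℝ} {H : Vec d → Matrix (Fin d) (Fin d) ℝ}
    (hu : ContDiff ℝ 1 u) (hH : IsWeakHess u H)
    (hm : ∀ i j, AEMeasurable fun x => H x i j)
    (hi : ∀ i j R, IntegrableOn (fun x => H x i j ^ 2) (cube R))
    {R : ℝ} (hR : 0 ≤ R) {δ : ℝ} (hδ : 0 < δ) :
    ∃ v, IsTest v ∧ (∀ x ∈ cube R, |v x - u x| ≤ δ ∧ ∀ i, |pd i v x - pd i u x| ≤ δ) ∧
      ∀ i j, ∫ x in cube R, (pd i (pd j v) x - H x i j) ^ 2 ≤ δ := by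
  obtain ⟨χ, hχ, -, -, hχ1, -⟩ := exists_cutoff (d := d) (show 0 < R + 2 by positivity)
  set f : Vec d → ℝ := fun x => χ x * u x with hf
  have hfu : ∀ x ∈ cube (R + 2), f x = u x := fun x hx => by simp [hf, hχ1 x hx]
  have hf1 : ContDiff ℝ 1 f := (hχ.smooth.of_le (by simp)).mul hu
  have hfc : HasCompactSupport f := hχ.compact.mul_right
  have hpf : ∀ x ∈ cube R, ∀ i, pd i f x = pd i u x := by
    intro x hx i
    have : f =ᶠ[𝓝 x] u := by
      have hb : ball (0 : Vec d) (R + 2) ∈ 𝓝 x := isOpen_ball.mem_nhds (by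
        rw [mem_ball_zero_iff]
        linarith [mem_cube.1 hx])
      filter_upwards [hb] with y hy
      exact hfu y (ball_subset_closedBall hy)
    rw [pd, pd, this.fderiv_eq]
  set G : Vec d → Matrix (Fin d) (Fin d) ℝ := (cube (R + 1)).indicator H with hG
  have hGe : ∀ i j, (fun x => G x i j) = (cube (R + 1)).indicator fun x => H x i j := by
    intro i j
    ext x
    by_cases hx : x ∈ cube (R + 1) <;> simp [hG, hx]
  have hG2 : ∀ i j, MemLp (fun x => G x i j) 2 := by
    intro i j
    rw [hGe, memLp_indicator_iff_restrict (measurableSet_cube _),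
      memLp_two_iff_integrable_sq (hm i j).aestronglyMeasurable.restrict]
    exact hi i j _
  have hpc : ∀ i, Continuous (pd i f) := fun i =>
    (hf1.continuous_fderiv one_ne_zero).clm_apply continuous_const
  have hpcs : ∀ i, HasCompactSupport (pd i f) := fun i =>
    hfc.mono' (support_pd_subset i f)
  obtain ⟨r₀, hr₀, h₀⟩ := exists_radius hf1.continuous hfc hδ
  choose r₁ hr₁ h₁ using fun i => exists_radius (hpc i) (hpcs i) hδ
  choose r₂ hr₂ h₂ using fun i j => exists_radius_sq (hG2 i j) hR hδ
  have hev : ∀ᶠ r in 𝓝[>] (0 : ℝ), 0 < r ∧ r ≤ 1 ∧ r ≤ r₀ ∧ (∀ i, r ≤ r₁ i) ∧ ∀ i j, r ≤ r₂ i j := by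
    have hle : ∀ {s : ℝ}, 0 < s → ∀ᶠ r in 𝓝[>] (0 : ℝ), r ≤ s := fun hs =>
      (eventually_le_nhds hs).filter_mono nhdsWithin_le_nhds
    exact (eventually_mem_nhdsWithin (a := (0 : ℝ)) (s := Ioi 0)).and ((hle one_pos).and ((hle hr₀).and
      ((eventually_all.2 fun i => hle (hr₁ i)).and
        (eventually_all.2 fun i => eventually_all.2 fun j => hle (hr₂ i j)))))
  obtain ⟨r, hr, hr1, hrr₀, hrr₁, hrr₂⟩ := hev.exists
  obtain ⟨w, hw⟩ := exists_isMollifier (d := d) hr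
  have hfl : LocallyIntegrable f := hf1.continuous.locallyIntegrable
  refine ⟨conv w f, hw.isTest_conv hfl hfc, fun x hx => ⟨?_, fun i => ?_⟩, fun i j => ?_⟩
  · rw [← hfu x (cube_mono (by linarith) hx)]
    exact h₀ r hrr₀ w hw x
  · rw [← hpf x hx, pd_conv hw.test.continuous.locallyIntegrable hf1 hfc]
    exact h₁ i r (hrr₁ i) w hw x
  · refine le_trans (le_of_eq ?_) (h₂ i j r (hrr₂ i j) w hw)
    refine setIntegral_congr_fun (measurableSet_cube R) fun x hx => ?_
    have hn : ∀ y, ‖y - x‖ ≤ r → ‖y‖ ≤ R + 1 := fun y hy => by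
      have := norm_le_norm_add_norm_sub' y x
      linarith [mem_cube.1 hx]
    simp only [hw.pd_pd_conv (G := G) hH hfl x
      (fun y hy => hfu y (mem_cube.2 (by linarith [hn y hy]))) i j
      (fun y hy => by rw [hG, indicator_of_mem (mem_cube.2 (hn y hy))])]
    have : G x = H x := by rw [hG, indicator_of_mem (cube_mono (by linarith) hx)]
    rw [this]

/-! ### Euclidean norms and affine changes of variables -/

theorem nrm_nonneg (x : Vec d) : 0 ≤ nrm x := Real.sqrt_nonneg _

theorem nrm_sq (x : Vec d) : nrm x ^ 2 = ∑ i, x i ^ 2 :=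
  Real.sq_sqrt (Finset.sum_nonneg fun _ _ => sq_nonneg _)

theorem abs_apply_le_nrm (x : Vec d) (i : Fin d) : |x i| ≤ nrm x :=
  Real.abs_le_sqrt (Finset.single_le_sum (f := fun i => x i ^ 2) (fun _ _ => sq_nonneg _)
    (Finset.mem_univ i))

theorem norm_le_nrm (x : Vec d) : ‖x‖ ≤ nrm x :=
  (pi_norm_le_iff_of_nonneg (nrm_nonneg x)).2 (abs_apply_le_nrm x)

theorem nrm_le_sum_abs (x : Vec d) : nrm x ≤ ∑ i, |x i| := by
  refine Real.sqrt_le_iff.2 ⟨Finset.sum_nonneg fun _ _ => abs_nonneg _, ?_⟩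
  simpa only [sq_abs] using Finset.sum_sq_le_sq_sum_of_nonneg (s := Finset.univ)
    (f := fun i => |x i|) fun i _ => abs_nonneg _

theorem nrm_le_mul_norm (x : Vec d) : nrm x ≤ d * ‖x‖ := by
  refine (nrm_le_sum_abs x).trans ?_
  simpa using Finset.sum_le_card_nsmul Finset.univ (fun i => |x i|) ‖x‖ fun i _ => norm_le_pi_norm x i

theorem abs_dotProduct_le (x y : Vec d) : |x ⬝ᵥ y| ≤ nrm x * nrm y := by
  refine abs_le_of_sq_le_sq ?_ (mul_nonneg (nrm_nonneg x) (nrm_nonneg y))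
  rw [mul_pow, nrm_sq, nrm_sq]
  exact Finset.sum_mul_sq_le_sq_mul_sq _ _ _

theorem continuous_nrm : Continuous (nrm : Vec d → ℝ) := by
  unfold nrm
  fun_prop

theorem sq_trProd_le {A D : Matrix (Fin d) (Fin d) ℝ} {m : ℝ} (hA : ∀ i j, |A i j| ≤ m) :
    trProd A D ^ 2 ≤ d ^ 2 * m ^ 2 * ∑ i, ∑ j, D i j ^ 2 := by
  have e : trProd A D = ∑ p : Fin d × Fin d, A p.1 p.2 * D p.2 p.1 := by
    rw [trProd, Fintype.sum_prod_type]
  have e2 : ∑ i, ∑ j, D i j ^ 2 = ∑ p : Fin d × Fin d, D p.2 p.1 ^ 2 := by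
    rw [Fintype.sum_prod_type_right]
  have h : ∑ p : Fin d × Fin d, A p.1 p.2 ^ 2 ≤ d ^ 2 * m ^ 2 := by
    refine (Finset.sum_le_card_nsmul _ _ (m ^ 2) fun p _ => ?_).trans (by simp [pow_two])
    rw [← sq_abs]
    exact pow_le_pow_left₀ (abs_nonneg _) (hA _ _) 2
  rw [e, e2]
  exact (Finset.sum_mul_sq_le_sq_mul_sq _ _ _).trans
    (mul_le_mul_of_nonneg_right h (Finset.sum_nonneg fun _ _ => sq_nonneg _))

theorem trProd_sub_left (A B D : Matrix (Fin d) (Fin d) ℝ) :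
    trProd (A - B) D = trProd A D - trProd B D := by
  simp [trProd, sub_mul, Finset.sum_sub_distrib]

theorem trProd_sub_right (A D E : Matrix (Fin d) (Fin d) ℝ) :
    trProd A (D - E) = trProd A D - trProd A E := by
  simp [trProd, mul_sub, Finset.sum_sub_distrib]

/-- `A Aᵀ` is bounded below by `θ`. -/
def IsElliptic (θ : ℝ) (A : Matrix (Fin d) (Fin d) ℝ) : Prop :=
  ∀ v : Vec d, θ * (v ⬝ᵥ v) ≤ v ⬝ᵥ ((A * Aᵀ) *ᵥ v)

namespace IsElliptic

variable {θ : ℝ} {A : Matrix (Fin d) (Fin d) ℝ}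

theorem le_sum (hA : IsElliptic θ A) (v : Vec d) :
    θ * ∑ k, v k ^ 2 ≤ ∑ i, (∑ k, A k i * v k) ^ 2 := by
  have h := hA v
  rw [← Matrix.mulVec_mulVec, Matrix.dotProduct_mulVec, ← Matrix.mulVec_transpose] at h
  simpa [dotProduct, Matrix.mulVec, pow_two] using h

theorem det_ne_zero (hA : IsElliptic θ A) (hθ : 0 < θ) : A.det ≠ 0 := by
  intro h
  rw [← Matrix.det_transpose] at h
  obtain ⟨v, hv, hv0⟩ := Matrix.exists_mulVec_eq_zero_iff.2 h
  have h1 := hA v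
  rw [← Matrix.mulVec_mulVec, hv0, Matrix.mulVec_zero, dotProduct_zero] at h1
  have h2 : 0 < v ⬝ᵥ v := by
    refine lt_of_le_of_ne (Finset.sum_nonneg fun i _ => mul_self_nonneg _) fun h => hv ?_
    exact dotProduct_self_eq_zero.1 h.symm
  exact absurd h1 (not_le.2 (mul_pos hθ h2))

theorem le_sum_conj (hA : IsElliptic θ A) (hθ : 0 < θ) (D : Matrix (Fin d) (Fin d) ℝ) :
    θ ^ 2 * ∑ i, ∑ j, D i j ^ 2
      ≤ ∑ i, ∑ j, (∑ k, ∑ l, A l i * A k j * D l k) ^ 2 := by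
  have h1 : ∀ j, θ * ∑ l, (∑ k, A k j * D l k) ^ 2
      ≤ ∑ i, (∑ k, ∑ l, A l i * A k j * D l k) ^ 2 := by
    intro j
    refine (hA.le_sum _).trans (le_of_eq ?_)
    refine Finset.sum_congr rfl fun i _ => ?_
    rw [Finset.sum_comm]
    simp only [Finset.mul_sum, mul_assoc]
  have h2 : ∀ l, θ * ∑ k, D l k ^ 2 ≤ ∑ j, (∑ k, A k j * D l k) ^ 2 := fun l => hA.le_sum _
  calc θ ^ 2 * ∑ i, ∑ j, D i j ^ 2 = θ * ∑ l, θ * ∑ k, D l k ^ 2 := by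
        rw [← Finset.mul_sum]; ring
    _ ≤ θ * ∑ l, ∑ j, (∑ k, A k j * D l k) ^ 2 :=
        mul_le_mul_of_nonneg_left (Finset.sum_le_sum fun l _ => h2 l) hθ.le
    _ = ∑ j, θ * ∑ l, (∑ k, A k j * D l k) ^ 2 := by rw [Finset.sum_comm, Finset.mul_sum]
    _ ≤ ∑ j, ∑ i, (∑ k, ∑ l, A l i * A k j * D l k) ^ 2 := Finset.sum_le_sum fun j _ => h1 j
    _ = _ := Finset.sum_comm

end IsElliptic

theorem exists_equiv_mulVec {A : Matrix (Fin d) (Fin d) ℝ} (hA : A.det ≠ 0) :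
    ∃ L : Vec d ≃L[ℝ] Vec d, ∀ y, L y = A *ᵥ y :=
  ⟨(LinearEquiv.ofInjectiveEndo (Matrix.toLin' A) (Matrix.mulVec_injective_iff_isUnit.2
      ((Matrix.isUnit_iff_isUnit_det A).2 hA.isUnit))).toContinuousLinearEquiv,
    fun _ => rfl⟩

section Affine

variable {A : Matrix (Fin d) (Fin d) ℝ} {s : ℝ} {L : Vec d ≃L[ℝ] Vec d}

theorem norm_apply_le (hL : ∀ y, L y = (s • A) *ᵥ y) {m : ℝ} (hm : ∀ i j, |A i j| ≤ m) (hs : 0 ≤ s)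
    (hm0 : 0 ≤ m) (y : Vec d) : ‖L y‖ ≤ s * (d * m * ‖y‖) := by
  rw [pi_norm_le_iff_of_nonneg (by positivity)]
  intro i
  rw [hL, Matrix.smul_mulVec, Pi.smul_apply, smul_eq_mul, norm_mul, Real.norm_of_nonneg hs]
  refine mul_le_mul_of_nonneg_left ?_ hs
  have h := Finset.sum_le_card_nsmul Finset.univ (fun k => ‖A i k * y k‖) (m * ‖y‖) fun k _ => by
    rw [norm_mul]
    exact mul_le_mul (hm i k) (norm_le_pi_norm y k) (norm_nonneg _) hm0
  refine (norm_sum_le _ _).trans (h.trans (le_of_eq (by simp [mul_assoc])))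

theorem apply_single (hL : ∀ y, L y = (s • A) *ᵥ y) (i k : Fin d) :
    L (Pi.single i 1) k = s * A k i := by
  simp [hL]

theorem pd_comp (hL : ∀ y, L y = (s • A) *ᵥ y) {v : Vec d → ℝ} (hv : Differentiable ℝ v)
    (r : ℝ) (x₁ : Vec d) (i : Fin d) (y : Vec d) : pd i (fun y => r * v (x₁ + L y)) y
      = r * s * ∑ k, A k i * pd k v (x₁ + L y) := by
  rw [pd_const_mul (v := fun y => v (x₁ + L y))
    (hv.comp (L.differentiable.const_add x₁)), pd_comp_affine hv]
  simp only [apply_single hL, Finset.mul_sum]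
  exact Finset.sum_congr rfl fun k _ => by ring

theorem pd_pd_comp (hL : ∀ y, L y = (s • A) *ᵥ y) {v : Vec d → ℝ} (hv : IsTest v)
    (r : ℝ) (x₁ : Vec d) (i j : Fin d) (y : Vec d) :
    pd i (pd j fun y => r * v (x₁ + L y)) y
      = r * s ^ 2 * ∑ k, ∑ l, A l i * A k j * hess v (x₁ + L y) l k := by
  have h := hv.comp_affine L x₁
  rw [pd_const_mul h.differentiable, pd_const_mul (h.pd j).differentiable]
  beta_reduce
  rw [pd_pd_comp_affine hv]
  simp only [apply_single hL, Finset.mul_sum]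
  refine Finset.sum_congr rfl fun k _ => Finset.sum_congr rfl fun l _ => ?_
  change _ = r * s ^ 2 * (A l i * A k j * pd l (pd k v) (x₁ + L y))
  ring

theorem lap_comp (hL : ∀ y, L y = (s • A) *ᵥ y) {v : Vec d → ℝ} (hv : IsTest v)
    (r : ℝ) (x₁ : Vec d) (y : Vec d) : lap (fun y => r * v (x₁ + L y)) y
      = r * s ^ 2 * trProd (A * Aᵀ) (hess v (x₁ + L y)) := by
  simp only [lap, pd_pd_comp hL hv, trProd, Matrix.mul_apply, Matrix.transpose_apply,
    ← Finset.mul_sum, Finset.sum_mul]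
  congr 1
  rw [Finset.sum_comm]
  refine Finset.sum_congr rfl fun k _ => ?_
  rw [Finset.sum_comm]
  exact Finset.sum_congr rfl fun l _ => Finset.sum_congr rfl fun i _ => by ring

theorem le_hessSq_comp (hL : ∀ y, L y = (s • A) *ᵥ y) {θ : ℝ} (hA : IsElliptic θ A) (hθ : 0 < θ)
    {v : Vec d → ℝ} (hv : IsTest v) (r : ℝ) (x₁ : Vec d) (y : Vec d) :
    θ ^ 2 * ((r * s ^ 2) ^ 2 * ∑ i, ∑ j, hess v (x₁ + L y) i j ^ 2)
      ≤ hessSq (fun y => r * v (x₁ + L y)) y := by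
  simp only [hessSq, pd_pd_comp hL hv, mul_pow _ _ 2, ← Finset.mul_sum]
  have h := mul_le_mul_of_nonneg_left (hA.le_sum_conj hθ (hess v (x₁ + L y)))
    (sq_nonneg (r * s ^ 2))
  simp only [mul_pow] at h ⊢
  linarith

end Affine

/-- Affine changes of variables multiply integrals by a constant and preserve null sets. -/
theorem exists_integral_comp_affine (L : Vec d ≃L[ℝ] Vec d) (x₁ : Vec d) :
    ∃ q : ℝ, 0 ≤ q ∧ (∀ F : Vec d → ℝ, Integrable F → Integrable (fun y => F (x₁ + L y)) ∧
      ∫ y, F (x₁ + L y) = q * ∫ x, F x) ∧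
      ∀ P : Vec d → Prop, (∀ᵐ x, P x) → ∀ᵐ y, P (x₁ + L y) := by
  set f : Vec d → Vec d := fun y => x₁ + L y
  have hf : MeasurableEmbedding f :=
    (L.toHomeomorph.trans (Homeomorph.addLeft x₁)).measurableEmbedding
  set q : ℝ := |(LinearMap.det (L : Vec d →ₗ[ℝ] Vec d))⁻¹|
  have hmap : Measure.map f volume = ENNReal.ofReal q • (volume : Measure (Vec d)) := by
    have h1 : Measure.map (L : Vec d → Vec d) volume = ENNReal.ofReal q • volume :=
      Measure.map_linearMap_addHaar_eq_smul_addHaar volume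
        (f := (L : Vec d →ₗ[ℝ] Vec d)) (LinearEquiv.isUnit_det' L.toLinearEquiv).ne_zero
    have h2 : Measure.map f volume = Measure.map (x₁ + ·) (Measure.map (L : Vec d → Vec d) volume) :=
      (Measure.map_map (measurable_const_add x₁) L.continuous.measurable).symm
    rw [h2, h1, Measure.map_smul, map_add_left_eq_self]
  refine ⟨q, abs_nonneg _, fun F hF => ⟨?_, ?_⟩, fun P hP => ?_⟩
  · have : Integrable F (Measure.map f volume) := by
      rw [hmap]
      exact hF.smul_measure ENNReal.ofReal_ne_top
    exact hf.integrable_map_iff.1 this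
  · rw [← hf.integral_map, hmap, integral_smul_measure, ENNReal.toReal_ofReal (abs_nonneg _),
      smul_eq_mul]
  · refine ae_of_ae_map hf.measurable.aemeasurable ?_
    rw [hmap]
    exact Measure.smul_absolutelyContinuous.ae_le hP

/-! ### Preparations for the blow-up -/

/-- The doubling point of a continuous function on a ball. -/
theorem exists_doubling_point {N : Vec d → ℝ} (hN : Continuous N) {ρ T : ℝ} (hρ : 0 < ρ)
    (hT : 0 < T) {x₀ : Vec d} (h : T < N x₀) :
    ∃ x₁ D, 0 < D ∧ D ≤ ρ ∧ ‖x₁ - x₀‖ ≤ ρ - D ∧ ρ * T ≤ D * N x₁ ∧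
      ∀ x, ‖x - x₁‖ ≤ D / 2 → N x ≤ 2 * N x₁ := by
  obtain ⟨x₁, hx₁, hmax⟩ := (isCompact_closedBall x₀ ρ).exists_isMaxOn
    ⟨x₀, mem_closedBall_self hρ.le⟩
    (f := fun x => (ρ - ‖x - x₀‖) * N x) (by fun_prop)
  rw [mem_closedBall, dist_eq_norm] at hx₁
  set D := ρ - ‖x₁ - x₀‖
  have h0 : ρ * N x₀ ≤ D * N x₁ := by
    simpa using hmax (mem_closedBall_self hρ.le)
  have h1 : ρ * T ≤ D * N x₁ := (mul_le_mul_of_nonneg_left h.le hρ.le).trans h0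
  have hD : 0 < D := by
    refine lt_of_le_of_ne (by simpa [D] using hx₁) fun h => ?_
    rw [← h, zero_mul] at h1
    exact absurd h1 (not_le.2 (mul_pos hρ hT))
  have hN₁ : 0 < N x₁ := pos_of_mul_pos_right ((mul_pos hρ hT).trans_le h1) hD.le
  refine ⟨x₁, D, hD, by simp [D], by simp [D], h1, fun x hx => ?_⟩
  have h2 : ‖x - x₀‖ ≤ ρ - D / 2 := by
    have := norm_add_le (x - x₁) (x₁ - x₀)
    rw [sub_add_sub_cancel] at this
    simp only [D] at hx ⊢
    linarith
  by_contra! hlt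
  have h3 : (ρ - ‖x - x₀‖) * N x ≤ D * N x₁ := hmax (by
    rw [mem_closedBall, dist_eq_norm]
    linarith)
  nlinarith

theorem norm_fderiv_le (u : Vec d → ℝ) (x : Vec d) : ‖fderiv ℝ u x‖ ≤ d * nrm (grad u x) := by
  refine ContinuousLinearMap.opNorm_le_bound _ (mul_nonneg d.cast_nonneg (nrm_nonneg _)) fun h => ?_
  rw [fderiv_eq_sum_pd]
  have := Finset.sum_le_card_nsmul Finset.univ (fun i => ‖h i * pd i u x‖)
    (nrm (grad u x) * ‖h‖) fun i _ => by
      rw [norm_mul, mul_comm]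
      exact mul_le_mul (abs_apply_le_nrm (grad u x) i) (norm_le_pi_norm h i) (norm_nonneg _)
        (nrm_nonneg _)
  exact (norm_sum_le _ _).trans (this.trans (le_of_eq (by simp [mul_assoc])))

theorem continuous_grad {u : Vec d → ℝ} (hu : ContDiff ℝ 1 u) : Continuous (grad u) :=
  continuous_pi fun _ => (hu.continuous_fderiv one_ne_zero).clm_apply continuous_const

/-- A bound on the logarithmic gradient controls the growth of a positive function. -/
theorem le_exp_mul_of_nrm_grad_le {u : Vec d → ℝ} (hu : ContDiff ℝ 1 u) (hpos : ∀ x, 0 < u x)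
    {x₁ : Vec d} {D B : ℝ} (h : ∀ x, ‖x - x₁‖ ≤ D → nrm (grad u x) / u x ≤ B) {x : Vec d}
    (hx : ‖x - x₁‖ ≤ D) : u x ≤ Real.exp (d * B * ‖x - x₁‖) * u x₁ := by
  have hD : 0 ≤ D := (norm_nonneg _).trans hx
  have hm := (convex_closedBall x₁ D).norm_image_sub_le_of_norm_hasFDerivWithin_le
    (f := fun x => Real.log (u x)) (f' := fun x => (u x)⁻¹ • fderiv ℝ u x) (C := d * B)
    (x := x₁) (y := x)
    (fun z _ => ((hu.differentiable one_ne_zero z).hasFDerivAt.log (hpos z).ne').hasFDerivWithinAt)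
    (fun z hz => by
      rw [norm_smul, norm_inv, Real.norm_of_nonneg (hpos z).le]
      calc (u z)⁻¹ * ‖fderiv ℝ u z‖ ≤ (u z)⁻¹ * (d * nrm (grad u z)) :=
            mul_le_mul_of_nonneg_left (norm_fderiv_le u z) (inv_nonneg.2 (hpos z).le)
        _ = d * (nrm (grad u z) / u z) := by ring
        _ ≤ d * B := mul_le_mul_of_nonneg_left
            (h z (by rwa [mem_closedBall, dist_eq_norm] at hz)) d.cast_nonneg)
    (mem_closedBall_self hD) (by rwa [mem_closedBall, dist_eq_norm])
  have h1 := (le_abs_self _).trans hm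
  rw [← Real.log_le_log_iff (hpos x) (mul_pos (Real.exp_pos _) (hpos x₁)),
    Real.log_mul (Real.exp_pos _).ne' (hpos x₁).ne', Real.log_exp]
  linarith

/-- The Hessian of a strong solution is locally square integrable. -/
theorem integrableOn_sq_hess {σm : Vec d → Matrix (Fin d) (Fin d) ℝ} {θ : ℝ} (hθ : 0 < θ)
    (hell : ∀ x, IsElliptic θ (σm x)) {b : Vec d → Vec d} {c : Vec d → ℝ}
    (hb : ∀ R : ℝ, ∃ M, ∀ x : Vec d, nrm x ≤ R → nrm (b x) ≤ M)
    (hc : ∀ R : ℝ, ∃ M, ∀ x : Vec d, nrm x ≤ R → |c x| ≤ M)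
    {p : ℝ} (hp : (d : ℝ) < p) {u : Vec d → ℝ} {H : Vec d → Matrix (Fin d) (Fin d) ℝ}
    (hm : ∀ i j, AEMeasurable fun x => H x i j)
    (hi : ∀ R : ℝ, ∀ i j, IntegrableOn (fun x => |H x i j| ^ p) {x : Vec d | nrm x ≤ R})
    (hu : ContDiff ℝ 1 u)
    (heq : ∀ᵐ x : Vec d, (1 / 2) * trProd (amat σm x) (H x) + (b x) ⬝ᵥ (grad u x) + c x * u x = 0)
    (i j : Fin d) (R : ℝ) : IntegrableOn (fun x => H x i j ^ 2) (cube R) := by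
  have hsub : (cube R : Set (Vec d)) ⊆ {x | nrm x ≤ d * R} := fun x hx =>
    (nrm_le_mul_norm x).trans (mul_le_mul_of_nonneg_left (mem_cube.1 hx) d.cast_nonneg)
  have hms : AEStronglyMeasurable (fun x => H x i j ^ 2) (volume.restrict (cube R)) :=
    ((hm i j).pow_const 2).aestronglyMeasurable.restrict
  rcases d with _ | _ | d
  · exact i.elim0
  · obtain ⟨Mb, hMb⟩ := hb ((0 + 1 : ℕ) * R)
    obtain ⟨Mc, hMc⟩ := hc ((0 + 1 : ℕ) * R)
    obtain ⟨G, hG⟩ := (isCompact_cube R).exists_bound_of_continuousOn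
      (f := fun x => nrm (grad u x)) (continuous_nrm.comp (continuous_grad hu)).continuousOn
    obtain ⟨U, hU⟩ := (isCompact_cube R).exists_bound_of_continuousOn hu.continuous.continuousOn
    have hfin : IntegrableOn (fun _ : Vec (0 + 1) => (2 / θ * (Mb * G + Mc * U)) ^ 2) (cube R) :=
      integrableOn_cube continuous_const R
    refine Integrable.mono' hfin hms ?_
    filter_upwards [ae_restrict_of_ae heq, ae_restrict_mem (measurableSet_cube R)] with x hx hxR
    rw [Real.norm_of_nonneg (sq_nonneg _), ← sq_abs]
    refine pow_le_pow_left₀ (abs_nonneg _) ?_ 2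
    obtain rfl : i = 0 := Fin.eq_zero i
    obtain rfl : j = 0 := Fin.eq_zero j
    have hθa : θ ≤ amat σm x 0 0 := by
      have := hell x 1
      simpa [dotProduct, Matrix.mulVec, amat] using this
    have e : trProd (amat σm x) (H x) = amat σm x 0 0 * H x 0 0 := by simp [trProd]
    rw [e] at hx
    have h1 : |b x ⬝ᵥ grad u x| ≤ Mb * G := by
      have hg := hG x hxR
      rw [Real.norm_of_nonneg (nrm_nonneg _)] at hg
      exact (abs_dotProduct_le _ _).trans (mul_le_mul (hMb x (hsub hxR)) hg (nrm_nonneg _)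
        ((nrm_nonneg _).trans (hMb x (hsub hxR))))
    have h2 : |c x * u x| ≤ Mc * U := by
      rw [abs_mul]
      exact mul_le_mul (hMc x (hsub hxR)) (hU x hxR) (abs_nonneg _)
        ((abs_nonneg _).trans (hMc x (hsub hxR)))
    have h3 : amat σm x 0 0 * H x 0 0 = -2 * (b x ⬝ᵥ grad u x + c x * u x) := by linarith
    have h4 : θ * |H x 0 0| ≤ 2 * (Mb * G + Mc * U) := by
      calc θ * |H x 0 0| ≤ |amat σm x 0 0| * |H x 0 0| :=
            mul_le_mul_of_nonneg_right (hθa.trans (le_abs_self _)) (abs_nonneg _)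
        _ = |-2 * (b x ⬝ᵥ grad u x + c x * u x)| := by rw [← abs_mul, h3]
        _ = 2 * |b x ⬝ᵥ grad u x + c x * u x| := by rw [abs_mul]; norm_num
        _ ≤ 2 * (Mb * G + Mc * U) := by linarith [abs_add_le (b x ⬝ᵥ grad u x) (c x * u x)]
    rw [div_mul_eq_mul_div, le_div_iff₀ hθ]
    linarith
  · have hp2 : (2 : ℝ) ≤ p := by
      push_cast at hp
      linarith [(Nat.cast_nonneg d : (0 : ℝ) ≤ d)]
    have h1 : IntegrableOn (fun _ : Vec (d + 1 + 1) => (1 : ℝ)) (cube R) :=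
      integrableOn_cube continuous_const R
    have h2 := (hi ((d + 1 + 1 : ℕ) * R) i j).mono_set hsub
    have h3 : IntegrableOn (fun x => 1 + |H x i j| ^ p) (cube R) := h1.add h2
    refine Integrable.mono' h3 hms (Eventually.of_forall fun x => ?_)
    rw [Real.norm_of_nonneg (sq_nonneg _), ← sq_abs]
    have h0 : 0 ≤ |H x i j| ^ p := Real.rpow_nonneg (abs_nonneg _) _
    rcases le_total |H x i j| 1 with h | h
    · have := pow_le_one₀ (n := 2) (abs_nonneg _) h
      linarith
    · have := Real.rpow_le_rpow_of_exponent_le h hp2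
      rw [Real.rpow_two] at this
      linarith

/-- A function that nearly solves an elliptic equation has small excess in the coordinates that
turn the leading coefficients at a nearby point into the identity matrix. -/
theorem excess_comp_le {A : Matrix (Fin d) (Fin d) ℝ} {s : ℝ} {L : Vec d ≃L[ℝ] Vec d}
    (hL : ∀ y, L y = (s • A) *ᵥ y) {θ : ℝ} (hA : IsElliptic θ A) (hθ : 0 < θ)
    {v : Vec d → ℝ} (hv : IsTest v) {r : ℝ} (x₁ y : Vec d)
    {a H : Matrix (Fin d) (Fin d) ℝ} {ω M τ ε : ℝ} (hω : ∀ i j, |(A * Aᵀ - a) i j| ≤ ω)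
    (hM : ∀ i j, |a i j| ≤ M) (hτ : |r * s ^ 2 * trProd a H| ≤ τ)
    (hωε : 3 * (d ^ 2 * ω ^ 2) ≤ ε * θ ^ 2) (hτε : 3 * τ ^ 2 ≤ ε) (hε : 0 ≤ ε) :
    excess ε (fun y => r * v (x₁ + L y)) y
      ≤ 3 * (r * s ^ 2) ^ 2 * (d ^ 2 * M ^ 2)
        * ∑ i, ∑ j, (hess v (x₁ + L y) i j - H i j) ^ 2 := by
  set D := hess v (x₁ + L y)
  set P := ∑ i, ∑ j, D i j ^ 2 with hP
  have hP0 : 0 ≤ P := Finset.sum_nonneg fun _ _ => Finset.sum_nonneg fun _ _ => sq_nonneg _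
  set E := ∑ i, ∑ j, (D i j - H i j) ^ 2 with hE
  have hE0 : 0 ≤ E := Finset.sum_nonneg fun _ _ => Finset.sum_nonneg fun _ _ => sq_nonneg _
  refine max_le (by positivity) ?_
  have h1 := sq_trProd_le (D := D) hω
  have h2 : trProd a (D - H) ^ 2 ≤ d ^ 2 * M ^ 2 * E := sq_trProd_le (D := D - H) hM
  have h3 : (r * s ^ 2 * trProd a H) ^ 2 ≤ τ ^ 2 :=
    sq_le_sq' (neg_le_of_abs_le hτ) (le_of_abs_le hτ)
  have h4 := le_hessSq_comp hL hA hθ hv r x₁ y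
  rw [lap_comp hL hv]
  rw [trProd_sub_left] at h1
  rw [trProd_sub_right] at h2
  set q := r * s ^ 2
  set t₁ := trProd (A * Aᵀ) D
  set t₂ := trProd a D
  set t₃ := trProd a H
  have h5 : (q * t₁) ^ 2 ≤ 3 * (q ^ 2 * (t₁ - t₂) ^ 2 + q ^ 2 * (t₂ - t₃) ^ 2 + (q * t₃) ^ 2) := by
    nlinarith [sq_nonneg (q * (t₁ - t₂) - q * (t₂ - t₃)), sq_nonneg (q * (t₁ - t₂) - q * t₃),
      sq_nonneg (q * (t₂ - t₃) - q * t₃)]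
  have h6 := mul_le_mul_of_nonneg_left h1 (sq_nonneg q)
  have h7 := mul_le_mul_of_nonneg_left h2 (sq_nonneg q)
  have h8 := mul_le_mul_of_nonneg_left h4 hε
  have h9 := mul_le_mul_of_nonneg_right hωε (mul_nonneg (sq_nonneg q) hP0)
  linarith

/-! ### Blow-up -/

theorem setIntegral_excess_comp_le {A : Matrix (Fin d) (Fin d) ℝ} {s : ℝ} {L : Vec d ≃L[ℝ] Vec d}
    (hL : ∀ y, L y = (s • A) *ᵥ y) {θ : ℝ} (hA : IsElliptic θ A) (hθ : 0 < θ) (r : ℝ) (x₁ : Vec d)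
    {a H : Vec d → Matrix (Fin d) (Fin d) ℝ} {ω M τ ε t R R' : ℝ}
    (hR : ∀ y ∈ cube R, ‖L y‖ ≤ t) (hR' : ‖x₁‖ + t ≤ R')
    (hω : ∀ x, ‖x - x₁‖ ≤ t → ∀ i j, |(A * Aᵀ - a x) i j| ≤ ω)
    (hM : ∀ x i j, |a x i j| ≤ M)
    (hτ : ∀ᵐ x, ‖x - x₁‖ ≤ t → |r * s ^ 2 * trProd (a x) (H x)| ≤ τ)
    (hωε : 3 * (d ^ 2 * ω ^ 2) ≤ ε * θ ^ 2) (hτε : 3 * τ ^ 2 ≤ ε) (hε : 0 ≤ ε)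
    (hm : ∀ i j, AEMeasurable fun x => H x i j)
    (hi : ∀ i j R, IntegrableOn (fun x => H x i j ^ 2) (cube R)) :
    ∃ q, ∀ v, IsTest v → ∀ δ, (∀ i j, ∫ x in cube R', (pd i (pd j v) x - H x i j) ^ 2 ≤ δ) →
      ∫ y in cube R, excess ε (fun y => r * v (x₁ + L y)) y ≤ q * δ := by
  obtain ⟨q, hq, hint, hae⟩ := exists_integral_comp_affine L x₁
  set m := 3 * (r * s ^ 2) ^ 2 * (d ^ 2 * M ^ 2) with hm_def
  have hm0 : 0 ≤ m := by positivity
  refine ⟨q * (m * d ^ 2), fun v hv δ hδ => ?_⟩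
  set e : Vec d → ℝ := fun x => m * ∑ i, ∑ j, (pd i (pd j v) x - H x i j) ^ 2 with he
  have he0 : ∀ x, 0 ≤ e x := fun x => mul_nonneg hm0
    (Finset.sum_nonneg fun _ _ => Finset.sum_nonneg fun _ _ => sq_nonneg _)
  have hij : ∀ i j, IntegrableOn (fun x => (pd i (pd j v) x - H x i j) ^ 2) (cube R') := by
    intro i j
    have hc := ((hv.pd j).pd i).continuous
    have h1 : IntegrableOn (fun x => 2 * pd i (pd j v) x ^ 2 + 2 * H x i j ^ 2) (cube R') :=
      ((integrableOn_cube (hc.pow 2) R').const_mul 2).add ((hi i j R').const_mul 2)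
    refine Integrable.mono' h1 ?_ (Eventually.of_forall fun x => ?_)
    · exact ((hc.aemeasurable.sub (hm i j)).pow_const 2).aestronglyMeasurable.restrict
    · rw [Real.norm_of_nonneg (sq_nonneg _)]
      nlinarith [sq_nonneg (pd i (pd j v) x + H x i j)]
  have hei : IntegrableOn e (cube R') :=
    (integrable_finsetSum _ fun i _ => integrable_finsetSum _ fun j _ => hij i j).const_mul m
  set F := (cube R').indicator e with hF
  have hF0 : ∀ x, 0 ≤ F x := fun x => indicator_nonneg (fun x _ => he0 x) x
  have hFi : Integrable F := hei.integrable_indicator (measurableSet_cube _)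
  obtain ⟨hFc, hFe⟩ := hint F hFi
  have hFδ : ∫ x, F x ≤ m * d ^ 2 * δ := by
    rw [hF, integral_indicator (measurableSet_cube _), he, integral_const_mul,
      integral_finsetSum _ fun i _ => integrable_finsetSum _ fun j _ => hij i j,
      mul_assoc m]
    refine mul_le_mul_of_nonneg_left ?_ hm0
    have h1 : ∀ i, ∫ x in cube R', ∑ j, (pd i (pd j v) x - H x i j) ^ 2 ≤ d * δ := by
      intro i
      rw [integral_finsetSum _ fun j _ => hij i j]
      exact (Finset.sum_le_card_nsmul _ _ δ fun j _ => hδ i j).trans (by simp)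
    exact (Finset.sum_le_card_nsmul _ _ (d * δ) fun i _ => h1 i).trans
      (le_of_eq (by simp [pow_two, mul_assoc]))
  have hWt : IsTest fun y => r * v (x₁ + L y) := (hv.comp_affine L x₁).mul_left contDiff_const
  have hle : ∫ y in cube R, excess ε (fun y => r * v (x₁ + L y)) y ≤ ∫ y in cube R, F (x₁ + L y) := by
    refine setIntegral_mono_ae_restrict (integrableOn_cube (hWt.continuous_excess ε) R)
      hFc.integrableOn ?_
    filter_upwards [ae_restrict_of_ae (hae _ hτ), ae_restrict_mem (measurableSet_cube R)] with y h hy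
    have hy' : ‖x₁ + L y - x₁‖ ≤ t := by
      rw [add_sub_cancel_left]
      exact hR y hy
    have hmem : x₁ + L y ∈ cube R' :=
      mem_cube.2 ((norm_add_le _ _).trans (by linarith [hR y hy]))
    rw [hF, indicator_of_mem hmem]
    exact excess_comp_le hL hA hθ hv x₁ y (hω _ hy') (hM _) (h hy') hωε hτε hε
  calc _ ≤ ∫ y in cube R, F (x₁ + L y) := hle
    _ ≤ ∫ y, F (x₁ + L y) := setIntegral_le_integral hFc (Eventually.of_forall fun y => hF0 _)
    _ = q * ∫ x, F x := hFe
    _ ≤ q * (m * d ^ 2 * δ) := mul_le_mul_of_nonneg_left hFδ hq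
    _ = q * (m * d ^ 2) * δ := by ring

theorem abs_sum_mul_le {A : Matrix (Fin d) (Fin d) ℝ} {M m : ℝ} (hA : ∀ i j, |A i j| ≤ M)
    (hM : 0 ≤ M) {z : Vec d} (hz : ∀ k, |z k| ≤ m) (i : Fin d) :
    |∑ k, A k i * z k| ≤ d * M * m := by
  have h := Finset.sum_le_card_nsmul Finset.univ (fun k => |A k i * z k|) (M * m) fun k _ => by
    rw [abs_mul]
    exact mul_le_mul (hA k i) (hz k) (abs_nonneg _) hM
  exact (Finset.abs_sum_le_sum_abs _ _).trans (h.trans (le_of_eq (by simp [mul_assoc])))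

theorem le_exp_mul_of_doubling_point {u : Vec d → ℝ} (hu : ContDiff ℝ 1 u) (hpos : ∀ x, 0 < u x)
    {x₁ : Vec d} {M S N s t : ℝ} (hsN : s * N = 1) (hN0 : 0 ≤ N) (ht : s * (d * M * (2 * S)) = t)
    (hNt : ∀ x, ‖x - x₁‖ ≤ t → nrm (grad u x) / u x ≤ 2 * N) {x : Vec d} (hx : ‖x - x₁‖ ≤ t) :
    u x ≤ Real.exp (4 * d ^ 2 * M * S) * u x₁ := by
  refine (le_exp_mul_of_nrm_grad_le hu hpos hNt hx).trans
    (mul_le_mul_of_nonneg_right (Real.exp_le_exp.2 ?_) (hpos x₁).le)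
  calc d * (2 * N) * ‖x - x₁‖ ≤ d * (2 * N) * t := mul_le_mul_of_nonneg_left hx (by positivity)
    _ = s * N * (4 * d ^ 2 * M * S) := by rw [← ht]; ring
    _ = 4 * d ^ 2 * M * S := by rw [hsN, one_mul]

/-- A positive function cannot satisfy, near a doubling point of its logarithmic gradient, an
elliptic equation that is too close to one with constant coefficients and no lower-order terms. -/
theorem false_of_doubling_point {θ κ S Q ε M : ℝ} (hθ : 0 < θ) (hκ : 0 < κ) (hS : 1 ≤ S)
    (hε : 0 < ε) (hM0 : 0 ≤ M) (hκθ : d * (2 * κ) ^ 2 < θ)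
    (hQ : (1 + 2 * d * M) * Real.exp (4 * d ^ 2 * M * S) + 1 ≤ Q)
    (hcore : ∀ η, 0 < η → η ≤ 1 → ∀ v : Vec d → ℝ, IsTest v →
      (∀ x ∈ cube (2 * S), 0 ≤ v x ∧ v x ≤ Q ∧ ∀ i, |pd i v x| ≤ Q) → (∀ x ∈ cube η, v x ≤ 2) →
      ∫ x in cube (2 * S), excess ε v x ≤ ε * η ^ d →
      ∀ (j : Fin d) ℓ, (∀ x ∈ cube η, |pd j v x - ℓ| ≤ κ) → |ℓ| ≤ 2 * κ)
    {σm : Vec d → Matrix (Fin d) (Fin d) ℝ} (hM : ∀ x i j, |amat σm x i j| ≤ M)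
    {u : Vec d → ℝ} {H : Vec d → Matrix (Fin d) (Fin d) ℝ} (hu : ContDiff ℝ 1 u)
    (hpos : ∀ x, 0 < u x) (hH : IsWeakHess u H) (hm : ∀ i j, AEMeasurable fun x => H x i j)
    (hi : ∀ i j R, IntegrableOn (fun x => H x i j ^ 2) (cube R))
    {x₁ : Vec d} (hell : IsElliptic θ (σm x₁)) (hσ : ∀ i j, |σm x₁ i j| ≤ M) {N s t ω τ : ℝ}
    (hN : nrm (grad u x₁) / u x₁ = N) (hsN : s * N = 1) (hs : 0 < s) (ht : s * (d * M * (2 * S)) = t)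
    (hNt : ∀ x, ‖x - x₁‖ ≤ t → nrm (grad u x) / u x ≤ 2 * N)
    (hω : ∀ x, ‖x - x₁‖ ≤ t → ∀ i j, |(amat σm x₁ - amat σm x) i j| ≤ ω)
    (hτ : ∀ᵐ x, ‖x - x₁‖ ≤ t → |(u x₁)⁻¹ * s ^ 2 * trProd (amat σm x) (H x)| ≤ τ)
    (hωε : 3 * (d ^ 2 * ω ^ 2) ≤ ε * θ ^ 2) (hτε : 3 * τ ^ 2 ≤ ε) : False := by
  set A := σm x₁
  set r := (u x₁)⁻¹
  have hr : 0 < r := inv_pos.2 (hpos x₁)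
  have hru : r * u x₁ = 1 := inv_mul_cancel₀ (hpos x₁).ne'
  obtain ⟨L, hL⟩ := exists_equiv_mulVec (A := s • A) (by
    rw [Matrix.det_smul]
    exact mul_ne_zero (pow_ne_zero _ hs.ne') (hell.det_ne_zero hθ))
  have hLt : ∀ y ∈ cube (2 * S), ‖L y‖ ≤ t := fun y hy => by
    rw [← ht]
    refine (norm_apply_le hL hσ hs.le hM0 y).trans (mul_le_mul_of_nonneg_left ?_ hs.le)
    exact mul_le_mul_of_nonneg_left (mem_cube.1 hy) (by positivity)
  have ht0 : 0 ≤ t := by rw [← ht]; positivity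
  have hnear : ∀ y ∈ cube (2 * S), ‖x₁ + L y - x₁‖ ≤ t := fun y hy => by
    rw [add_sub_cancel_left]
    exact hLt y hy
  set E := Real.exp (4 * d ^ 2 * M * S) with hE
  have hN0 : 0 < N := pos_of_mul_pos_right (hsN ▸ one_pos) hs.le
  have hE0 : 0 < E := Real.exp_pos _
  have hgrow : ∀ y ∈ cube (2 * S), u (x₁ + L y) ≤ E * u x₁ := fun y hy =>
    le_exp_mul_of_doubling_point hu hpos hsN hN0.le ht hNt (hnear y hy)
  have hgrad : ∀ y ∈ cube (2 * S), ∀ k, |pd k u (x₁ + L y)| ≤ 2 * N * (E * u x₁) := by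
    intro y hy k
    have h1 := (div_le_iff₀ (hpos _)).1 (hNt _ (hnear y hy))
    exact (abs_apply_le_nrm (grad u (x₁ + L y)) k).trans (h1.trans
      (mul_le_mul_of_nonneg_left (hgrow y hy) (by positivity)))
  set w : Vec d → ℝ := fun y => r * u (x₁ + L y) with hw
  have hud := hu.differentiable one_ne_zero
  have hpw : ∀ i y, pd i w y = r * s * ∑ k, A k i * pd k u (x₁ + L y) := fun i y =>
    pd_comp hL hud r x₁ i y
  have hpwQ : ∀ y ∈ cube (2 * S), ∀ i, |pd i w y| ≤ 2 * d * M * E := by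
    intro y hy i
    rw [hpw, abs_mul, abs_of_pos (mul_pos hr hs)]
    calc r * s * |∑ k, A k i * pd k u (x₁ + L y)| ≤ r * s * (d * M * (2 * N * (E * u x₁))) :=
          mul_le_mul_of_nonneg_left (abs_sum_mul_le hσ hM0 (hgrad y hy) i) (by positivity)
      _ = (r * u x₁) * (s * N) * (2 * d * M * E) := by ring
      _ = 2 * d * M * E := by rw [hru, hsN, one_mul, one_mul]
  obtain ⟨j, hj⟩ : ∃ j, 2 * κ < |pd j w 0| := by
    by_contra! hcon
    have h1 : ∑ i, pd i w 0 ^ 2 ≤ d * (2 * κ) ^ 2 := by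
      refine (Finset.sum_le_card_nsmul _ _ ((2 * κ) ^ 2) fun i _ => ?_).trans (by simp)
      rw [← sq_abs]
      exact pow_le_pow_left₀ (abs_nonneg _) (hcon i) 2
    have h2 := hell.le_sum (grad u x₁)
    rw [← nrm_sq] at h2
    have h3 : ∑ i, pd i w 0 ^ 2 = (r * s) ^ 2 * ∑ i, (∑ k, A k i * grad u x₁ k) ^ 2 := by
      rw [Finset.mul_sum]
      refine Finset.sum_congr rfl fun i _ => ?_
      rw [hpw, mul_pow, map_zero, add_zero]
      rfl
    have h4 : r * s * nrm (grad u x₁) = 1 := by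
      rw [← hsN, ← hN, div_eq_inv_mul]
      ring
    have h5 := mul_le_mul_of_nonneg_left h2 (sq_nonneg (r * s))
    have h6 : (r * s) ^ 2 * (θ * nrm (grad u x₁) ^ 2) = θ := by
      rw [mul_left_comm, ← mul_pow, h4, one_pow, mul_one]
    linarith
  have hwc : Continuous w := continuous_const.mul
    (hu.continuous.comp (continuous_const.add L.continuous))
  have hpwc : Continuous (pd j w) := by
    have : pd j w = fun y => r * s * ∑ k, A k j * grad u (x₁ + L y) k := funext fun y => hpw j y
    rw [this]
    have h := (continuous_grad hu).comp ((continuous_const (y := x₁)).add L.continuous)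
    exact continuous_const.mul (continuous_finsetSum _ fun k _ =>
      continuous_const.mul ((continuous_apply k).comp h))
  obtain ⟨η, hη0, hη1, hη⟩ : ∃ η, 0 < η ∧ η ≤ 1 ∧
      ∀ y ∈ cube η, w y ≤ 3 / 2 ∧ |pd j w y - pd j w 0| ≤ κ / 2 := by
    have hw0 : w 0 < 3 / 2 := by
      simp only [hw, map_zero, add_zero, hru]
      norm_num
    have e1 : ∀ᶠ y in 𝓝 (0 : Vec d), w y < 3 / 2 := hwc.continuousAt.eventually_lt_const hw0
    have e2 : ∀ᶠ y in 𝓝 (0 : Vec d), |pd j w y - pd j w 0| < κ / 2 :=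
      ((hpwc.sub continuous_const).abs.continuousAt).eventually_lt_const (by simpa using hκ)
    obtain ⟨η', hη', hb⟩ := Metric.nhds_basis_closedBall.eventually_iff.1 (e1.and e2)
    refine ⟨min η' 1, lt_min hη' one_pos, min_le_right _ _, fun y hy => ?_⟩
    have := hb (closedBall_subset_closedBall (min_le_left η' 1) hy)
    exact ⟨this.1.le, this.2.le⟩
  obtain ⟨m, hm0, hmu⟩ : ∃ m > 0, ∀ x ∈ closedBall x₁ t, m ≤ u x := by
    obtain ⟨z, -, hz⟩ := (isCompact_closedBall x₁ t).exists_isMinOn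
      ⟨x₁, mem_closedBall_self ht0⟩ hu.continuous.continuousOn
    exact ⟨u z, hpos z, fun x hx => hz hx⟩
  obtain ⟨q, hq⟩ := setIntegral_excess_comp_le hL hell hθ r x₁ (R' := ‖x₁‖ + t) hLt le_rfl hω hM hτ
    hωε hτε hε.le hm hi
  have hev : ∀ (k : ℝ) {e : ℝ}, 0 < e → ∀ᶠ δ in 𝓝[>] (0 : ℝ), k * δ ≤ e := fun k e he =>
    (((continuous_const (y := k)).mul continuous_id).continuousAt.eventually_le_const
      (by simpa using he)).filter_mono nhdsWithin_le_nhds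
  obtain ⟨δ, hδ, hδm, hδr, hδ1, hδκ, hδq⟩ := ((eventually_mem_nhdsWithin (a := (0 : ℝ))
    (s := Ioi 0)).and ((hev 1 hm0).and ((hev r (show (0 : ℝ) < 1 / 2 by norm_num)).and
    ((hev (r * s * (d * M)) one_pos).and ((hev (r * s * (d * M)) (half_pos hκ)).and
    (hev q (mul_pos hε (pow_pos hη0 d)))))))).exists
  obtain ⟨v, hv, hvu, hvH⟩ := exists_isTest_approx hu hH hm hi
    (show 0 ≤ ‖x₁‖ + t by positivity) hδ
  have hmem : ∀ y ∈ cube (2 * S), x₁ + L y ∈ cube (‖x₁‖ + t) := fun y hy =>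
    mem_cube.2 ((norm_add_le _ _).trans (by linarith [hLt y hy]))
  set W : Vec d → ℝ := fun y => r * v (x₁ + L y) with hW
  have hWt : IsTest W := (hv.comp_affine L x₁).mul_left contDiff_const
  have hWw : ∀ y ∈ cube (2 * S), |W y - w y| ≤ r * δ := by
    intro y hy
    rw [hW, hw, ← mul_sub, abs_mul, abs_of_pos hr]
    exact mul_le_mul_of_nonneg_left (hvu _ (hmem y hy)).1 hr.le
  have hpWw : ∀ y ∈ cube (2 * S), ∀ i, |pd i W y - pd i w y| ≤ r * s * (d * M) * δ := by
    intro y hy i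
    rw [hpw, hW, pd_comp hL hv.differentiable, ← mul_sub, ← Finset.sum_sub_distrib, abs_mul,
      abs_of_pos (mul_pos hr hs), mul_assoc (r * s)]
    refine mul_le_mul_of_nonneg_left ?_ (mul_pos hr hs).le
    simp only [← mul_sub]
    exact abs_sum_mul_le hσ hM0 (fun k => (hvu _ (hmem y hy)).2 k) i
  have hsub : (cube η : Set (Vec d)) ⊆ cube (2 * S) := cube_mono (by linarith)
  have hdM : 0 ≤ d * M * E := by positivity
  refine absurd (hcore η hη0 hη1 W hWt (fun y hy => ⟨?_, ?_, fun i => ?_⟩) (fun y hy => ?_)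
    (le_trans (hq v hv δ hvH) hδq) j (pd j w 0) fun y hy => ?_) (not_le.2 hj)
  · refine mul_nonneg hr.le ?_
    have h1 := (abs_le.1 (hvu _ (hmem y hy)).1).1
    have h2 := hmu (x₁ + L y) (by
      rw [mem_closedBall, dist_eq_norm]
      exact hnear y hy)
    linarith
  · have h1 := (abs_le.1 (hWw y hy)).2
    have h2 : w y ≤ E := by
      have := mul_le_mul_of_nonneg_left (hgrow y hy) hr.le
      rwa [mul_left_comm, hru, mul_one] at this
    linarith
  · have h1 := abs_sub_abs_le_abs_sub (pd i W y) (pd i w y)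
    linarith [hpWw y hy i, hpwQ y hy i]
  · linarith [(abs_le.1 (hWw y (hsub hy))).2, (hη y hy).1]
  · have h1 := abs_sub_le (pd j W y) (pd j w y) (pd j w 0)
    linarith [hpWw y (hsub hy) j, (hη y hy).2]

theorem abs_apply_le_of_abs_mul_transpose_le {A : Matrix (Fin d) (Fin d) ℝ} {M : ℝ} (hM : 1 ≤ M)
    (hA : ∀ i j, |(A * Aᵀ) i j| ≤ M) (i j : Fin d) : |A i j| ≤ M := by
  refine abs_le_of_sq_le_sq ?_ (by linarith)
  have h1 : A i j ^ 2 ≤ ∑ k, A i k ^ 2 :=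
    Finset.single_le_sum (f := fun k => A i k ^ 2) (fun _ _ => sq_nonneg _) (Finset.mem_univ j)
  have h2 : (A * Aᵀ) i i = ∑ k, A i k ^ 2 := by simp [Matrix.mul_apply, pow_two]
  nlinarith [(le_abs_self _).trans (hA i i)]

theorem exists_radius_of_uniformContinuous {a : Vec d → Matrix (Fin d) (Fin d) ℝ}
    (ha : ∀ i j, UniformContinuous fun x => a x i j) {ω : ℝ} (hω : 0 < ω) :
    ∃ δ > 0, ∀ x y, ‖x - y‖ < δ → ∀ i j, |(a y - a x) i j| ≤ ω := by
  choose δ hδ h using fun i j => Metric.uniformContinuous_iff.1 (ha i j) ω hω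
  have hev : ∀ᶠ r in 𝓝[>] (0 : ℝ), ∀ i j, r ≤ δ i j := eventually_all.2 fun i =>
    eventually_all.2 fun j => (eventually_le_nhds (hδ i j)).filter_mono nhdsWithin_le_nhds
  obtain ⟨r, hr0, hr⟩ := ((eventually_mem_nhdsWithin (a := (0 : ℝ)) (s := Ioi 0)).and hev).exists
  refine ⟨r, hr0, fun x y hxy i j => ?_⟩
  have := h i j (a := y) (b := x) (by
    rw [dist_comm, dist_eq_norm]
    exact hxy.trans_le (hr i j))
  exact this.le

/-- The size of the lower-order coefficients on a unit ball. -/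
theorem coeff_le_iSup {b : Vec d → Vec d} {c : Vec d → ℝ}
    (hb : ∀ R : ℝ, ∃ M, ∀ x : Vec d, nrm x ≤ R → nrm (b x) ≤ M)
    (hc : ∀ R : ℝ, ∃ M, ∀ x : Vec d, nrm x ≤ R → |c x| ≤ M) (x : Vec d) {B : ℝ}
    (hB : 1 + ⨆ y : {y : Vec d // nrm (y - x) < 1}, (nrm (b y) + Real.sqrt |c y|) = B) :
    1 ≤ B ∧ ∀ y, nrm (y - x) < 1 → nrm (b y) ≤ B ∧ |c y| ≤ B ^ 2 := by
  set f : {y : Vec d // nrm (y - x) < 1} → ℝ := fun y => nrm (b y) + Real.sqrt |c y|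
  have hf0 : ∀ y, 0 ≤ f y := fun y => add_nonneg (nrm_nonneg _) (Real.sqrt_nonneg _)
  have hB1 : 1 ≤ B := by linarith [Real.iSup_nonneg hf0]
  obtain ⟨M₁, hM₁⟩ := hb (d * (‖x‖ + 1))
  obtain ⟨M₂, hM₂⟩ := hc (d * (‖x‖ + 1))
  have hbdd : BddAbove (range f) := by
    refine ⟨M₁ + Real.sqrt M₂, ?_⟩
    rintro _ ⟨y, rfl⟩
    have hy : nrm (y : Vec d) ≤ d * (‖x‖ + 1) := by
      refine (nrm_le_mul_norm _).trans (mul_le_mul_of_nonneg_left ?_ d.cast_nonneg)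
      have := norm_le_norm_add_norm_sub' (y : Vec d) x
      linarith [norm_le_nrm ((y : Vec d) - x), y.2]
    exact add_le_add (hM₁ _ hy) (Real.sqrt_le_sqrt (hM₂ _ hy))
  refine ⟨hB1, fun y hy => ?_⟩
  have h1 : nrm (b y) + Real.sqrt |c y| ≤ ⨆ y, f y := le_ciSup hbdd ⟨y, hy⟩
  have h2 := nrm_nonneg (b y)
  have h3 := Real.sqrt_nonneg |c y|
  exact ⟨by linarith, (Real.sqrt_le_left (by linarith)).1 (by linarith)⟩

/-- The lower-order terms of the rescaled equation are small. -/
theorem abs_lower_order_le {a H : Matrix (Fin d) (Fin d) ℝ} {β γ : Vec d} {c₀ u₀ u₁ B N s E T : ℝ}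
    (heq : (1 / 2) * trProd a H + β ⬝ᵥ γ + c₀ * u₀ = 0) (hβ : nrm β ≤ B) (hc : |c₀| ≤ B ^ 2)
    (hγ : nrm γ / u₀ ≤ 2 * N) (hu₀ : 0 < u₀) (hu₁ : 0 < u₁) (hE : u₀ ≤ E * u₁) (hs : 0 ≤ s)
    (hB : 0 ≤ B) (hN : 0 ≤ N) (hsN : s * N = 1) (hsB : s * B ≤ T) (hT : T ≤ 1) :
    |u₁⁻¹ * s ^ 2 * trProd a H| ≤ 6 * E * T := by
  have h1 : |β ⬝ᵥ γ| ≤ B * (2 * N * u₀) :=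
    (abs_dotProduct_le β γ).trans
      (mul_le_mul hβ ((div_le_iff₀ hu₀).1 hγ) (nrm_nonneg _) hB)
  have h2 : |c₀ * u₀| ≤ B ^ 2 * u₀ := by
    rw [abs_mul, abs_of_pos hu₀]
    exact mul_le_mul_of_nonneg_right hc hu₀.le
  have h3 : |trProd a H| ≤ 2 * (2 * N * B + B ^ 2) * u₀ := by
    have e : trProd a H = -2 * (β ⬝ᵥ γ + c₀ * u₀) := by linarith
    rw [e, abs_mul]
    norm_num
    linarith [abs_add_le (β ⬝ᵥ γ) (c₀ * u₀)]
  have hsB0 : 0 ≤ s * B := mul_nonneg hs hB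
  have hE0 : 0 ≤ E := (pos_of_mul_pos_left (hu₀.trans_le hE) hu₁.le).le
  rw [abs_mul, abs_of_nonneg (by positivity : 0 ≤ u₁⁻¹ * s ^ 2)]
  calc u₁⁻¹ * s ^ 2 * |trProd a H| ≤ u₁⁻¹ * s ^ 2 * (2 * (2 * N * B + B ^ 2) * (E * u₁)) := by
        refine mul_le_mul_of_nonneg_left (h3.trans ?_) (by positivity)
        exact mul_le_mul_of_nonneg_left hE (by positivity)
    _ = (u₁⁻¹ * u₁) * (2 * E * (2 * (s * N) * (s * B) + (s * B) * (s * B))) := by ring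
    _ = 2 * E * (2 * (s * B) + (s * B) * (s * B)) := by
        rw [inv_mul_cancel₀ hu₁.ne', hsN]; ring
    _ ≤ 2 * E * (2 * T + T * 1) := by
        refine mul_le_mul_of_nonneg_left ?_ (by positivity)
        exact add_le_add (by linarith)
          (mul_le_mul hsB (hsB.trans hT) hsB0 (hsB0.trans hsB))
    _ = 6 * E * T := by ring

/-- interior gradient estimate for positive strong solutions of
`½ aⁱʲ ∂_{ij} u + bⁱ ∂_i u + c u = 0` on `ℝᵈ`, with `a = σσᵀ` bounded,
uniformly continuous and uniformly elliptic, and `b`, `c` locally bounded and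
measurable.  A strong positive solution `u ∈ W^{2,p}_loc`, `p > d`, is encoded
by its (continuous) `C¹` representative together with its weak gradient and
weak Hessian. -/
theorem gradient_estimate {d : ℕ}
    (σm : Vec d → Matrix (Fin d) (Fin d) ℝ)
    (ha_bdd : ∃ M : ℝ, ∀ (x : Vec d) (i j : Fin d), |amat σm x i j| ≤ M)
    (ha_uc : ∀ i j, UniformContinuous fun x : Vec d => amat σm x i j)
    (ha_ell : ∃ θ > 0, ∀ (x v : Vec d), θ * (v ⬝ᵥ v) ≤ v ⬝ᵥ ((amat σm x) *ᵥ v))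
    (b : Vec d → Vec d) (c : Vec d → ℝ)
    (hb_meas : ∀ i, Measurable fun x => b x i) (hc_meas : Measurable c)
    (hb_locbdd : ∀ R : ℝ, ∃ M, ∀ x : Vec d, nrm x ≤ R → nrm (b x) ≤ M)
    (hc_locbdd : ∀ R : ℝ, ∃ M, ∀ x : Vec d, nrm x ≤ R → |c x| ≤ M)
    (p : ℝ) (hp : (d : ℝ) < p) :
    ∃ C₀ : ℝ, ∀ (u : Vec d → ℝ) (g : Vec d → Vec d)
      (H : Vec d → Matrix (Fin d) (Fin d) ℝ),
      IsW2loc p u g H → (∀ x, 0 < u x) → ContDiff ℝ 1 u →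
      (∀ᵐ x ∂(volume : Measure (Vec d)),
        (1 / 2) * trProd (amat σm x) (H x) + (b x) ⬝ᵥ (grad u x) + c x * u x = 0) →
      ∀ x : Vec d, nrm (grad u x) / u x ≤
        C₀ * (1 + ⨆ y : {y : Vec d // nrm (y - x) < 1},
          (nrm (b (y : Vec d)) + Real.sqrt |c (y : Vec d)|)) := by
  obtain ⟨M₀, hM₀⟩ := ha_bdd
  obtain ⟨θ, hθ, hell⟩ := ha_ell
  set M := max M₀ 1
  have hM1 : 1 ≤ M := le_max_right _ _
  have hM0 : 0 ≤ M := by linarith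
  have hM : ∀ x i j, |amat σm x i j| ≤ M := fun x i j => (hM₀ x i j).trans (le_max_left _ _)
  set κ := Real.sqrt (θ / (d + 1)) / 4 with hκ_def
  have hκ : 0 < κ := by positivity
  have hκθ : d * (2 * κ) ^ 2 < θ := by
    have e : (2 * κ) ^ 2 = θ / (d + 1) / 4 := by
      rw [hκ_def, mul_div_assoc', div_pow, mul_pow, Real.sq_sqrt (by positivity)]
      ring
    rw [e, mul_div_assoc', div_lt_iff₀ (by norm_num), mul_div_assoc', div_lt_iff₀ (by positivity)]
    nlinarith [mul_nonneg hθ.le (d.cast_nonneg (α := ℝ))]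
  obtain ⟨S, hS, hcore⟩ := exists_gradient_smallness (d := d) hκ
  set E := Real.exp (4 * d ^ 2 * M * S)
  have hE : 0 < E := Real.exp_pos _
  obtain ⟨ε, hε, hcore⟩ := hcore ((1 + 2 * d * M) * E + 1)
  have hε2 : Real.sqrt ε ^ 2 = ε := Real.sq_sqrt hε.le
  set ω := Real.sqrt ε * θ / (2 * (d + 1)) with hω_def
  have hω : 0 < ω := by positivity
  have hωε : 3 * (d ^ 2 * ω ^ 2) ≤ ε * θ ^ 2 := by
    rw [hω_def, div_pow, mul_pow, hε2, mul_div_assoc', mul_div_assoc', div_le_iff₀ (by positivity)]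
    have : 0 ≤ ε * θ ^ 2 := by positivity
    nlinarith [mul_nonneg this (d.cast_nonneg (α := ℝ)),
      mul_nonneg this (sq_nonneg (d : ℝ))]
  set τ := Real.sqrt ε / 2 with hτ_def
  have hτ : 0 < τ := by positivity
  have hτε : 3 * τ ^ 2 ≤ ε := by
    rw [hτ_def, div_pow, hε2]
    linarith
  obtain ⟨δ, hδ, hω⟩ := exists_radius_of_uniformContinuous ha_uc hω
  set k := d * M * (2 * S)
  have hk : 0 ≤ k := by positivity
  set ρ : ℝ := 1 / (d + 1) with hρ_def
  have hρ : 0 < ρ := by positivity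
  have hρd : d * ρ < 1 := by
    rw [hρ_def, mul_one_div, div_lt_one (by positivity)]
    linarith
  set C := 1 + 2 * k / ρ + k / δ + 6 * E / τ with hC
  have q1 : 0 ≤ 2 * k / ρ := by positivity
  have q2 : 0 ≤ k / δ := by positivity
  have q3 : 0 ≤ 6 * E / τ := by positivity
  have hC1 : 1 ≤ C := by linarith
  have hC0 : 0 < C := by linarith
  have hCρ : 2 * k ≤ C * ρ := (div_le_iff₀ hρ).1 (by linarith)
  have hCδ : k < C * δ := (div_lt_iff₀ hδ).1 (by linarith)
  have hCτ : 6 * E ≤ C * τ := (div_le_iff₀ hτ).1 (by linarith)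
  refine ⟨C, fun u g H hW hpos hu heq x₀ => ?_⟩
  obtain ⟨-, -, hHm, hgu, hHg, -, hHp⟩ := hW
  have hH2 := integrableOn_sq_hess hθ hell hb_locbdd hc_locbdd hp hHm hHp hu heq
  obtain ⟨B, hB⟩ : ∃ B, 1 + ⨆ y : {y : Vec d // nrm (y - x₀) < 1},
      (nrm (b (y : Vec d)) + Real.sqrt |c (y : Vec d)|) = B := ⟨_, rfl⟩
  obtain ⟨hB1, hBbc⟩ := coeff_le_iSup hb_locbdd hc_locbdd x₀ hB
  rw [hB]
  by_contra! hlt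
  obtain ⟨x₁, D, hD, hDρ, hx₁, hDN, hdoub⟩ := exists_doubling_point
    (N := fun x => nrm (grad u x) / u x)
    ((continuous_nrm.comp (continuous_grad hu)).div hu.continuous fun x => (hpos x).ne') hρ
    (mul_pos hC0 (by linarith : 0 < B)) hlt
  obtain ⟨N, hN⟩ : ∃ N, nrm (grad u x₁) / u x₁ = N := ⟨_, rfl⟩
  simp only [hN] at hDN hdoub
  have hN0 : 0 < N :=
    pos_of_mul_pos_right ((mul_pos hρ (mul_pos hC0 (by linarith : 0 < B))).trans_le hDN) hD.le
  have hCB : C * B ≤ N := by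
    refine le_of_mul_le_mul_left (hDN.trans ?_) hρ
    exact mul_le_mul_of_nonneg_right hDρ hN0.le
  have hsN : N⁻¹ * N = 1 := inv_mul_cancel₀ hN0.ne'
  have hs : 0 < N⁻¹ := inv_pos.2 hN0
  have hsB : N⁻¹ * B ≤ 1 / C := by
    rw [inv_mul_le_iff₀ hN0, mul_one_div, le_div_iff₀ hC0]
    linarith
  have hCB' : C ≤ C * B := le_mul_of_one_le_right hC0.le hB1
  have ht1 : N⁻¹ * k ≤ D / 2 := by
    rw [inv_mul_le_iff₀ hN0]
    linarith [mul_le_mul_of_nonneg_left hCB' hρ.le]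
  have ht2 : N⁻¹ * k < δ := by
    rw [inv_mul_lt_iff₀ hN0]
    exact hCδ.trans_le (mul_le_mul_of_nonneg_right (hCB'.trans hCB) hδ.le)
  have hNt : ∀ x, ‖x - x₁‖ ≤ N⁻¹ * k → nrm (grad u x) / u x ≤ 2 * N := fun x hx =>
    hdoub x (hx.trans ht1)
  refine false_of_doubling_point hθ hκ hS hε hM0 hκθ le_rfl hcore hM hu hpos
    (isWeakHess_of_isWeakPartial hgu hHg) hHm hH2 (hell x₁)
    (abs_apply_le_of_abs_mul_transpose_le hM1 (hM x₁)) hN hsN hs rfl hNt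
    (fun x hx => hω x x₁ (hx.trans_lt ht2)) ?_ hωε hτε
  filter_upwards [heq] with x hx hxt
  have hx₀ : nrm (x - x₀) < 1 := by
    have h1 := norm_add_le (x - x₁) (x₁ - x₀)
    rw [sub_add_sub_cancel] at h1
    exact ((nrm_le_mul_norm _).trans (mul_le_mul_of_nonneg_left (by linarith : ‖x - x₀‖ ≤ ρ)
      d.cast_nonneg)).trans_lt hρd
  have h := abs_lower_order_le hx (hBbc x hx₀).1 (hBbc x hx₀).2 (hNt x hxt) (hpos x) (hpos x₁)
    (le_exp_mul_of_doubling_point hu hpos hsN hN0.le rfl hNt hxt) hs.le (by linarith) hN0.le hsN hsB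
    ((div_le_one hC0).2 hC1)
  refine h.trans ?_
  rw [mul_one_div, div_le_iff₀ hC0]
  linarith

end RS
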